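/- Let q be a prime power. Then (q,3) ∈ B(3,2), except possibly for q ∈ {2, 4, 8, 16, 3, 9, 27, 81, 5, 25, 7, 49, 11, 121, 13, 17, 19, 23, 29, 31, 37, 43, 61, 67, 71, 79, 151, 211, 331}. -/

import Mathlib

open Polynomial

noncomputable section

/-- An element of a finite field is *primitive* if it generates the multiplicative group. -/
def IsPrimitiveElem {L : Type} [Field L] [Fintype L] (α : L) : Prop :=
  orderOf α = Fintype.card L - 1

/-- `β` is a *normal element* of `L` over `K`, where `n = [L : K]`:
the conjugates `β, β^q, …, β^(q^(n-1))` form a `K`-basis of `L`. -/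
def IsNormalElem (K : Type) {L : Type} [Field K] [Fintype K] [Field L] [Algebra K L]
    (n : ℕ) (β : L) : Prop :=
  LinearIndependent K (fun i : Fin n => β ^ Fintype.card K ^ (i : ℕ)) ∧
    Submodule.span K (Set.range fun i : Fin n => β ^ Fintype.card K ^ (i : ℕ)) = ⊤

/-- The set `Υ_Q(m₁, m₂)` of rational functions over the field `F` with `Q` elements. -/
def Upsilon (F : Type) [Field F] [Fintype F] (m₁ m₂ : ℕ) : Set (RatFunc F) :=
  {f | ∃ f₁ f₂ : F[X], f₂ ≠ 0 ∧
      f = algebraMap F[X] (RatFunc F) f₁ / algebraMap F[X] (RatFunc F) f₂ ∧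
      f₁.natDegree ≤ m₁ ∧ f₂.natDegree ≤ m₂ ∧ IsCoprime f₁ f₂ ∧
      ∃ (k : ℕ) (g : F[X]), 0 < k ∧ g.Monic ∧ Irreducible g ∧ g ≠ X ∧
        Nat.gcd k (Fintype.card F - 1) = 1 ∧
        g ^ k ∣ f₁ * f₂ ∧ ¬ g ^ (k + 1) ∣ f₁ * f₂}

/-- Evaluation of a rational function at a point of the same field (`0` if undefined). -/
def ratEval {F : Type} [Field F] (f : RatFunc F) (α : F) : F :=
  f.eval (RingHom.id F) α

/-- `α` is `s`-free. -/
def IsFree {F : Type} [Field F] (s : ℕ) (α : F) : Prop :=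
  α ≠ 0 ∧ ∀ d : ℕ, d ∣ s → d ≠ 1 → ¬ ∃ β : F, β ^ d = α

/-- The `F_q[x]`-module action `h ∘ β = ∑ hᵢ β^(qⁱ)` on `L`. -/
def polyAct {K L : Type} [Field K] [Fintype K] [Field L] [Algebra K L]
    (h : K[X]) (β : L) : L :=
  h.sum fun i a => algebraMap K L a * β ^ Fintype.card K ^ i

/-- `α` is `g`-free with respect to the `F_q[x]`-module structure of `L`. -/
def IsPolyFree (K : Type) {L : Type} [Field K] [Fintype K] [Field L] [Algebra K L]
    (g : K[X]) (α : L) : Prop :=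
  ∀ h : K[X], h.Monic → h ∣ g → (∃ lam : L, α = polyAct h lam) → h = 1

/-- `N_f(e₁, e₂, g)`: the number of `α ∈ L` such that `α` is `e₁`-free,
`f(α)` is `e₂`-free and `α` is `g`-free. -/
def NElems (K : Type) {L : Type} [Field K] [Fintype K] [Field L] [Fintype L] [Algebra K L]
    (f : RatFunc L) (e₁ e₂ : ℕ) (g : K[X]) : ℕ :=
  Nat.card {α : L | IsFree e₁ α ∧ IsFree e₂ (ratEval f α) ∧ IsPolyFree K g α}

/-- `W(ℓ)`: the number of squarefree divisors of `ℓ`. -/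
def Wnat (ℓ : ℕ) : ℕ := (ℓ.divisors.filter Squarefree).card

/-- `W_q(g)`: the number of monic squarefree divisors of `g` in `F_q[x]`. -/
def Wpoly {K : Type} [Field K] (g : K[X]) : ℕ :=
  Nat.card {h : K[X] // h.Monic ∧ Squarefree h ∧ h ∣ g}

/-- `Φ(g) = |(F_q[x]/(g))ˣ|`. -/
def PhiPoly {K : Type} [Field K] (g : K[X]) : ℕ :=
  Nat.card ((K[X] ⧸ Ideal.span ({g} : Set K[X]))ˣ)

/-- `(q, n) ∈ B(m₁, m₂)`: for every `f ∈ Υ_{qⁿ}(m₁, m₂)` there is a primitive element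
`α` of `F_{qⁿ}`, normal over `F_q`, with `f(α)` also primitive. -/
def memB (m₁ m₂ q n : ℕ) : Prop :=
  ∀ (K L : Type) [Field K] [Field L] [Fintype K] [Fintype L] [Algebra K L],
    Fintype.card K = q → Fintype.card L = q ^ n →
    ∀ f ∈ Upsilon L m₁ m₂,
      ∃ α : L, IsPrimitiveElem α ∧ IsNormalElem K n α ∧ IsPrimitiveElem (ratEval f α)

/-- `𝔑(q, n)`: the number of primitive elements of `F_{qⁿ}` that are normal over `F_q`. -/
def NNum (K L : Type) [Field K] [Fintype K] [Field L] [Fintype L] [Algebra K L] (n : ℕ) : ℕ :=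
  Nat.card {α : L | IsPrimitiveElem α ∧ IsNormalElem K n α}

end

/-! Part P1 -/

/-- order of `Σ b_j (X-η)^{uj}` at `η`. -/
lemma st_ord {𝔼 : Type} [Field 𝔼] (η : 𝔼) (u B J : ℕ) (hBu : B ≤ u) (b : ℕ → 𝔼[X])
    (hb : ∀ j, (b j).degree < B) (hne : ∃ j < J, b j ≠ 0) :
    (∑ j ∈ Finset.range J, b j * ((X - C η) ^ u) ^ j) ≠ 0 ∧
    ∃ j e, e < B ∧
      (∑ j ∈ Finset.range J, b j * ((X - C η) ^ u) ^ j).rootMultiplicity η = u * j + e := by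
  classical
  obtain ⟨j0, ⟨hj0, hbj0⟩, hmin⟩ : ∃ j, (j < J ∧ b j ≠ 0) ∧ ∀ i < j, ¬ (i < J ∧ b i ≠ 0) :=
    ⟨Nat.find hne, Nat.find_spec hne, fun i hi => Nat.find_min hne hi⟩
  set e := (b j0).rootMultiplicity η with he
  have heB : e < B := by
    have h1 : ((b j0).rootMultiplicity η) ≤ (b j0).natDegree := by
      have := Polynomial.natDegree_le_of_dvd (Polynomial.pow_rootMultiplicity_dvd (b j0) η) hbj0
      simpa using this
    have h2 := (Polynomial.natDegree_lt_iff_degree_lt hbj0).2 (hb j0)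
    omega
  have hmon : ((X - C η) ^ (u * j0) : 𝔼[X]) ≠ 0 := pow_ne_zero _ (X_sub_C_ne_zero η)
  -- rest
  obtain ⟨R, hR⟩ : ∃ R : 𝔼[X], (∑ j ∈ Finset.range J, b j * ((X - C η) ^ u) ^ j) =
      b j0 * (X - C η) ^ (u * j0) + (X - C η) ^ (u * j0 + u) * R := by
    refine ⟨∑ j ∈ (Finset.range J).filter (fun j => j0 < j), b j * (X - C η) ^ (u * (j - j0 - 1)), ?_⟩
    rw [Finset.mul_sum, ← Finset.add_sum_erase _ _ (Finset.mem_range.2 hj0), ← pow_mul]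
    congr 1
    have hsub : (Finset.range J).filter (fun j => j0 < j) ⊆ (Finset.range J).erase j0 := by
      intro j hj
      simp only [Finset.mem_filter, Finset.mem_range, Finset.mem_erase] at hj ⊢
      omega
    rw [← Finset.sum_subset hsub]
    · refine Finset.sum_congr rfl fun j hj => ?_
      simp only [Finset.mem_filter, Finset.mem_range] at hj
      obtain ⟨t, rfl⟩ : ∃ t, j = j0 + t + 1 := ⟨j - j0 - 1, by omega⟩
      have : j0 + t + 1 - j0 - 1 = t := by omega
      rw [this]; ring
    · intro j hj hj'
      simp only [Finset.mem_filter, Finset.mem_range, Finset.mem_erase] at hj hj'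
      have hlt : j < j0 := by omega
      have := hmin j hlt
      have h0 : b j = 0 := by
        by_contra h
        exact this ⟨hj.2, h⟩
      rw [h0, zero_mul]
  have hndvd : ¬ (X - C η) ^ (u * j0 + e + 1) ∣ (∑ j ∈ Finset.range J, b j * ((X - C η) ^ u) ^ j) := by
    rw [hR]
    intro hd
    have h1 : (X - C η) ^ (u * j0 + e + 1) ∣ (X - C η) ^ (u * j0 + u) * R :=
      Dvd.dvd.mul_right (pow_dvd_pow _ (by omega)) _
    have h2 := (dvd_add_left h1).1 hd
    have h3 : (X - C η) ^ (e + 1) * (X - C η) ^ (u * j0) ∣ b j0 * (X - C η) ^ (u * j0) := by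
      have e1 : (X - C η) ^ (e + 1) * (X - C η) ^ (u * j0) = (X - C η) ^ (u * j0 + e + 1) := by ring
      rw [e1]; exact h2
    have h4 := (mul_dvd_mul_iff_right hmon).1 h3
    have := (Polynomial.le_rootMultiplicity_iff hbj0).2 h4
    omega
  have hdvd : (X - C η) ^ (u * j0 + e) ∣ (∑ j ∈ Finset.range J, b j * ((X - C η) ^ u) ^ j) := by
    rw [hR]
    refine dvd_add ?_ (Dvd.dvd.mul_right (pow_dvd_pow _ (by omega)) _)
    rw [pow_add, mul_comm]
    exact mul_dvd_mul (Polynomial.pow_rootMultiplicity_dvd (b j0) η) dvd_rfl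
  have hP : (∑ j ∈ Finset.range J, b j * ((X - C η) ^ u) ^ j) ≠ 0 := by
    intro h; rw [h] at hndvd; exact hndvd (dvd_zero _)
  refine ⟨hP, j0, e, heB, le_antisymm ?_ ((Polynomial.le_rootMultiplicity_iff hP).2 hdvd)⟩
  by_contra hlt
  exact hndvd ((Polynomial.le_rootMultiplicity_iff hP).1 (by omega))

/-- change of basis -/
lemma st_basis {𝔼 : Type} [Field 𝔼] (p s : ℕ) [ExpChar 𝔼 p] (η : 𝔼) (B J : ℕ) (b : ℕ → 𝔼[X])
    (hb : ∀ j, (b j).degree < B) :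
    ∃ b' : ℕ → 𝔼[X], (∀ j, (b' j).degree < B) ∧
      (∑ j ∈ Finset.range J, b j * ((X : 𝔼[X]) ^ p ^ s) ^ j) =
      ∑ j ∈ Finset.range J, b' j * ((X - C η) ^ p ^ s) ^ j := by
  induction J generalizing b with
  | zero => exact ⟨b, hb, by simp⟩
  | succ J ih =>
    obtain ⟨c, hc, hcs⟩ := ih (fun j => b (j + 1)) (fun j => hb _)
    have hX : (X : 𝔼[X]) ^ p ^ s = (X - C η) ^ p ^ s + C (η ^ p ^ s) := by
      rw [sub_pow_expChar_pow, C_pow]; ring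
    set c' : ℕ → 𝔼[X] := fun j => if j < J then c j else 0 with hc'
    have hc'd : ∀ j, (c' j).degree < B := by
      intro j; simp only [hc']; split_ifs
      · exact hc j
      · simp
    refine ⟨fun j => (if j = 0 then b 0 else c' (j - 1)) + C (η ^ p ^ s) * c' j, ?_, ?_⟩
    · intro j
      refine (degree_add_le _ _).trans_lt (max_lt ?_ ?_)
      · split_ifs
        · exact hb 0
        · exact hc'd _
      · refine lt_of_le_of_lt ?_ (hc'd j)
        refine (degree_mul_le _ _).trans ?_
        calc _ ≤ 0 + (c' j).degree := by gcongr; exact degree_C_le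
          _ = _ := zero_add _
    · rw [Finset.sum_range_succ']
      have h1 : ∑ k ∈ Finset.range J, b (k + 1) * ((X : 𝔼[X]) ^ p ^ s) ^ (k + 1) =
          X ^ p ^ s * ∑ j ∈ Finset.range J, c' j * ((X - C η) ^ p ^ s) ^ j := by
        have h2 : ∑ j ∈ Finset.range J, c' j * ((X - C η) ^ p ^ s) ^ j =
          ∑ j ∈ Finset.range J, c j * ((X - C η) ^ p ^ s) ^ j :=
          Finset.sum_congr rfl fun j hj => by simp [hc', Finset.mem_range.1 hj]
        rw [h2, ← hcs, Finset.mul_sum]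
        refine Finset.sum_congr rfl fun j _ => by ring
      rw [h1, hX, add_mul]
      simp only [add_mul, Finset.sum_add_distrib]
      have h3 : ∑ x ∈ Finset.range (J + 1), C (η ^ p ^ s) * c' x * ((X - C η) ^ p ^ s) ^ x =
        C (η ^ p ^ s) * ∑ j ∈ Finset.range J, c' j * ((X - C η) ^ p ^ s) ^ j := by
        rw [Finset.sum_range_succ, Finset.mul_sum]
        simp [hc', mul_assoc]
      rw [h3, Finset.sum_range_succ', Finset.mul_sum]
      simp only [Nat.succ_ne_zero, if_false, if_true, Nat.add_sub_cancel]
      have h4 : ∀ k, c' k * ((X - C η) ^ p ^ s) ^ (k + 1) = (X - C η) ^ p ^ s * (c' k * ((X - C η) ^ p ^ s) ^ k) := by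
        intro k; ring
      simp only [h4]
      ring

lemma st_rm_pow {𝔼 : Type} [Field 𝔼] {F : 𝔼[X]} {η : 𝔼} {n : ℕ} :
    (F ^ n).rootMultiplicity η = n * F.rootMultiplicity η := by
  classical
  rw [← Polynomial.count_roots, ← Polynomial.count_roots, Polynomial.roots_pow, Multiset.count_nsmul]

lemma st_arith (d B M U N k x y : ℤ) (hd : 0 < d) (h1 : d * B + d * M ≤ U)
    (h2 : x ≤ B - 1) (h3 : -(B - 1) ≤ x) (h4 : y ≤ d) (h5 : -d ≤ y) (h6 : k ≤ M) (h7 : 0 ≤ k)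
    (hz : U * N = d * x + y * k) : N = 0 := by
  have a1 : d * x ≤ d * (B - 1) := by nlinarith
  have a2 : d * (-(B - 1)) ≤ d * x := by nlinarith
  have a3 : y * k ≤ d * k := by nlinarith
  have a4 : -d * k ≤ y * k := by nlinarith
  have a5 : d * k ≤ d * M := by nlinarith
  have b1 : U * N < U * 1 := by nlinarith
  have b2 : U * (-1) < U * N := by nlinarith
  have hU : 0 < U := by nlinarith
  have c1 := lt_of_mul_lt_mul_left b1 hU.le
  have c2 := lt_of_mul_lt_mul_left b2 hU.le
  omega

/-- independence -/
lemma st_indep {𝔼 : Type} [Field 𝔼] (p s : ℕ) [ExpChar 𝔼 p] (η : 𝔼) (B J d v : ℕ) (F : 𝔼[X])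
    (hF : F ≠ 0) (hu : p ^ s = d * v + 1) (hd : 0 < d)
    (hk : Nat.Coprime (F.rootMultiplicity η) d)
    (hB : d * B + d * F.natDegree ≤ d * v + 1)
    (b : ℕ → ℕ → 𝔼[X]) (hb : ∀ i j, (b i j).degree < B)
    (h0 : ∑ i ∈ Finset.range d, (∑ j ∈ Finset.range J, b i j * ((X : 𝔼[X]) ^ p ^ s) ^ j) * (F ^ v) ^ i = 0) :
    ∀ i < d, ∀ j < J, b i j = 0 := by
  classical
  set k := F.rootMultiplicity η with hkdef
  have hkM : k ≤ F.natDegree := by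
    have := Polynomial.natDegree_le_of_dvd (Polynomial.pow_rootMultiplicity_dvd F η) hF
    simpa using this
  have hBu : B ≤ p ^ s := by
    rw [hu]
    nlinarith
  set P : ℕ → 𝔼[X] := fun i => ∑ j ∈ Finset.range J, b i j * ((X : 𝔼[X]) ^ p ^ s) ^ j with hP
  have hPne : ∀ i, (∃ j < J, b i j ≠ 0) → P i ≠ 0 := by
    intro i hi
    have := (st_ord (0 : 𝔼) (p ^ s) B J hBu (b i) (hb i) hi).1
    simpa [hP] using this
  have hord : ∀ i, P i ≠ 0 → ∃ j e, e < B ∧ (P i).rootMultiplicity η = p ^ s * j + e := by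
    intro i hi
    obtain ⟨b', hb', hs⟩ := st_basis p s η B J (b i) (hb i)
    have hne : ∃ j < J, b' j ≠ 0 := by
      by_contra hcon
      push Not at hcon
      apply hi
      simp only [hP]
      rw [hs]
      refine Finset.sum_eq_zero fun j hj => ?_
      rw [hcon j (Finset.mem_range.1 hj), zero_mul]
    obtain ⟨_, h⟩ := st_ord η (p ^ s) B J hBu b' hb' hne
    simp only [hP]
    rw [hs]
    exact h
  by_contra hcon
  push Not at hcon
  obtain ⟨i1, hi1, j1, hj1, hne1⟩ := hcon
  set I := (Finset.range d).filter (fun i => P i ≠ 0) with hI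
  have hIne : I.Nonempty := ⟨i1, by
    simp only [hI, Finset.mem_filter, Finset.mem_range]
    exact ⟨hi1, hPne i1 ⟨j1, hj1, hne1⟩⟩⟩
  obtain ⟨i0, hi0, hmin⟩ := Finset.exists_min_image I
    (fun i => (P i * (F ^ v) ^ i).rootMultiplicity η) hIne
  have hGne : ∀ i, (F ^ v) ^ i ≠ 0 := fun i => pow_ne_zero _ (pow_ne_zero _ hF)
  have hmul : ∀ i ∈ I, P i * (F ^ v) ^ i ≠ 0 := by
    intro i hi
    exact mul_ne_zero (Finset.mem_filter.1 hi).2 (hGne i)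
  have hmult : ∀ i ∈ I, (P i * (F ^ v) ^ i).rootMultiplicity η =
      (P i).rootMultiplicity η + i * v * k := by
    intro i hi
    rw [Polynomial.rootMultiplicity_mul (hmul i hi), ← pow_mul, st_rm_pow, hkdef]
    ring
  have hinj : ∀ i ∈ I, ∀ i' ∈ I, (P i * (F ^ v) ^ i).rootMultiplicity η =
      (P i' * (F ^ v) ^ i').rootMultiplicity η → i = i' := by
    intro i hi i' hi' heq
    rw [hmult i hi, hmult i' hi'] at heq
    obtain ⟨j, e, he, hj⟩ := hord i (Finset.mem_filter.1 hi).2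
    obtain ⟨j', e', he', hj'⟩ := hord i' (Finset.mem_filter.1 hi').2
    rw [hj, hj', hu] at heq
    have hid : i < d := Finset.mem_range.1 (Finset.mem_filter.1 hi).1
    have hid' : i' < d := Finset.mem_range.1 (Finset.mem_filter.1 hi').1
    -- integers
    have hz : ((d * v + 1 : ℕ) : ℤ) * ((d:ℤ) * j + i * k - d * j' - i' * k) = d * (e' - e) + (i - i') * k := by
      have : (((d * v + 1) * j + e + i * v * k : ℕ) : ℤ) = (((d * v + 1) * j' + e' + i' * v * k : ℕ) : ℤ) := by
        exact_mod_cast heq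
      push_cast at this ⊢
      linear_combination (d : ℤ) * this
    have hN : ((d:ℤ) * j + i * k - d * j' - i' * k) = 0 := by
      have h1 : (d:ℤ) * B + d * F.natDegree ≤ ((d * v + 1 : ℕ) : ℤ) := by exact_mod_cast hB
      exact st_arith d B F.natDegree _ _ k (e' - e) (i - i') (by exact_mod_cast hd) h1
        (by omega) (by omega) (by omega) (by omega) (by exact_mod_cast hkM) (by positivity) hz
    have hdvd : (d : ℤ) ∣ (i - i') * k := ⟨j' - j, by linear_combination hN⟩
    have hcop : IsCoprime (d : ℤ) (k : ℤ) := by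
      rw [Nat.isCoprime_iff_coprime]; exact hk.symm
    have hdvd2 := hcop.dvd_of_dvd_mul_right hdvd
    have : (i:ℤ) - i' = 0 := Int.eq_zero_of_abs_lt_dvd hdvd2 (by rw [abs_lt]; omega)
    omega
  -- contradiction
  set m := (P i0 * (F ^ v) ^ i0).rootMultiplicity η with hm
  have hi0d : i0 ∈ Finset.range d := (Finset.mem_filter.1 hi0).1
  rw [← Finset.add_sum_erase _ _ hi0d] at h0
  have hdv : (X - C η) ^ (m + 1) ∣ ∑ i ∈ (Finset.range d).erase i0, P i * (F ^ v) ^ i := by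
    refine Finset.dvd_sum fun i hi => ?_
    by_cases hPi : P i = 0
    · rw [hPi, zero_mul]; exact dvd_zero _
    · have hiI : i ∈ I := Finset.mem_filter.2 ⟨(Finset.mem_erase.1 hi).2, hPi⟩
      rw [← Polynomial.le_rootMultiplicity_iff (hmul i hiI)]
      have h1 := hmin i hiI
      have h2 : m ≠ (P i * (F ^ v) ^ i).rootMultiplicity η := by
        intro h
        exact (Finset.mem_erase.1 hi).1 (hinj i0 hi0 i hiI h).symm
      omega
  have hdv2 : (X - C η) ^ (m + 1) ∣ P i0 * (F ^ v) ^ i0 := by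
    have : P i0 * (F ^ v) ^ i0 = - ∑ i ∈ (Finset.range d).erase i0, P i * (F ^ v) ^ i := by
      linear_combination h0
    rw [this]
    exact (dvd_neg).2 hdv
  have := (Polynomial.le_rootMultiplicity_iff (hmul i0 hi0)).2 hdv2
  omega

/-! Part P1b -/

lemma st_arith2 (d v c M B : ℕ) (hd : 0 < d) (hc : c = 4 * M + 6) (hv : 2 * M + 8 ≤ v) (hB : B + M = v) :
    (d * v + 1) * B + (v + c) + d * v * M < d * (v + c) * B := by
  subst hc
  have h2 : v ≤ 2 * B := by omega
  have h3 : d * v * M ≤ d * (2 * B) * M := by gcongr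
  have h4 : B ≤ d * B := Nat.le_mul_of_pos_left _ hd
  have h5 : d * (v + (4 * M + 6)) * B = d * v * B + d * B * (4 * M) + 6 * (d * B) := by ring
  have h6 : d * (2 * B) * M = 2 * (d * B * M) := by ring
  have h7 : d * B * (4 * M) = 4 * (d * B * M) := by ring
  have h8 : (d * v + 1) * B = d * v * B + B := by ring
  have h9 : d * B * M ≥ 4 * M := by
    calc 4 * M ≤ (d * B) * M := by gcongr; omega
      _ = _ := rfl
  rw [h5, h8]; rw [h6] at h3; rw [h7]
  omega

lemma stepanov_main {K 𝔼 : Type} [Field K] [Fintype K] [Field 𝔼] [Algebra K 𝔼] (p s : ℕ) [ExpChar K p]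
    (hq : Fintype.card K = (p ^ s) ^ 2) (d v : ℕ) (hu : p ^ s = d * v + 1) (hd : 0 < d)
    (F : K[X]) (hF : F ≠ 0) (η : 𝔼)
    (hk : Nat.Coprime ((F.map (algebraMap K 𝔼)).rootMultiplicity η) d)
    (hv : 2 * F.natDegree + 8 ≤ v) (a : K) (ha : a ≠ 0) (S : Finset K)
    (hS : ∀ x ∈ S, F.eval x ^ (v * (p ^ s + 1)) = a) :
    d * S.card ≤ (p ^ s) ^ 2 + (1 + d * (4 * F.natDegree + 6) + d * F.natDegree) * p ^ s := by
  classical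
  set M := F.natDegree with hM
  set u := p ^ s with hudef
  obtain ⟨B, hB⟩ : ∃ B, B + M = v := ⟨v - M, by omega⟩
  obtain ⟨c, hc⟩ : ∃ c, c = 4 * M + 6 := ⟨_, rfl⟩
  set J := v + c with hJ
  set T := u * B + J + d * v * M with hT
  have hcount : T < d * J * B := by
    have := st_arith2 d v c M B hd hc hv hB
    rw [hT, hJ, hu]; exact this
  have hupos : 0 < u := by omega
  set G := F ^ v with hG
  have hGdeg : G.natDegree ≤ v * M := by rw [hG, hM]; exact natDegree_pow_le
  -- the map
  let Φ : (Fin d × Fin J → K[X]) → K[X] := fun b =>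
    ∑ ij : Fin d × Fin J, C (a ^ (ij.1 : ℕ)) * (b ij) ^ u * X ^ (ij.2 : ℕ) * G ^ (d - 1 - (ij.1 : ℕ))
  have hΦsub : ∀ b b', Φ (b - b') = Φ b - Φ b' := by
    intro b b'
    simp only [Φ]
    rw [← Finset.sum_sub_distrib]
    refine Finset.sum_congr rfl fun ij _ => ?_
    rw [Pi.sub_apply, hudef, sub_pow_expChar_pow]
    ring
  have hΦdeg : ∀ b : Fin d × Fin J → K[X], (∀ ij, (b ij).degree < B) → (Φ b).degree < T := by
    intro b hb
    have h1 : (Φ b) ∈ Polynomial.degreeLT K T := by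
      refine Submodule.sum_mem _ fun ij _ => ?_
      rw [Polynomial.mem_degreeLT]
      by_cases h0 : b ij = 0
      · rw [h0, zero_pow hupos.ne']
        simp
      have hbd := (Polynomial.natDegree_lt_iff_degree_lt h0).2 (hb ij)
      have hi := ij.1.2
      have hj := ij.2.2
      have hn : (C (a ^ (ij.1 : ℕ)) * (b ij) ^ u * X ^ (ij.2 : ℕ) * G ^ (d - 1 - (ij.1 : ℕ))).natDegree
          ≤ u * (b ij).natDegree + ij.2 + (d - 1 - ij.1) * (v * M) := by
        refine natDegree_mul_le.trans ?_
        refine add_le_add (natDegree_mul_le.trans ?_) (natDegree_pow_le.trans (by gcongr))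
        refine add_le_add (natDegree_C_mul_le _ _ |>.trans natDegree_pow_le) ?_
        simp
      refine lt_of_le_of_lt degree_le_natDegree ?_
      rw [Nat.cast_lt]
      refine lt_of_le_of_lt hn ?_
      have h2 : u * (b ij).natDegree ≤ u * B := by gcongr
      have h3 : (d - 1 - (ij.1:ℕ)) * (v * M) ≤ d * (v * M) := by gcongr; omega
      rw [← mul_assoc d] at h3
      omega
    exact Polynomial.mem_degreeLT.1 h1
  -- pigeonhole
  have hcardLT : ∀ n, Nat.card (Polynomial.degreeLT K n) = Fintype.card K ^ n := by
    intro n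
    rw [Nat.card_congr (Polynomial.degreeLTEquiv K n).toEquiv]
    simp
  have hfin : ∀ n, Finite (Polynomial.degreeLT K n) := fun n =>
    Finite.of_equiv _ (Polynomial.degreeLTEquiv K n).toEquiv.symm
  let Ψ : (Fin d × Fin J → Polynomial.degreeLT K B) → Polynomial.degreeLT K T := fun b =>
    ⟨Φ (fun ij => (b ij : K[X])), Polynomial.mem_degreeLT.2
      (hΦdeg _ fun ij => Polynomial.mem_degreeLT.1 (b ij).2)⟩
  have hninj : ¬ Function.Injective Ψ := by
    intro hinj
    have h1 := Nat.card_le_card_of_injective Ψ hinj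
    rw [Nat.card_fun, hcardLT, hcardLT, ← pow_mul] at h1
    have h2 : Nat.card (Fin d × Fin J) = d * J := by simp
    rw [h2] at h1
    have hK : 1 < Fintype.card K := Fintype.one_lt_card
    have := (Nat.pow_le_pow_iff_right hK).1 h1
    rw [mul_comm B] at this
    omega
  obtain ⟨b1, b2, hb12, hbne⟩ : ∃ b1 b2, Ψ b1 = Ψ b2 ∧ b1 ≠ b2 := by
    simpa [Function.Injective] using hninj
  set b : Fin d × Fin J → K[X] := (fun ij => (b1 ij : K[X])) - (fun ij => (b2 ij : K[X])) with hb
  have hbdeg : ∀ ij, (b ij).degree < B := fun ij =>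
    Polynomial.mem_degreeLT.1 (Submodule.sub_mem _ (b1 ij).2 (b2 ij).2)
  have hΦ0 : Φ b = 0 := by
    rw [hb, hΦsub, sub_eq_zero]
    exact congrArg Subtype.val hb12
  have hbne0 : ∃ ij, b ij ≠ 0 := by
    by_contra hcon
    push Not at hcon
    apply hbne
    funext ij
    have := hcon ij
    rw [hb, Pi.sub_apply, sub_eq_zero] at this
    exact Subtype.ext this
  set h : K[X] := ∑ ij : Fin d × Fin J, b ij * (X ^ u) ^ (ij.2 : ℕ) * G ^ (ij.1 : ℕ) with hh
  -- h nonzero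
  have hhne : h ≠ 0 := by
    intro h0
    have : ExpChar 𝔼 p := expChar_of_injective_algebraMap (algebraMap K 𝔼).injective p
    let bb : ℕ → ℕ → 𝔼[X] := fun i j => if hij : i < d ∧ j < J then
      (b (⟨i, hij.1⟩, ⟨j, hij.2⟩)).map (algebraMap K 𝔼) else 0
    have hbb : ∀ i j, (bb i j).degree < B := by
      intro i j
      simp only [bb]
      split_ifs
      · rw [degree_map]; exact hbdeg _
      · simp
    have key := st_indep p s η B J d v (F.map (algebraMap K 𝔼))
      ((Polynomial.map_ne_zero_iff (algebraMap K 𝔼).injective).2 hF) hu hd hk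
      (by rw [natDegree_map, ← hM]; nlinarith) bb hbb ?_
    · obtain ⟨ij, hij⟩ := hbne0
      have := key ij.1 ij.1.2 ij.2 ij.2.2
      simp only [bb, ij.1.2, ij.2.2, and_self, dif_pos, Fin.eta, Prod.mk.eta] at this
      exact hij ((Polynomial.map_eq_zero (algebraMap K 𝔼)).1 this)
    · have h1 := congrArg (Polynomial.mapRingHom (algebraMap K 𝔼)) h0
      rw [hh, map_sum, map_zero, Fintype.sum_prod_type] at h1
      rw [← h1, Finset.sum_range]
      refine Finset.sum_congr rfl fun i _ => ?_
      rw [Finset.sum_range, Finset.sum_mul]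
      refine Finset.sum_congr rfl fun j _ => ?_
      simp only [bb, i.2, j.2, and_self, dif_pos, Fin.eta, map_mul, map_pow,
        Polynomial.coe_mapRingHom, Polynomial.map_X, hG]
      rfl
  have hhdeg : h.natDegree ≤ B + J * u + d * (v * M) := by
    refine natDegree_sum_le_of_forall_le _ _ fun ij _ => ?_
    have hi := ij.1.2
    have hj := ij.2.2
    refine natDegree_mul_le.trans ?_
    refine add_le_add (natDegree_mul_le.trans ?_) (natDegree_pow_le.trans (by gcongr))
    refine add_le_add ?_ ?_
    · by_cases h0 : b ij = 0
      · simp [h0]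
      · exact ((Polynomial.natDegree_lt_iff_degree_lt h0).2 (hbdeg ij)).le
    · rw [← pow_mul, natDegree_X_pow, mul_comm]; gcongr
  have hroot : ∀ x ∈ S, h.IsRoot x := by
    intro x hx
    have hx' := hS x hx
    have hGx : G.eval x ^ (u + 1) = a := by rw [hG, eval_pow, ← pow_mul]; exact hx'
    have hGne : G.eval x ≠ 0 := by
      intro h0; rw [h0, zero_pow (by omega)] at hGx; exact ha hGx.symm
    have hxq : x ^ (u * u) = x := by rw [← sq, ← hq]; exact FiniteField.pow_card x
    have hmul : (h.eval x) ^ u * G.eval x ^ (d - 1) = (Φ b).eval x := by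
      simp only [Φ, hh, eval_finsetSum]
      rw [hudef, sum_pow_char_pow, Finset.sum_mul]
      refine Finset.sum_congr rfl fun ij _ => ?_
      have hi := ij.1.2
      simp only [eval_mul, eval_pow, eval_X, eval_C, mul_pow]
      rw [← hudef]
      have e1 : ((x ^ u) ^ (ij.2:ℕ)) ^ u = x ^ (ij.2:ℕ) := by
        rw [← pow_mul, ← pow_mul, show u * ((ij.2:ℕ) * u) = u * u * ij.2 by ring, pow_mul, hxq]
      have e2 : (eval x G ^ (ij.1:ℕ)) ^ u * eval x G ^ (d - 1) = a ^ (ij.1:ℕ) * eval x G ^ (d - 1 - (ij.1:ℕ)) := by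
        rw [← hGx, ← pow_mul, ← pow_mul, ← pow_add, ← pow_add]
        congr 1
        obtain ⟨t, ht⟩ : ∃ t, d = ij.1 + t + 1 := ⟨d - ij.1 - 1, by omega⟩
        have e3 : d - 1 - (ij.1:ℕ) = t := by omega
        have e4 : d - 1 = ij.1 + t := by omega
        rw [e3, e4]; ring
      rw [e1]
      linear_combination (eval x (b ij) ^ u * x ^ (ij.2:ℕ)) * e2
    rw [hΦ0, eval_zero] at hmul
    rcases mul_eq_zero.1 hmul with h1 | h1
    · exact pow_eq_zero_iff hupos.ne' |>.1 h1
    · exact absurd h1 (pow_ne_zero _ hGne)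
  have hSle : S.card ≤ h.natDegree := by
    refine Polynomial.card_le_degree_of_subset_roots (p := h) ?_
    intro x hx
    exact (Polynomial.mem_roots hhne).2 (hroot x hx)
  have hfin2 : d * S.card ≤ d * (v + (v + c) * u + d * (v * M)) := by
    gcongr
    refine hSle.trans (hhdeg.trans ?_)
    gcongr; omega
  refine hfin2.trans ?_
  subst hc
  have e1 : d * v ≤ u := by omega
  calc d * (v + (v + (4 * M + 6)) * u + d * (v * M))
      = d * v + (d * v) * u + d * (4 * M + 6) * u + (d * M) * (d * v) := by ring
    _ ≤ u + u * u + d * (4 * M + 6) * u + (d * M) * u := by gcongr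
    _ = _ := by ring

lemma stepanov {K 𝔼 : Type} [Field K] [Fintype K] [Field 𝔼] [Algebra K 𝔼] (p s : ℕ) [ExpChar K p]
    (hq : Fintype.card K = (p ^ s) ^ 2) (d v : ℕ) (hu : p ^ s = d * v + 1) (hd : 0 < d)
    (F : K[X]) (hF : F ≠ 0) (η : 𝔼)
    (hk : Nat.Coprime ((F.map (algebraMap K 𝔼)).rootMultiplicity η) d)
    (a : K) (ha : a ≠ 0) (S : Finset K)
    (hS : ∀ x ∈ S, F.eval x ^ (v * (p ^ s + 1)) = a) (M : ℕ) (hM : F.natDegree ≤ M) :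
    d * S.card ≤ (p ^ s) ^ 2 + (1 + d * (4 * M + 6) + d * M + d * (d * (2 * M + 8) + 1)) * p ^ s := by
  by_cases hv : 2 * F.natDegree + 8 ≤ v
  · refine (stepanov_main p s hq d v hu hd F hF η hk hv a ha S hS).trans ?_
    refine Nat.add_le_add_left (Nat.mul_le_mul_right _ ?_) _
    calc 1 + d * (4 * F.natDegree + 6) + d * F.natDegree ≤ 1 + d * (4 * M + 6) + d * M := by gcongr
      _ ≤ _ := Nat.le_add_right _ _
  · push Not at hv
    have h1 : S.card ≤ p ^ s * p ^ s := by
      rw [← sq, ← hq]; exact Finset.card_le_univ S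
    have h2 : p ^ s ≤ d * (2 * M + 8) + 1 := by
      rw [hu]; gcongr; omega
    calc d * S.card ≤ d * (p ^ s * p ^ s) := by gcongr
      _ ≤ d * ((d * (2 * M + 8) + 1) * p ^ s) := by gcongr
      _ = (d * (d * (2 * M + 8) + 1)) * p ^ s := by ring
      _ ≤ _ := by
        refine le_add_of_nonneg_of_le (by positivity) ?_
        gcongr
        exact Nat.le_add_left _ _

/-! Part P2 -/

lemma pw_pow_bound (x B C : ℝ) (hB : 0 < B) (h : ∀ r : ℕ, 1 ≤ r → x ^ r ≤ C * B ^ r) : x ≤ B := by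
  by_contra hcon
  push Not at hcon
  have h1 : 1 < x / B := (one_lt_div hB).2 hcon
  obtain ⟨n, hn⟩ := pow_unbounded_of_one_lt (max C 1) h1
  have hn0 : 1 ≤ n := by
    rcases Nat.eq_zero_or_pos n with h0 | h0
    · subst h0
      have := le_max_right C 1
      simp only [pow_zero] at hn
      linarith
    · exact h0
  have h2 := h n hn0
  rw [div_pow] at hn
  have h3 : max C 1 * B ^ n < x ^ n := (lt_div_iff₀ (by positivity)).1 hn
  have h4 : C * B ^ n ≤ max C 1 * B ^ n := by gcongr; exact le_max_left _ _
  linarith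

lemma pw_roots_bound (s : Multiset ℂ) (B C : ℝ) (hB : 0 < B)
    (h : ∀ r : ℕ, 1 ≤ r → ‖(s.map fun w => w ^ r).sum‖ ≤ C * B ^ r) (w0 : ℂ) (hw0 : w0 ∈ s) : ‖w0‖ ≤ B := by
  classical
  set A : ℂ[X] := ∏ w ∈ s.toFinset.erase w0, (X - Polynomial.C w) with hA
  have hA0 : A.eval w0 ≠ 0 := by
    rw [hA, eval_prod, Finset.prod_ne_zero_iff]
    intro w hw
    have := Finset.ne_of_mem_erase hw
    simp [sub_eq_zero, this.symm]
  have hAz : ∀ w ∈ s, w ≠ w0 → A.eval w = 0 := by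
    intro w hw hne
    rw [hA, eval_prod]
    exact Finset.prod_eq_zero (i := w) (by simp [hne, hw]) (by simp)
  have hcnt : 0 < s.count w0 := Multiset.count_pos.2 hw0
  have key : ∀ r : ℕ, (s.count w0 : ℂ) * (A.eval w0 * w0 ^ r) =
      ∑ k ∈ Finset.range (A.natDegree + 1), A.coeff k * (s.map fun w => w ^ (r + k)).sum := by
    intro r
    have h1 : (s.map fun w => A.eval w * w ^ r).sum = (s.count w0 : ℂ) * (A.eval w0 * w0 ^ r) := by
      rw [Finset.sum_multiset_map_count, Finset.sum_eq_single w0]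
      · simp
      · intro w hw hne
        rw [hAz w (by simpa using hw) hne]; simp
      · intro hn; exact absurd (by simpa using hw0) hn
    rw [← h1]
    have h2 : ∀ w : ℂ, A.eval w * w ^ r = ∑ k ∈ Finset.range (A.natDegree + 1), A.coeff k * w ^ (r + k) := by
      intro w
      rw [eval_eq_sum_range, Finset.sum_mul]
      refine Finset.sum_congr rfl fun k _ => ?_
      rw [pow_add]; ring
    simp only [h2]
    rw [Multiset.sum_map_sum]
    refine Finset.sum_congr rfl fun k _ => ?_
    rw [Multiset.sum_map_mul_left]
  refine pw_pow_bound ‖w0‖ B ((∑ k ∈ Finset.range (A.natDegree + 1), ‖A.coeff k‖ * (C * B ^ k)) / ‖A.eval w0‖)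
    hB ?_
  intro r hr
  have h3 : ‖(s.count w0 : ℂ) * (A.eval w0 * w0 ^ r)‖ ≤
     (∑ k ∈ Finset.range (A.natDegree + 1), ‖A.coeff k‖ * (C * B ^ k)) * B ^ r := by
    rw [key, Finset.sum_mul]
    refine (norm_sum_le _ _).trans (Finset.sum_le_sum fun k _ => ?_)
    rw [norm_mul, mul_assoc]
    refine mul_le_mul_of_nonneg_left ?_ (norm_nonneg _)
    refine (h (r + k) (by omega)).trans (le_of_eq ?_)
    rw [pow_add]; ring
  rw [norm_mul, norm_mul, norm_pow, Complex.norm_natCast] at h3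
  have hpos : 0 < ‖A.eval w0‖ := norm_pos_iff.2 hA0
  rw [div_mul_eq_mul_div, le_div_iff₀ hpos]
  have h4 : (1 : ℝ) ≤ s.count w0 := by exact_mod_cast hcnt
  have h5 : 0 ≤ ‖A.eval w0‖ * ‖w0‖ ^ r := by positivity
  nlinarith

/-- logarithmic derivative of a product of linear factors -/
lemma pw_logder (s : Multiset ℂ) :
    PowerSeries.X * PowerSeries.derivative ℂ ((s.map fun w => (1 - PowerSeries.C w * PowerSeries.X : PowerSeries ℂ)).prod)
     = - ((s.map fun w => (1 - PowerSeries.C w * PowerSeries.X : PowerSeries ℂ)).prod *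
      PowerSeries.mk (fun r => if r = 0 then 0 else (s.map fun w => w ^ r).sum)) := by
  induction s using Multiset.induction with
  | empty =>
    have : (PowerSeries.mk (fun r : ℕ => (0:ℂ))) = 0 := by
      ext n; simp
    simp [this, Derivation.map_one_eq_zero]
  | cons w s ih =>
    simp only [Multiset.map_cons, Multiset.prod_cons, Multiset.sum_cons]
    set P := (s.map fun w => (1 - PowerSeries.C w * PowerSeries.X : PowerSeries ℂ)).prod
    have h1 : (PowerSeries.mk (fun r : ℕ => if r = 0 then (0:ℂ) else w ^ r + (s.map fun w => w ^ r).sum)) =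
      PowerSeries.mk (fun r : ℕ => if r = 0 then (0:ℂ) else w ^ r) +
      PowerSeries.mk (fun r : ℕ => if r = 0 then (0:ℂ) else (s.map fun w => w ^ r).sum) := by
      ext n
      simp only [PowerSeries.coeff_mk, map_add]
      split_ifs <;> simp
    have h2 : (1 - PowerSeries.C w * PowerSeries.X) * PowerSeries.mk (fun r : ℕ => if r = 0 then (0:ℂ) else w ^ r)
       = PowerSeries.C w * PowerSeries.X := by
      ext n
      rw [sub_mul, one_mul, map_sub, mul_assoc, PowerSeries.coeff_C_mul, PowerSeries.coeff_C_mul]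
      rcases n with _ | n
      · simp
      · rw [PowerSeries.coeff_succ_X_mul]
        rcases n with _ | n
        · simp
        · simp [PowerSeries.coeff_mk, PowerSeries.coeff_X, pow_succ]; ring
    have h3 : PowerSeries.X * PowerSeries.derivative ℂ (1 - PowerSeries.C w * PowerSeries.X) = 
       - (PowerSeries.C w * PowerSeries.X) := by
      ext n
      rcases n with _ | n
      · simp
      · rw [PowerSeries.coeff_succ_X_mul, PowerSeries.coeff_derivative, map_sub, map_neg,
          PowerSeries.coeff_C_mul, PowerSeries.coeff_one]
        rcases n with _ | n
        · simp
        · simp [PowerSeries.coeff_X]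
    rw [h1, Derivation.leibniz, smul_eq_mul, smul_eq_mul]
    linear_combination (1 - PowerSeries.C w * PowerSeries.X) * ih + P * h3 + P * h2

lemma pw_main (a S : ℕ → ℂ) (m : ℕ) (hm : 1 ≤ m) (ha0 : a 0 = 1) (ha : ∀ n, m ≤ n → a n = 0)
    (hS : ∀ n : ℕ, (n : ℂ) * a n = ∑ r ∈ Finset.Icc 1 n, S r * a (n - r))
    (Q C : ℝ) (hQ : 0 < Q) (hC : ∀ r : ℕ, 1 ≤ r → ‖S (2 * r)‖ ≤ C * Q ^ r) :
    ‖S 1‖ ≤ (m - 1) * Real.sqrt Q := by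
  classical
  set P : ℂ[X] := ∑ n ∈ Finset.range m, monomial (m - 1 - n) (a n) with hP
  have hcoef : ∀ n < m, P.coeff (m - 1 - n) = a n := by
    intro n hn
    rw [hP, finsetSum_coeff, Finset.sum_eq_single n]
    · simp
    · intro k hk hkn
      rw [coeff_monomial, if_neg]
      have := Finset.mem_range.1 hk
      omega
    · intro h; exact absurd (Finset.mem_range.2 hn) h
  have hdeg : P.natDegree ≤ m - 1 := by
    refine natDegree_sum_le_of_forall_le _ _ fun n _ => ?_
    exact (natDegree_monomial_le _).trans (by omega)
  have hlead : P.coeff (m - 1) = 1 := by have := hcoef 0 (by omega); rwa [ha0, Nat.sub_zero] at this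
  have hmon : P.Monic := monic_of_natDegree_le_of_coeff_eq_one (m - 1) hdeg hlead
  have hdeg' : P.natDegree = m - 1 := by
    refine le_antisymm hdeg (le_natDegree_of_ne_zero ?_)
    rw [hlead]; exact one_ne_zero
  set s := P.roots with hs
  have hsplit : P = (s.map fun w => (X - Polynomial.C w)).prod := 
    (IsAlgClosed.splits P).eq_prod_roots_of_monic hmon
  have hcard : Multiset.card s = m - 1 := by
    rw [← hdeg']; exact (splits_iff_card_roots.1 (IsAlgClosed.splits P))
  -- reverse
  have hrev : P.reverse = (s.map fun w => (1 - Polynomial.C w * X)).prod := by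
    rw [hsplit]
    generalize s = t
    induction t using Multiset.induction with
    | empty => simpa using reverse_C (1:ℂ)
    | cons w t ih =>
      rw [Multiset.map_cons, Multiset.prod_cons, Multiset.map_cons, Multiset.prod_cons, reverse_mul_of_domain, ih]
      congr 1
      have : (X - Polynomial.C w).natDegree = 1 := natDegree_X_sub_C w
      rw [reverse, this]
      ext n
      rw [coeff_reflect]
      rcases n with _ | _ | n
      · rw [revAt_le (by norm_num)]; simp
      · rw [revAt_le (by norm_num)]; simp [coeff_one]
      · rw [revAt_eq_self_of_lt (by omega)]; simp [coeff_X, coeff_one, coeff_C]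
  have hrevc : ∀ n, P.reverse.coeff n = a n := by
    intro n
    rw [coeff_reverse, hdeg']
    by_cases hn : n < m
    · rw [revAt_le (by omega), hcoef n hn]
    · rw [revAt_eq_self_of_lt (by omega), ha n (by omega)]
      exact coeff_eq_zero_of_natDegree_lt (by omega)
  have hL : PowerSeries.mk a = (s.map fun w => (1 - PowerSeries.C w * PowerSeries.X : PowerSeries ℂ)).prod := by
    have h1 : PowerSeries.mk a = (P.reverse : PowerSeries ℂ) := by
      ext n; simp [hrevc]
    rw [h1, hrev]
    have := map_multiset_prod (Polynomial.coeToPowerSeries.ringHom (R := ℂ)) (s.map fun w => (1 - Polynomial.C w * X))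
    rw [Polynomial.coeToPowerSeries.ringHom_apply] at this
    rw [this, Multiset.map_map]
    congr 1
    refine Multiset.map_congr rfl fun w _ => ?_
    simp
  have h1 := pw_logder s
  rw [← hL] at h1
  set p : PowerSeries ℂ := PowerSeries.mk (fun r => if r = 0 then 0 else (s.map fun w => w ^ r).sum) with hp
  have h2 : PowerSeries.X * PowerSeries.derivative ℂ (PowerSeries.mk a) = 
    PowerSeries.mk a * PowerSeries.mk (fun r => if r = 0 then 0 else S r) := by
    ext n
    have e : (PowerSeries.coeff n) (PowerSeries.X * PowerSeries.derivative ℂ (PowerSeries.mk a)) = n * a n := by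
      rcases n with _ | n
      · simp
      · rw [PowerSeries.coeff_succ_X_mul, PowerSeries.coeff_derivative, PowerSeries.coeff_mk]
        push_cast; ring
    rw [e, hS, mul_comm (PowerSeries.mk a), PowerSeries.coeff_mul, Finset.Nat.sum_antidiagonal_eq_sum_range_succ_mk]
    simp only [PowerSeries.coeff_mk, ite_mul, zero_mul]
    rw [Finset.range_eq_Ico, Finset.sum_eq_sum_Ico_succ_bot (by omega)]
    simp only [if_true, zero_add]
    refine Finset.sum_congr (by ext; simp) fun r hr => ?_
    rw [if_neg (by have := Finset.mem_Icc.1 hr; omega)]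
  have hLne : PowerSeries.mk a ≠ 0 := by
    intro h0
    have := congrArg (PowerSeries.coeff 0) h0
    simp [ha0] at this
  have h3 : PowerSeries.mk (fun r => if r = 0 then 0 else S r) = - p := by
    apply mul_left_cancel₀ hLne
    rw [← h2, h1]; ring
  have h4 : ∀ r, 1 ≤ r → S r = - (s.map fun w => w ^ r).sum := by
    intro r hr
    have := congrArg (PowerSeries.coeff r) h3
    have hr0 : r ≠ 0 := by omega
    simpa [hp, hr0] using this
  have hw : ∀ w ∈ s, ‖w‖ ≤ Real.sqrt Q := by
    intro w hw
    have := pw_roots_bound (s.map fun w => w ^ 2) Q C hQ ?_ (w ^ 2) (Multiset.mem_map_of_mem _ hw)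
    · rw [norm_pow] at this
      exact Real.le_sqrt_of_sq_le this
    · intro r hr
      rw [Multiset.map_map]
      have e := h4 (2 * r) (by omega)
      have e2 := hC r hr
      rw [e, norm_neg] at e2
      simpa [Function.comp_def, ← pow_mul] using e2
  rw [h4 1 le_rfl, norm_neg]
  have h5 : ‖(s.map fun w => w ^ 1).sum‖ ≤ (s.map fun w => ‖w‖).sum := by
    simp only [pow_one, Multiset.map_id']
    exact norm_multiset_sum_le _
  refine h5.trans ?_
  have h6 := Multiset.sum_le_card_nsmul (s.map fun w => ‖w‖) (Real.sqrt Q) (by simpa using hw)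
  rw [Multiset.card_map, hcard, nsmul_eq_mul, Nat.cast_sub hm, Nat.cast_one] at h6
  exact h6

/-! Part P3a -/

lemma rs_closure {K 𝔼 : Type} [Field K] [Field 𝔼] [IsAlgClosed 𝔼] [Algebra K 𝔼] (g F : K[X]) (hg : g.Monic) :
    algebraMap K 𝔼 (resultant g F) = ((g.aroots 𝔼).map fun ρ => aeval ρ F).prod := by
  rw [← resultant_map_map]
  have h := resultant_eq_prod_eval (g.map (algebraMap K 𝔼)) (F.map (algebraMap K 𝔼)) F.natDegree
    natDegree_map_le (IsAlgClosed.splits _)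
  rw [natDegree_map, (hg.map _).leadingCoeff, one_pow, one_mul] at h
  rw [h, aroots]
  simp [eval_map_algebraMap]

lemma nrm_pb {K S : Type} [Field K] [Field S] [Algebra K S] [Algebra.IsSeparable K S] [FiniteDimensional K S]
    (pb : PowerBasis K S) (F : K[X]) :
    Algebra.norm K (aeval pb.gen F) = resultant (minpoly K pb.gen) F := by
  classical
  apply (algebraMap K (AlgebraicClosure K)).injective
  rw [rs_closure _ _ (minpoly.monic pb.isIntegral_gen), Algebra.norm_eq_prod_embeddings K (AlgebraicClosure K)]
  have hnd : ((minpoly K pb.gen).aroots (AlgebraicClosure K)).Nodup := 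
    nodup_roots (.map (Algebra.IsSeparable.isSeparable K pb.gen))
  have h1 : ∀ σ : S →ₐ[K] AlgebraicClosure K, σ (aeval pb.gen F) = aeval (σ pb.gen) F := by
    intro σ; rw [aeval_algHom_apply]
  simp only [h1]
  rw [Fintype.prod_equiv pb.liftEquiv' (fun σ => aeval (σ pb.gen) F) (fun x => aeval x.1 F)
    (fun σ => by rw [pb.liftEquiv'_apply_coe])]
  rw [Finset.prod_mem_multiset _ _ (fun x => aeval x F) (fun x => rfl), Finset.prod_eq_multiset_prod,
    Multiset.toFinset_val, Multiset.dedup_eq_self.mpr hnd]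

lemma nrm_aeval {K S : Type} [Field K] [Field S] [Algebra K S] [Algebra.IsSeparable K S] [FiniteDimensional K S]
    (x : S) (F : K[X]) :
    Algebra.norm K (aeval x F) = resultant (minpoly K x) F ^ (Module.finrank K S / (minpoly K x).natDegree) := by
  have hx : IsIntegral K x := Algebra.IsIntegral.isIntegral x
  set pb := IntermediateField.adjoin.powerBasis hx with hpb
  have h1 := nrm_pb pb F
  have hg : pb.gen = IntermediateField.AdjoinSimple.gen K x := rfl
  have hm : minpoly K pb.gen = minpoly K x := by
    rw [hg, IntermediateField.minpoly_gen]
  have h2 : aeval x F = algebraMap (IntermediateField.adjoin K {x}) S (aeval pb.gen F) := by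
    rw [← aeval_algebraMap_apply, hg, IntermediateField.AdjoinSimple.algebraMap_gen]
  have h3 : Module.finrank K S / (minpoly K x).natDegree = Module.finrank (IntermediateField.adjoin K {x}) S := by
    rw [← IntermediateField.adjoin.finrank hx, ← Module.finrank_mul_finrank K (IntermediateField.adjoin K {x}) S]
    exact Nat.mul_div_cancel_left _ Module.finrank_pos
  rw [h2, ← Algebra.norm_norm (R := K) (S := IntermediateField.adjoin K {x}), Algebra.norm_algebraMap, map_pow, h1, hm, h3]

/-! Part P3b -/

/-- the finite set of monic polynomials of degree `n` over a finite field -/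
lemma md_finite (K : Type) [Field K] [Fintype K] (n : ℕ) : {h : K[X] | h.Monic ∧ h.natDegree = n}.Finite := by
  have hfin : Finite (Polynomial.degreeLT K (n + 1)) :=
    Finite.of_equiv _ (Polynomial.degreeLTEquiv K (n + 1)).toEquiv.symm
  refine Set.Finite.subset (Set.toFinite ((Polynomial.degreeLT K (n + 1) : Submodule K K[X]) : Set K[X])) ?_
  rintro h ⟨h1, h2⟩
  refine Polynomial.mem_degreeLT.2 ?_
  rw [degree_eq_natDegree h1.ne_zero, h2]
  exact_mod_cast Nat.lt_succ_self n

noncomputable def mdeg (K : Type) [Field K] [Fintype K] (n : ℕ) : Finset K[X] := (md_finite K n).toFinset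

lemma mem_mdeg {K : Type} [Field K] [Fintype K] {n : ℕ} {h : K[X]} : h ∈ mdeg K n ↔ h.Monic ∧ h.natDegree = n := by
  simp [mdeg]

open Classical in
/-- monic irreducibles of degree at most `n` -/
noncomputable def mirr (K : Type) [Field K] [Fintype K] (n : ℕ) : Finset K[X] :=
  ((Finset.range (n + 1)).biUnion (mdeg K)).filter Irreducible

lemma mem_mirr {K : Type} [Field K] [Fintype K] {n : ℕ} {h : K[X]} :
    h ∈ mirr K n ↔ h.Monic ∧ Irreducible h ∧ h.natDegree ≤ n := by
  classical
  simp only [mirr, Finset.mem_filter, Finset.mem_biUnion, Finset.mem_range, mem_mdeg]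
  constructor
  · rintro ⟨⟨i, hi, h1, h2⟩, h3⟩
    exact ⟨h1, h3, by omega⟩
  · rintro ⟨h1, h2, h3⟩
    exact ⟨⟨h.natDegree, by omega, h1, rfl⟩, h2⟩

lemma nw_count {K : Type} [Field K] (P h : K[X]) (hP : P.Monic) (hPi : Irreducible P) (hh : h.Monic)
    [DecidableEq K] [∀ n : ℕ, Decidable (P ^ n ∣ h)] (n : ℕ) (hn : h.natDegree = n) :
    ((Finset.Icc 1 n).filter (fun r => P.natDegree ∣ r ∧ P ^ (r / P.natDegree) ∣ h)).card =
     (UniqueFactorizationMonoid.normalizedFactors h).count P := by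
  classical
  have hdP : 0 < P.natDegree := hPi.natDegree_pos
  set c := (UniqueFactorizationMonoid.normalizedFactors h).count P with hc
  have hdvd : ∀ k : ℕ, P ^ k ∣ h ↔ k ≤ c := by
    intro k
    rw [pow_dvd_iff_le_emultiplicity, UniqueFactorizationMonoid.emultiplicity_eq_count_normalizedFactors hPi hh.ne_zero,
      hP.normalize_eq_self]
    exact_mod_cast Iff.rfl
  have h1 : (Finset.Icc 1 n).filter (fun r => P.natDegree ∣ r ∧ P ^ (r / P.natDegree) ∣ h) =
     (Finset.Icc 1 c).image (fun k => P.natDegree * k) := by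
    ext r
    simp only [Finset.mem_filter, Finset.mem_Icc, Finset.mem_image]
    constructor
    · rintro ⟨⟨h1, h2⟩, ⟨k, rfl⟩, h4⟩
      rw [Nat.mul_div_cancel_left _ hdP, hdvd] at h4
      exact ⟨k, ⟨Nat.pos_of_mul_pos_left h1, h4⟩, rfl⟩
    · rintro ⟨k, ⟨h1, h2⟩, rfl⟩
      refine ⟨⟨Nat.mul_pos hdP h1, ?_⟩, dvd_mul_right _ _, ?_⟩
      · have := natDegree_le_of_dvd ((hdvd k).2 h2) hh.ne_zero
        rw [natDegree_pow, hn, mul_comm] at this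
        exact this
      · rw [Nat.mul_div_cancel_left _ hdP, hdvd]; exact h2
  rw [h1, Finset.card_image_of_injective _ (fun a b hab => Nat.eq_of_mul_eq_mul_left hdP hab)]
  simp

lemma nw_deg {K : Type} [Field K] [Fintype K] (h : K[X]) (hh : h.Monic) [DecidableEq K] :
    ∑ P ∈ mirr K h.natDegree, P.natDegree * (UniqueFactorizationMonoid.normalizedFactors h).count P = h.natDegree := by
  classical
  have h1 : (UniqueFactorizationMonoid.normalizedFactors h).prod = h := by
    rw [UniqueFactorizationMonoid.prod_normalizedFactors_eq hh.ne_zero, hh.normalize_eq_self]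
  have h2 : ((UniqueFactorizationMonoid.normalizedFactors h).map natDegree).sum = h.natDegree := by
    conv_rhs => rw [← h1]
    rw [natDegree_multiset_prod]
    exact UniqueFactorizationMonoid.zero_notMem_normalizedFactors h
  refine Eq.trans ?_ h2
  rw [Finset.sum_multiset_map_count]
  symm
  rw [Finset.sum_subset (s₂ := mirr K h.natDegree)]
  · refine Finset.sum_congr rfl fun P _ => ?_
    rw [smul_eq_mul, mul_comm]
  · intro P hP
    rw [Multiset.mem_toFinset] at hP
    have hi := UniqueFactorizationMonoid.irreducible_of_normalized_factor P hP
    refine mem_mirr.2 ⟨?_, hi, ?_⟩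
    · have := UniqueFactorizationMonoid.normalize_normalized_factor P hP
      rw [← this]
      exact monic_normalize hi.ne_zero
    · exact natDegree_le_of_dvd (UniqueFactorizationMonoid.dvd_of_mem_normalizedFactors hP) hh.ne_zero
  · intro P _ hP
    rw [Multiset.mem_toFinset] at hP
    rw [Multiset.count_eq_zero_of_notMem hP, zero_smul]

lemma nw_shift {K : Type} [Field K] [Fintype K] (Λ : K[X] → ℂ)
    (hmul : ∀ h h' : K[X], h.Monic → h'.Monic → Λ (h * h') = Λ h * Λ h') (P : K[X]) (hP : P.Monic) (n : ℕ)
    (hn : P.natDegree ≤ n) [∀ h, Decidable (P ∣ h)] :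
    Λ P * ∑ h ∈ mdeg K (n - P.natDegree), Λ h = ∑ h ∈ (mdeg K n).filter (fun h => P ∣ h), Λ h := by
  classical
  rw [Finset.mul_sum]
  refine Finset.sum_bij (fun h _ => P * h) ?_ ?_ ?_ ?_
  · intro h hh
    have := mem_mdeg.1 hh
    simp only [Finset.mem_filter, mem_mdeg]
    refine ⟨⟨hP.mul this.1, ?_⟩, dvd_mul_right _ _⟩
    rw [hP.natDegree_mul this.1]; omega
  · intro a _ b _ hab
    exact mul_left_cancel₀ hP.ne_zero hab
  · intro h hh
    simp only [Finset.mem_filter, mem_mdeg] at hh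
    obtain ⟨⟨h1, h2⟩, ⟨k, rfl⟩⟩ := hh
    have hk := hP.of_mul_monic_left h1
    refine ⟨k, mem_mdeg.2 ⟨hk, ?_⟩, rfl⟩
    rw [hP.natDegree_mul hk] at h2; omega
  · intro h hh
    rw [hmul _ _ hP (mem_mdeg.1 hh).1]

lemma lam_pow {K : Type} [Field K] (Λ : K[X] → ℂ) (h1 : Λ 1 = 1)
    (hmul : ∀ h h' : K[X], h.Monic → h'.Monic → Λ (h * h') = Λ h * Λ h') (P : K[X]) (hP : P.Monic) (k : ℕ) :
    Λ (P ^ k) = Λ P ^ k := by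
  induction k with
  | zero => simpa using h1
  | succ k ih => rw [pow_succ, hmul _ _ (hP.pow k) hP, ih, pow_succ]

open Classical in
lemma newton {K : Type} [Field K] [Fintype K] (Λ : K[X] → ℂ) (h1 : Λ 1 = 1)
    (hmul : ∀ h h' : K[X], h.Monic → h'.Monic → Λ (h * h') = Λ h * Λ h') (S : ℕ → ℂ)
    (hS : ∀ r, 1 ≤ r → S r = ∑ P ∈ (mirr K r).filter (fun P => P.natDegree ∣ r),
      (P.natDegree : ℂ) * Λ P ^ (r / P.natDegree)) (n : ℕ) :
    (n : ℂ) * ∑ h ∈ mdeg K n, Λ h = ∑ r ∈ Finset.Icc 1 n, S r * ∑ h ∈ mdeg K (n - r), Λ h := by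
  have e1 : ∀ r ∈ Finset.Icc 1 n, S r * ∑ h ∈ mdeg K (n - r), Λ h =
      ∑ P ∈ mirr K n, ∑ h ∈ mdeg K n, if P.natDegree ∣ r ∧ P ^ (r / P.natDegree) ∣ h then
        (P.natDegree : ℂ) * Λ h else 0 := by
    intro r hr
    obtain ⟨hr1, hr2⟩ := Finset.mem_Icc.1 hr
    have e2 : (mirr K r).filter (fun P => P.natDegree ∣ r) = (mirr K n).filter (fun P => P.natDegree ∣ r) := by
      ext P
      simp only [Finset.mem_filter, mem_mirr]
      constructor
      · rintro ⟨⟨a, b, c⟩, d⟩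
        exact ⟨⟨a, b, by omega⟩, d⟩
      · rintro ⟨⟨a, b, c⟩, d⟩
        exact ⟨⟨a, b, Nat.le_of_dvd hr1 d⟩, d⟩
    rw [hS r hr1, e2, Finset.sum_mul, Finset.sum_filter]
    refine Finset.sum_congr rfl fun P hP => ?_
    have hPm := (mem_mirr.1 hP).1
    split_ifs with hd
    · have e3 := nw_shift Λ hmul (P ^ (r / P.natDegree)) (hPm.pow _) n
        (by rw [natDegree_pow, Nat.div_mul_cancel hd]; exact hr2)
      rw [natDegree_pow, Nat.div_mul_cancel hd, lam_pow Λ h1 hmul P hPm, Finset.sum_filter] at e3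
      rw [mul_assoc, e3, Finset.mul_sum]
      refine Finset.sum_congr rfl fun h _ => ?_
      simp [hd]
    · simp [hd]
  rw [Finset.sum_congr rfl e1, Finset.mul_sum]
  rw [Finset.sum_comm]
  simp_rw [Finset.sum_comm (s := Finset.Icc 1 n)]
  rw [Finset.sum_comm]
  refine Finset.sum_congr rfl fun h hh => ?_
  obtain ⟨hm, hd⟩ := mem_mdeg.1 hh
  have e4 : ∀ P ∈ mirr K n, (∑ r ∈ Finset.Icc 1 n, if P.natDegree ∣ r ∧ P ^ (r / P.natDegree) ∣ h then
        (P.natDegree : ℂ) * Λ h else 0) =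
        ((P.natDegree * (UniqueFactorizationMonoid.normalizedFactors h).count P : ℕ) : ℂ) * Λ h := by
    intro P hP
    obtain ⟨a, b, c⟩ := mem_mirr.1 hP
    rw [← Finset.sum_filter, Finset.sum_const, nw_count P h a b hm n hd, nsmul_eq_mul]
    push_cast; ring
  rw [Finset.sum_congr rfl e4, ← Finset.sum_mul, ← Nat.cast_sum]
  have := nw_deg h hm
  rw [hd] at this
  rw [this]

/-! Part P3c -/

noncomputable def lam {K : Type} [Field K] (χ1 χ2 : MulChar K ℂ) (F h : K[X]) : ℂ :=
  χ1 (resultant h X) * χ2 (resultant h F)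

lemma res_one {K : Type} [Field K] (F : K[X]) : resultant 1 F = 1 := by
  simp

lemma res_mul {K : Type} [Field K] (F h h' : K[X]) (hh : h.Monic) (hh' : h'.Monic) :
    resultant (h * h') F = resultant h F * resultant h' F := by
  rw [← resultant_mul_left h h' F _ le_rfl, hh.natDegree_mul hh']

lemma lam_one {K : Type} [Field K] (χ1 χ2 : MulChar K ℂ) (F : K[X]) : lam χ1 χ2 F 1 = 1 := by
  rw [lam, res_one, res_one]; simp

lemma lam_mul {K : Type} [Field K] (χ1 χ2 : MulChar K ℂ) (F h h' : K[X]) (hh : h.Monic) (hh' : h'.Monic) :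
    lam χ1 χ2 F (h * h') = lam χ1 χ2 F h * lam χ1 χ2 F h' := by
  rw [lam, lam, lam, res_mul _ _ _ hh hh', res_mul _ _ _ hh hh', map_mul, map_mul]; ring

lemma res_mul_right {K : Type} [Field K] (h A B : K[X]) (hh : h.Monic) :
    resultant h (A * B) = resultant h A * resultant h B := by
  apply (algebraMap K (AlgebraicClosure K)).injective
  rw [map_mul, rs_closure _ _ hh, rs_closure _ _ hh, rs_closure _ _ hh, ← Multiset.prod_map_mul]
  simp

lemma res_pow_right {K : Type} [Field K] (h A : K[X]) (hh : h.Monic) (e : ℕ) :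
    resultant h (A ^ e) = resultant h A ^ e := by
  apply (algebraMap K (AlgebraicClosure K)).injective
  rw [map_pow, rs_closure _ _ hh, rs_closure _ _ hh, ← Multiset.prod_map_pow]
  simp

lemma res_right {K : Type} [Field K] (h F : K[X]) :
    algebraMap K (AlgebraicClosure K) (resultant h F) = (-1) ^ (h.natDegree * F.natDegree) *
      ((algebraMap K (AlgebraicClosure K) F.leadingCoeff) ^ h.natDegree *
        ((F.aroots (AlgebraicClosure K)).map fun ρ => aeval ρ h).prod) := by
  rw [resultant_comm, map_mul, map_pow, map_neg, map_one]
  congr 1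
  rw [← resultant_map_map]
  have h := resultant_eq_prod_eval (F.map (algebraMap K (AlgebraicClosure K))) (h.map (algebraMap K (AlgebraicClosure K))) h.natDegree
    natDegree_map_le (IsAlgClosed.splits _)
  rw [natDegree_map, leadingCoeff_map] at h
  rw [h, aroots]
  simp [eval_map_algebraMap]

lemma res_congr {K : Type} [Field K] (h h' F R : K[X]) (hd : h.natDegree = h'.natDegree) (hR : R ∣ h' - h)
    (hroot : ∀ ρ : AlgebraicClosure K, aeval ρ F = 0 → aeval ρ R = 0) : resultant h' F = resultant h F := by
  apply (algebraMap K (AlgebraicClosure K)).injective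
  rw [res_right, res_right, hd]
  congr 3
  refine Multiset.map_congr rfl fun ρ hρ => ?_
  have h1 := hroot ρ ((mem_aroots.1 hρ).2)
  obtain ⟨c, hc⟩ := hR
  have h2 := congrArg (aeval ρ) hc
  rw [map_mul, h1, zero_mul, map_sub, sub_eq_zero] at h2
  exact h2

lemma res_twist {K : Type} [Field K] (h h' g w : K[X]) (hg : g.Monic) (hd : h.natDegree = h'.natDegree) (hR : g ∣ h' - w * h) :
    resultant h' g = resultant g w * resultant h g := by
  apply (algebraMap K (AlgebraicClosure K)).injective
  rw [map_mul, rs_closure _ _ hg, res_right h', res_right h, hd]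
  have : ((g.aroots (AlgebraicClosure K)).map fun ρ => aeval ρ h').prod = 
    ((g.aroots (AlgebraicClosure K)).map fun ρ => aeval ρ w).prod * ((g.aroots (AlgebraicClosure K)).map fun ρ => aeval ρ h).prod := by
    rw [← Multiset.prod_map_mul]
    congr 1
    refine Multiset.map_congr rfl fun ρ hρ => ?_
    have h1 := (mem_aroots.1 hρ).2
    obtain ⟨c, hc⟩ := hR
    have h2 := congrArg (aeval ρ) hc
    rw [map_mul, h1, zero_mul, map_sub, sub_eq_zero, map_mul] at h2
    exact h2
  rw [this]; ring

lemma exists_res {K : Type} [Field K] [Fintype K] (g : K[X]) (hg : g.Monic) (hi : Irreducible g) (b : K) (hb : b ≠ 0) :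
    ∃ t : K[X], resultant g t = b ∧ ¬ g ∣ t := by
  have : Fact (Irreducible g) := ⟨hi⟩
  have hfd : FiniteDimensional K (AdjoinRoot g) := (AdjoinRoot.powerBasis hi.ne_zero).finite
  have hfin : Finite (AdjoinRoot g) := Module.finite_of_finite K
  obtain ⟨y, hy⟩ := FiniteField.norm_surjective K (AdjoinRoot g) b
  obtain ⟨t, rfl⟩ := AdjoinRoot.mk_surjective y
  have h1 := nrm_pb (AdjoinRoot.powerBasis hi.ne_zero) t
  rw [AdjoinRoot.minpoly_powerBasis_gen_of_monic hg, AdjoinRoot.powerBasis_gen, AdjoinRoot.aeval_eq, hy] at h1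
  refine ⟨t, h1.symm, fun hd => ?_⟩
  rw [AdjoinRoot.mk_eq_zero.2 hd, Algebra.norm_zero] at hy
  exact hb hy.symm

lemma chi_pow_ne {K : Type} [Field K] [Fintype K] (χ : MulChar K ℂ) (hχ : χ ≠ 1) (e : ℕ) (he : Nat.Coprime e (Fintype.card K - 1)) :
    ∃ b : K, b ≠ 0 ∧ χ (b ^ e) ≠ 1 := by
  obtain ⟨a, ha⟩ := MulChar.ne_one_iff.1 hχ
  refine ⟨a, a.ne_zero, fun h => ha ?_⟩
  rw [map_pow] at h
  have h2 : χ a ^ (Fintype.card K - 1) = 1 := by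
    rw [← map_pow, FiniteField.pow_card_sub_one_eq_one _ a.ne_zero, map_one]
  have h3 := orderOf_dvd_of_pow_eq_one h
  have h4 := orderOf_dvd_of_pow_eq_one h2
  have h5 := Nat.eq_one_of_dvd_coprimes he h3 h4
  exact orderOf_eq_one_iff.1 h5

lemma lam_sum_zero {K : Type} [Field K] [Fintype K] (χ1 χ2 : MulChar K ℂ) (hχ : χ2 ≠ 1) (F g F' R : K[X]) (e : ℕ)
    (hF : F = g ^ e * F') (he : Nat.Coprime e (Fintype.card K - 1)) (hg : g.Monic) (hi : Irreducible g)
    (hR : R ≠ 0) (hcop : IsCoprime g R) (hX : X ∣ R)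
    (hroot : ∀ ρ : AlgebraicClosure K, aeval ρ F' = 0 → aeval ρ R = 0) (n : ℕ)
    (hn : g.natDegree + R.natDegree ≤ n) : ∑ h ∈ mdeg K n, lam χ1 χ2 F h = 0 := by
  classical
  obtain ⟨b, hb0, hb⟩ := chi_pow_ne χ2 hχ e he
  obtain ⟨t, ht, hgt⟩ := exists_res g hg hi b hb0
  obtain ⟨u, v, huv⟩ := hcop
  set w := t * v * R + u * g with hw
  have hw1 : R ∣ w - 1 := ⟨t * v - v, by rw [hw, ← huv]; ring⟩
  have hw2 : g ∣ w - t := ⟨u - t * u, by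
    have : w - t = w - t * (u * g + v * R) := by rw [huv, mul_one]
    rw [this, hw]; ring⟩
  have hgw : ¬ g ∣ w := fun h => hgt (by simpa using dvd_sub h hw2)
  have hrw : resultant g w = b := by
    rw [← ht]
    apply (algebraMap K (AlgebraicClosure K)).injective
    rw [rs_closure _ _ hg, rs_closure _ _ hg]
    congr 1
    refine Multiset.map_congr rfl fun ρ hρ => ?_
    have h1 := (mem_aroots.1 hρ).2
    obtain ⟨c, hc⟩ := hw2
    have h2 := congrArg (aeval ρ) hc
    rw [map_mul, h1, zero_mul, map_sub, sub_eq_zero] at h2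
    exact h2
  set M := g * R with hM
  have hM0 : M ≠ 0 := mul_ne_zero hg.ne_zero hR
  have hMd : M.natDegree = g.natDegree + R.natDegree := natDegree_mul hg.ne_zero hR
  let φ : K[X] → K[X] := fun h => h + ((w * h) % M - h % M)
  have hφdvd : ∀ h, M ∣ φ h - w * h := by
    intro h
    have e1 := EuclideanDomain.div_add_mod (w * h) M
    have e2 := EuclideanDomain.div_add_mod h M
    refine ⟨h / M - (w * h) / M, ?_⟩
    simp only [φ]
    linear_combination e1 - e2
  have hφdeg : ∀ h, ((w * h) % M - h % M).degree < M.degree := by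
    intro h
    refine (degree_sub_le _ _).trans_lt (max_lt ?_ ?_)
    · exact EuclideanDomain.mod_lt _ hM0
    · exact EuclideanDomain.mod_lt _ hM0
  have hφm : ∀ h ∈ mdeg K n, φ h ∈ mdeg K n := by
    intro h hh
    obtain ⟨h1, h2⟩ := mem_mdeg.1 hh
    have h3 : ((w * h) % M - h % M).degree < h.degree := by
      refine (hφdeg h).trans_le ?_
      rw [degree_eq_natDegree hM0, degree_eq_natDegree h1.ne_zero, hMd, h2]
      exact_mod_cast hn
    refine mem_mdeg.2 ⟨h1.add_of_left h3, ?_⟩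
    rw [← h2]
    exact natDegree_add_eq_left_of_degree_lt h3
  have hgp : Prime g := hi.prime
  have hφinj : ∀ h ∈ mdeg K n, ∀ h' ∈ mdeg K n, φ h = φ h' → h = h' := by
    intro h _ h' _ heq
    have h1 : M ∣ w * (h - h') := by
      have := dvd_sub (hφdvd h') (hφdvd h)
      rw [heq] at this
      convert! this using 1; ring
    have h2 : g ∣ h - h' := (hgp.dvd_or_dvd ((dvd_mul_right g R).trans h1)).resolve_left hgw
    have h3 : R ∣ h - h' := by
      have a1 := (dvd_mul_left R g).trans h1
      have a2 := hw1.mul_right (h - h')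
      have := dvd_sub a1 a2
      convert! this using 1; ring
    have h4 : M ∣ h - h' := IsCoprime.mul_dvd ⟨u, v, huv⟩ h2 h3
    have h5 : h % M = h' % M := by
      rw [← sub_eq_zero]
      rw [← Polynomial.sub_mod]
      exact EuclideanDomain.mod_eq_zero.2 h4
    have h6 : (w * h) % M = (w * h') % M := by
      rw [← sub_eq_zero, ← Polynomial.sub_mod, ← mul_sub]
      exact EuclideanDomain.mod_eq_zero.2 h1
    simp only [φ] at heq
    rw [h5, h6] at heq
    exact add_right_cancel heq
  have hφlam : ∀ h ∈ mdeg K n, lam χ1 χ2 F (φ h) = χ2 (b ^ e) * lam χ1 χ2 F h := by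
    intro h hh
    obtain ⟨h1, h2⟩ := mem_mdeg.1 hh
    obtain ⟨h3, h4⟩ := mem_mdeg.1 (hφm h hh)
    have hR1 : R ∣ φ h - h := by
      have a1 := (dvd_mul_left R g).trans (hφdvd h)
      have a2 := hw1.mul_right h
      have := dvd_add a1 a2
      convert! this using 1; ring
    have e1 : resultant (φ h) X = resultant h X := by
      refine res_congr h (φ h) X R (h2.trans h4.symm) hR1 ?_
      intro ρ hρ
      obtain ⟨c, hc⟩ := hX
      rw [hc, map_mul, hρ, zero_mul]
    have e2 : resultant (φ h) F' = resultant h F' :=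
      res_congr h (φ h) F' R (h2.trans h4.symm) hR1 hroot
    have e3 : resultant (φ h) g = b * resultant h g := by
      rw [← hrw]
      exact res_twist h (φ h) g w hg (h2.trans h4.symm) ((dvd_mul_right g R).trans (hφdvd h))
    rw [lam, lam, hF, res_mul_right _ _ _ h3, res_mul_right _ _ _ h1, res_pow_right _ _ h3, res_pow_right _ _ h1, e1, e2, e3,
      mul_pow, map_mul, map_mul, map_mul]
    ring
  have hsum : ∑ h ∈ mdeg K n, lam χ1 χ2 F h = ∑ h ∈ mdeg K n, lam χ1 χ2 F (φ h) := by
    have himg : (mdeg K n).image φ = mdeg K n := by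
      refine Finset.eq_of_subset_of_card_le ?_ ?_
      · intro x hx
        obtain ⟨y, hy, rfl⟩ := Finset.mem_image.1 hx
        exact hφm y hy
      · rw [Finset.card_image_of_injOn]
        intro x hx y hy hxy
        exact hφinj x hx y hy hxy
    conv_lhs => rw [← himg]
    rw [Finset.sum_image]
    intro x hx y hy hxy
    exact hφinj x hx y hy hxy
  rw [Finset.sum_congr rfl hφlam, ← Finset.mul_sum] at hsum
  by_contra hne
  apply hb
  have h7 : (χ2 (b ^ e) - 1) * ∑ h ∈ mdeg K n, lam χ1 χ2 F h = 0 := by linear_combination -hsum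
  rcases mul_eq_zero.1 h7 with h8 | h8
  · exact sub_eq_zero.1 h8
  · exact absurd h8 hne

/-! Part P3d -/

lemma fib_card {K E : Type} [Field K] [Fintype K] [Field E] [Fintype E] [Algebra K E] [DecidableEq K[X]] (r : ℕ)
    (hr : Module.finrank K E = r) (P : K[X]) (hP : P.Monic) (hi : Irreducible P) (hd : P.natDegree ∣ r) :
    (Finset.univ.filter (fun x : E => minpoly K x = P)).card = P.natDegree := by
  classical
  have hcard : Fintype.card E = Nat.card K ^ r := by
    rw [Nat.card_eq_fintype_card, ← hr]; exact Module.card_eq_pow_finrank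
  have h1 : P ∣ X ^ (Nat.card K) ^ r - X := hi.natDegree_dvd_iff_dvd_X_pow_card_pow_sub_X.1 hd
  rw [← hcard] at h1
  have h2 : (P.map (algebraMap K E)).Splits := by
    have h3 : P.map (algebraMap K E) ∣ X ^ Fintype.card E - X := by
      have := Polynomial.map_dvd (algebraMap K E) h1
      simpa using this
    refine Splits.of_dvd ?_ (FiniteField.X_pow_card_sub_X_ne_zero E Fintype.one_lt_card) h3
    rw [splits_iff_card_roots, FiniteField.roots_X_pow_card_sub_X, FiniteField.X_pow_card_sub_X_natDegree_eq E Fintype.one_lt_card]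
    exact Finset.card_univ
  have hsep : (P.map (algebraMap K E)).Separable := (PerfectField.separable_of_irreducible hi).map
  have hnd : (P.aroots E).Nodup := nodup_roots hsep
  have h4 : Finset.univ.filter (fun x : E => minpoly K x = P) = (P.aroots E).toFinset := by
    ext x
    rw [Finset.mem_filter, Multiset.mem_toFinset, mem_aroots]
    constructor
    · rintro ⟨_, rfl⟩
      exact ⟨hP.ne_zero, minpoly.aeval _ _⟩
    · rintro ⟨_, h⟩
      exact ⟨Finset.mem_univ _, (minpoly.eq_of_irreducible_of_monic hi h hP).symm⟩
  rw [h4, Multiset.toFinset_card_of_nodup hnd]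
  have := splits_iff_card_roots.1 h2
  rw [natDegree_map] at this
  exact this

open Classical in
lemma ext_sum {K E : Type} [Field K] [Fintype K] [Field E] [Fintype E] [Algebra K E] (χ1 χ2 : MulChar K ℂ) (F : K[X]) (r : ℕ)
    (hr : Module.finrank K E = r) :
    ∑ x : E, χ1 (Algebra.norm K x) * χ2 (Algebra.norm K (aeval x F)) =
      ∑ P ∈ (mirr K r).filter (fun P => P.natDegree ∣ r), (P.natDegree : ℂ) * lam χ1 χ2 F P ^ (r / P.natDegree) := by
  rw [← Finset.sum_fiberwise_of_maps_to (s := Finset.univ) (g := fun x : E => minpoly K x)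
    (t := (mirr K r).filter (fun P => P.natDegree ∣ r))]
  · refine Finset.sum_congr rfl fun P hP => ?_
    rw [Finset.mem_filter, mem_mirr] at hP
    obtain ⟨⟨h1, h2, h3⟩, h4⟩ := hP
    rw [Finset.sum_congr rfl (g := fun _ => lam χ1 χ2 F P ^ (r / P.natDegree)), Finset.sum_const, fib_card r hr P h1 h2 h4,
      nsmul_eq_mul]
    intro x hx
    have hx' : minpoly K x = P := (Finset.mem_filter.1 hx).2
    have e1 := nrm_aeval (K := K) x X
    have e2 := nrm_aeval (K := K) x F
    rw [aeval_X, hx', hr] at e1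
    rw [hx', hr] at e2
    rw [e1, e2, map_pow, map_pow, lam, mul_pow]
  · intro x _
    have hx : IsIntegral K x := Algebra.IsIntegral.isIntegral x
    rw [Finset.mem_filter, mem_mirr]
    have hd : (minpoly K x).natDegree ∣ r := by rw [← hr]; exact minpoly.degree_dvd hx
    refine ⟨⟨minpoly.monic hx, minpoly.irreducible hx, Nat.le_of_dvd ?_ hd⟩, hd⟩
    rw [← hr]; exact Module.finrank_pos

/-- Weil-type bound from growth of the sums over even-degree extensions -/
lemma weil_of_growth {K : Type} [Field K] [Fintype K] (χ1 χ2 : MulChar K ℂ) (hχ : χ2 ≠ 1) (F g F' R : K[X]) (e : ℕ)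
    (hF : F = g ^ e * F') (he : Nat.Coprime e (Fintype.card K - 1)) (hg : g.Monic) (hi : Irreducible g)
    (hR : R ≠ 0) (hcop : IsCoprime g R) (hX : X ∣ R)
    (hroot : ∀ ρ : AlgebraicClosure K, aeval ρ F' = 0 → aeval ρ R = 0) (m : ℕ)
    (hm : g.natDegree + R.natDegree ≤ m) (C : ℝ)
    (hC : ∀ (s : ℕ) (E : Type) [Field E] [Fintype E] [Algebra K E], 1 ≤ s → Module.finrank K E = 2 * s →
      ‖∑ x : E, χ1 (Algebra.norm K x) * χ2 (Algebra.norm K (aeval x F))‖ ≤ C * (Fintype.card K : ℝ) ^ s) :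
    ‖∑ x : K, χ1 x * χ2 (F.eval x)‖ ≤ (m - 1) * Real.sqrt (Fintype.card K) := by
  classical
  let S : ℕ → ℂ := fun r => ∑ P ∈ (mirr K r).filter (fun P => P.natDegree ∣ r),
    (P.natDegree : ℂ) * lam χ1 χ2 F P ^ (r / P.natDegree)
  have hm1 : 1 ≤ m := by have := hi.natDegree_pos; omega
  have h1 : ∑ x : K, χ1 x * χ2 (F.eval x) = S 1 := by
    have := ext_sum (E := K) χ1 χ2 F 1 (Module.finrank_self K)
    simp only [S]
    rw [← this]
    refine Finset.sum_congr rfl fun x _ => ?_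
    simp [Algebra.norm_self, coe_aeval_eq_eval]
  rw [h1]
  refine pw_main (fun n => ∑ h ∈ mdeg K n, lam χ1 χ2 F h) S m hm1 ?_ ?_ ?_ _ C ?_ ?_
  · have : mdeg K 0 = {1} := by
      ext h
      rw [mem_mdeg, Finset.mem_singleton]
      constructor
      · rintro ⟨a, b⟩; exact a.natDegree_eq_zero.1 b
      · rintro rfl; exact ⟨monic_one, natDegree_one⟩
    simp only [this, Finset.sum_singleton, lam_one]
  · intro n hn
    exact lam_sum_zero χ1 χ2 hχ F g F' R e hF he hg hi hR hcop hX hroot n (hm.trans hn)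
  · intro n
    exact newton (lam χ1 χ2 F) (lam_one _ _ _) (lam_mul χ1 χ2 F) S (fun r _ => rfl) n
  · exact_mod_cast Fintype.card_pos
  · intro r hr
    obtain ⟨p, hp⟩ := CharP.exists K
    have hpp : Fact p.Prime := ⟨CharP.char_is_prime K p⟩
    have : NeZero (2 * r) := ⟨by omega⟩
    let := Fintype.ofFinite (FiniteField.Extension K p (2 * r))
    have h2 := hC r (FiniteField.Extension K p (2 * r)) hr (FiniteField.finrank_extension K p (2 * r))
    rw [ext_sum χ1 χ2 F (2 * r) (FiniteField.finrank_extension K p (2 * r))] at h2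
    exact h2

/-! Part P4 -/

lemma gr_mult {K E : Type} [Field K] [Fintype K] [Field E] [Algebra K E] (F g F' : K[X]) (e : ℕ)
    (hF : F = g ^ e * F') (hi : Irreducible g) (h0 : g.eval 0 ≠ 0) (hcop : IsCoprime g F') (c : E) (hc : c ≠ 0) :
    (F.map (algebraMap K E)).comp (C c * X ^ (Fintype.card K - 1)) ≠ 0 ∧
    ∃ η : AlgebraicClosure E, (((F.map (algebraMap K E)).comp (C c * X ^ (Fintype.card K - 1))).map
      (algebraMap E (AlgebraicClosure E))).rootMultiplicity η = e := by
  classical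
  set D := Fintype.card K - 1 with hD
  have hD0 : D ≠ 0 := by have := Fintype.one_lt_card (α := K); omega
  let A := AlgebraicClosure E
  obtain ⟨ρ, hρ⟩ : ∃ ρ : A, aeval ρ g = 0 := by
    have := IsAlgClosed.exists_aeval_eq_zero A g (by
      have := Polynomial.degree_pos_of_irreducible hi
      exact this.ne')
    exact this
  set c' : A := algebraMap E A c with hc'
  have hc'0 : c' ≠ 0 := by simpa [hc'] using hc
  have hρ0 : ρ ≠ 0 := by
    rintro rfl
    have h3 := aeval_algebraMap_apply A (0:K) g
    rw [map_zero, hρ, coe_aeval_eq_eval] at h3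
    exact h0 ((map_eq_zero _).1 h3.symm)
  obtain ⟨η, hη⟩ := IsAlgClosed.exists_pow_nat_eq (ρ / c') (Nat.pos_of_ne_zero hD0)
  have hη2 : c' * η ^ D = ρ := by rw [hη, mul_div_cancel₀ _ hc'0]
  have hη0 : η ≠ 0 := by
    rintro rfl
    rw [zero_pow hD0, mul_zero] at hη2
    exact hρ0 hη2.symm
  have hmap : ∀ P : K[X], ((P.map (algebraMap K E)).comp (C c * X ^ D)).map (algebraMap E A)
      = (P.map (algebraMap K A)).comp (C c' * X ^ D) := by
    intro P
    rw [Polynomial.map_comp, Polynomial.map_map, ← IsScalarTower.algebraMap_eq]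
    simp [hc']
  have hev : ∀ P : K[X], eval η ((P.map (algebraMap K A)).comp (C c' * X ^ D)) = aeval ρ P := by
    intro P
    rw [eval_comp, eval_mul, eval_C, eval_pow, eval_X, hη2, eval_map_algebraMap]
  have hsep : g.Separable := PerfectField.separable_of_irreducible hi
  have hsep2 : aeval ρ (derivative g) ≠ 0 := hsep.aeval_derivative_ne_zero hρ
  have hF'ρ : aeval ρ F' ≠ 0 := by
    intro h
    obtain ⟨a, b, hab⟩ := hcop
    have := congrArg (aeval ρ) hab
    simp [hρ, h] at this
  have hDA : (D : A) ≠ 0 := by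
    have h1 : ((Fintype.card K : ℕ) : A) = 0 := by
      have : ((Fintype.card K : ℕ) : K) = 0 := FiniteField.cast_card_eq_zero K
      rw [← map_natCast (algebraMap K A), this, map_zero]
    have h2 : (D : A) + 1 = 0 := by
      rw [← h1, hD]
      have := Fintype.one_lt_card (α := K)
      norm_cast
      congr 1
      omega
    intro h
    rw [h] at h2
    simp at h2
  set g1 := (g.map (algebraMap K A)).comp (C c' * X ^ D) with hg1
  set F1 := (F'.map (algebraMap K A)).comp (C c' * X ^ D) with hF1
  have hder : eval η (derivative g1) ≠ 0 := by
    rw [hg1, derivative_comp, derivative_map, eval_mul, hev, derivative_C_mul, derivative_X_pow]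
    simp only [eval_mul, eval_C, eval_pow, eval_X]
    simp [hsep2, hc'0, hDA, hη0]
  have hg10 : g1 ≠ 0 := by
    intro h; rw [h] at hder; simp at hder
  have hm1 : g1.rootMultiplicity η = 1 := by
    have h1 : 0 < g1.rootMultiplicity η := (rootMultiplicity_pos hg10).2 (by rw [IsRoot, hg1, hev, hρ])
    have h2 : ¬ 1 < g1.rootMultiplicity η := by
      rw [one_lt_rootMultiplicity_iff_isRoot hg10]
      rintro ⟨-, h⟩
      exact hder h
    omega
  have hF10 : eval η F1 ≠ 0 := by rw [hF1, hev]; exact hF'ρ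
  have hF1ne : F1 ≠ 0 := by intro h; rw [h] at hF10; simp at hF10
  have hm2 : F1.rootMultiplicity η = 0 := rootMultiplicity_eq_zero hF10
  have hFF : (F.map (algebraMap K A)).comp (C c' * X ^ D) = g1 ^ e * F1 := by
    rw [hF]; simp [hg1, hF1]
  have hne : g1 ^ e * F1 ≠ 0 := mul_ne_zero (pow_ne_zero _ hg10) hF1ne
  constructor
  · intro h
    have := hmap F
    rw [h, hFF] at this
    simp at this
    tauto
  · refine ⟨η, ?_⟩
    rw [hmap, hFF, rootMultiplicity_mul hne, st_rm_pow, hm1, hm2]; simp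

lemma mc_norm_le {K : Type} [Field K] [Fintype K] (χ : MulChar K ℂ) (a : K) : ‖χ a‖ ≤ 1 := by
  by_cases h : a = 0
  · rw [h, MulChar.map_nonunit χ (by simp)]; simp
  · have h2 : χ a ^ (Fintype.card K - 1) = 1 := by
      rw [← map_pow, FiniteField.pow_card_sub_one_eq_one _ h, map_one]
    have := Fintype.one_lt_card (α := K)
    exact (Complex.norm_eq_one_of_pow_eq_one h2 (by omega)).le

lemma gr_T {K E : Type} [Field K] [Fintype K] [Field E] [Fintype E] [Algebra K E] (F g F' : K[X]) (e : ℕ)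
    (hF : F = g ^ e * F') (hi : Irreducible g) (h0 : g.eval 0 ≠ 0) (hcop : IsCoprime g F')
    (he : Nat.Coprime e (Fintype.card K - 1)) (c : E) (hc : c ≠ 0) (χ : MulChar K ℂ) (hχ : χ ≠ 1) (s : ℕ)
    (hs : Module.finrank K E = 2 * s) (d M C1 : ℕ) (hd : d = Fintype.card K - 1) (hM : M = F.natDegree * d)
    (hC1 : C1 = (1 + d * (4 * M + 6) + d * M + d * (d * (2 * M + 8) + 1))) :
    ‖∑ y : E, χ (Algebra.norm K (aeval (c * y ^ d) F))‖ ≤ (d * (C1 + M) : ℝ) * (Fintype.card K : ℝ) ^ s := by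
  classical
  obtain ⟨G0, η, hη⟩ := gr_mult F g F' e hF hi h0 hcop c hc
  rw [← hd] at G0 hη
  set G := (F.map (algebraMap K E)).comp (C c * X ^ d) with hG
  set Q := Fintype.card K with hQ
  have hQ1 : 1 < Q := Fintype.one_lt_card
  have hd0 : 0 < d := by omega
  obtain ⟨p, hp⟩ := CharP.exists K
  obtain ⟨m, hpp, hm⟩ := FiniteField.card K p
  have : Fact p.Prime := ⟨hpp⟩
  have : CharP E p := charP_of_injective_algebraMap (algebraMap K E).injective p
  have : ExpChar E p := ExpChar.prime hpp
  set u := Q ^ s with hu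
  have hu2 : u = p ^ ((m : ℕ) * s) := by rw [hu, hQ, hm, pow_mul]
  have hcardE : Fintype.card E = u ^ 2 := by
    rw [Module.card_eq_pow_finrank (K := K) (V := E), hs, hu]; ring
  obtain ⟨v, hv⟩ : ∃ v, u = d * v + 1 := by
    have h1 : d ∣ u - 1 := by
      have := Nat.sub_dvd_pow_sub_pow Q 1 s
      rwa [one_pow, ← hd] at this
    obtain ⟨v, hv⟩ := h1
    refine ⟨v, ?_⟩
    have : 0 < u := by positivity
    omega
  have hu1 : 1 ≤ u := by rw [hv]; omega
  have hnorm : ∀ z : E, algebraMap K E (Algebra.norm K z) = z ^ (v * (u + 1)) := by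
    intro z
    rw [FiniteField.algebraMap_norm_eq_pow, Nat.card_eq_fintype_card, Nat.card_eq_fintype_card, hcardE, ← hQ, ← hd]
    congr 1
    apply Nat.div_eq_of_eq_mul_right hd0
    have : u ^ 2 = d * (v * (u + 1)) + 1 := by
      have h3 : (u:ℤ) = d * v + 1 := by exact_mod_cast hv
      zify
      linear_combination ((u:ℤ) + 1) * h3
    omega
  have hevG : ∀ y : E, G.eval y = aeval (c * y ^ d) F := by
    intro y
    rw [hG, eval_comp, eval_map_algebraMap]; simp
  have hGdeg : G.natDegree ≤ M := by
    rw [hG, natDegree_comp, natDegree_map, hM]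
    gcongr
    exact natDegree_C_mul_X_pow_le c d
  let N : K → ℕ := fun a => (Finset.univ.filter (fun y : E => Algebra.norm K (aeval (c * y ^ d) F) = a)).card
  have hN : ∀ a, a ≠ 0 → d * N a ≤ u ^ 2 + C1 * u := by
    intro a ha
    have := stepanov (K := E) p ((m:ℕ) * s) (by rw [← hu2, hcardE]) d v (by rw [← hu2, hv]) hd0 G G0 η
      (by rw [hη, hd]; exact he) (algebraMap K E a) (by simpa using ha)
      (Finset.univ.filter (fun y : E => Algebra.norm K (aeval (c * y ^ d) F) = a)) (by
        intro x hx
        simp only [Finset.mem_filter, Finset.mem_univ, true_and] at hx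
        rw [hevG, ← hu2, ← hnorm, hx]) M hGdeg
    rw [← hu2, ← hC1] at this
    exact this
  have hN0 : N 0 ≤ M := by
    refine le_trans ?_ ((card_roots' G).trans hGdeg)
    refine le_trans (Finset.card_le_card ?_) (Multiset.toFinset_card_le _)
    intro y hy
    simp only [Finset.mem_filter, Finset.mem_univ, true_and] at hy
    rw [Multiset.mem_toFinset, mem_roots G0, IsRoot, hevG]
    exact Algebra.norm_eq_zero_iff.1 hy
  have hNsum : ∑ a, N a = u ^ 2 := by
    rw [← hcardE, ← Finset.card_univ]
    exact (Finset.card_eq_sum_card_fiberwise (fun _ _ => Finset.mem_univ _)).symm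
  have hcardK : (Finset.univ.erase (0:K)).card = d := by
    rw [Finset.card_erase_of_mem (Finset.mem_univ _), Finset.card_univ, hd]
  have hlow : ∀ a, a ≠ 0 → u ^ 2 ≤ d * N a + d * (C1 + M) * u := by
    intro a ha
    have h1 : u ^ 2 = N 0 + (N a + ∑ b ∈ (Finset.univ.erase (0:K)).erase a, N b) := by
      rw [← hNsum, Finset.add_sum_erase _ _ (by simp [ha]), Finset.add_sum_erase _ _ (Finset.mem_univ _)]
    have h2 : d * ∑ b ∈ (Finset.univ.erase (0:K)).erase a, N b ≤ (d - 1) * (u ^ 2 + C1 * u) := by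
      rw [Finset.mul_sum]
      refine (Finset.sum_le_card_nsmul _ _ (u ^ 2 + C1 * u) ?_).trans ?_
      · intro b hb
        exact hN b (by simp at hb; tauto)
      · rw [Finset.card_erase_of_mem (by simp [ha]), hcardK, smul_eq_mul]
    obtain ⟨d', hd'⟩ : ∃ d', d = d' + 1 := ⟨d - 1, by omega⟩
    have h3 : d - 1 = d' := by omega
    rw [h3] at h2
    have h4 : d * N 0 ≤ d * M * u := by
      calc d * N 0 ≤ d * M := by gcongr
        _ ≤ d * M * u := Nat.le_mul_of_pos_right _ hu1
    have h5 : d * u ^ 2 = d * N 0 + (d * N a + d * ∑ b ∈ (Finset.univ.erase (0:K)).erase a, N b) := by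
      conv_lhs => rw [h1]
      ring
    have h6 : d' * (C1 * u) ≤ d * C1 * u := by
      rw [mul_assoc]; gcongr; omega
    have h7 : d * u ^ 2 = d' * u ^ 2 + u ^ 2 := by rw [hd']; ring
    nlinarith
  have hNabs : ∀ a, a ≠ 0 → |(d * N a : ℝ) - (u:ℝ) ^ 2| ≤ d * (C1 + M) * u := by
    intro a ha
    have h1 : ((d * N a : ℕ) : ℝ) ≤ ((u ^ 2 + C1 * u : ℕ) : ℝ) := by exact_mod_cast hN a ha
    have h2 : ((u ^ 2 : ℕ) : ℝ) ≤ ((d * N a + d * (C1 + M) * u : ℕ) : ℝ) := by exact_mod_cast hlow a ha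
    push_cast at h1 h2
    have hd1 : (1:ℝ) ≤ d := by exact_mod_cast hd0
    have h3 : (C1 * u : ℝ) ≤ d * (C1 + M) * u := by
      gcongr
      nlinarith [Nat.cast_nonneg (α := ℝ) C1, Nat.cast_nonneg (α := ℝ) M]
    rw [abs_le]
    constructor <;> linarith
  have hT : (d : ℂ) * ∑ y : E, χ (Algebra.norm K (aeval (c * y ^ d) F)) =
      ∑ a ∈ Finset.univ.erase (0:K), χ a * (((d * N a : ℝ) - (u:ℝ) ^ 2 : ℝ) : ℂ) := by
    have h1 : ∑ y : E, χ (Algebra.norm K (aeval (c * y ^ d) F)) = ∑ a : K, (N a : ℂ) * χ a := by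
      rw [← Finset.sum_fiberwise (s := Finset.univ) (g := fun y : E => Algebra.norm K (aeval (c * y ^ d) F))]
      refine Finset.sum_congr rfl fun a _ => ?_
      rw [Finset.sum_congr rfl (g := fun _ => χ a) (fun y hy => by
        rw [(Finset.mem_filter.1 hy).2])]
      rw [Finset.sum_const, nsmul_eq_mul]
    have h2 : ∑ a : K, χ a = 0 := MulChar.sum_eq_zero_of_ne_one hχ
    rw [h1, Finset.sum_erase _ (by simp [MulChar.map_nonunit])]
    push_cast
    rw [Finset.mul_sum]
    have : ∑ a : K, χ a * ((d:ℂ) * N a - (u:ℂ) ^ 2) = ∑ a : K, d * (N a * χ a) - (∑ a : K, χ a) * u ^ 2 := by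
      rw [Finset.sum_mul, ← Finset.sum_sub_distrib]
      exact Finset.sum_congr rfl fun a _ => by ring
    rw [this, h2]; simp
  have hfin : (d : ℝ) * ‖∑ y : E, χ (Algebra.norm K (aeval (c * y ^ d) F))‖ ≤ d * (d * (C1 + M) * u) := by
    have : (d : ℝ) * ‖∑ y : E, χ (Algebra.norm K (aeval (c * y ^ d) F))‖ =
      ‖(d : ℂ) * ∑ y : E, χ (Algebra.norm K (aeval (c * y ^ d) F))‖ := by
      rw [norm_mul, Complex.norm_natCast]
    rw [this, hT]
    refine (norm_sum_le _ _).trans ?_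
    refine (Finset.sum_le_card_nsmul _ _ (d * (C1 + M) * u : ℝ) ?_).trans ?_
    · intro a ha
      have ha0 : a ≠ 0 := Finset.ne_of_mem_erase ha
      rw [norm_mul, Complex.norm_real, Real.norm_eq_abs]
      have hn : ‖χ a‖ ≤ 1 := mc_norm_le χ a
      calc _ ≤ 1 * |(d * N a : ℝ) - (u:ℝ) ^ 2| := by gcongr
        _ ≤ _ := by rw [one_mul]; exact hNabs a ha0
    · rw [hcardK, nsmul_eq_mul]
  have hdpos : (0:ℝ) < d := by exact_mod_cast hd0
  have := le_of_mul_le_mul_left hfin hdpos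
  rw [hu] at this
  exact_mod_cast this

lemma gr_S {K E : Type} [Field K] [Fintype K] [Field E] [Fintype E] [Algebra K E] (F g F' : K[X]) (e : ℕ)
    (hF : F = g ^ e * F') (hi : Irreducible g) (h0 : g.eval 0 ≠ 0) (hcop : IsCoprime g F')
    (he : Nat.Coprime e (Fintype.card K - 1)) (χ1 χ : MulChar K ℂ) (hχ : χ ≠ 1) (s : ℕ)
    (hs : Module.finrank K E = 2 * s) (d M C1 : ℕ) (hd : d = Fintype.card K - 1) (hM : M = F.natDegree * d)
    (hC1 : C1 = (1 + d * (4 * M + 6) + d * M + d * (d * (2 * M + 8) + 1))) :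
    ‖∑ x : E, χ1 (Algebra.norm K x) * χ (Algebra.norm K (aeval x F))‖ ≤
      (d * (C1 + M) + 1 : ℝ) * (Fintype.card K : ℝ) ^ s := by
  classical
  set S := ∑ x : E, χ1 (Algebra.norm K x) * χ (Algebra.norm K (aeval x F)) with hS
  set u : ℝ := (Fintype.card K : ℝ) ^ s with hu
  have hQ1 : 1 < Fintype.card K := Fintype.one_lt_card
  have hd0 : d ≠ 0 := by omega
  have hu1 : 1 ≤ u := one_le_pow₀ (by exact_mod_cast hQ1.le)
  have h1 : ∀ y : E, y ≠ 0 → S = ∑ c : E, χ1 (Algebra.norm K c) * χ (Algebra.norm K (aeval (c * y ^ d) F)) := by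
    intro y hy
    have hyd : y ^ d ≠ 0 := pow_ne_zero _ hy
    rw [hS, ← Equiv.sum_comp (Equiv.mulRight₀ (y ^ d) hyd)]
    refine Finset.sum_congr rfl fun c _ => ?_
    change χ1 (Algebra.norm K (c * y ^ d)) * χ (Algebra.norm K (aeval (c * y ^ d) F)) = _
    have hny : Algebra.norm K y ≠ 0 := by rwa [Ne, Algebra.norm_eq_zero_iff]
    rw [map_mul, map_pow, hd, FiniteField.pow_card_sub_one_eq_one _ hny, mul_one]
  have hcE : ((Finset.univ.erase (0:E)).card : ℝ) = Fintype.card E - 1 := by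
    rw [Finset.card_erase_of_mem (Finset.mem_univ _), Finset.card_univ, Nat.cast_sub Fintype.card_pos]; simp
  have h2 : ((Finset.univ.erase (0:E)).card : ℂ) * S = ∑ c ∈ Finset.univ.erase (0:E), χ1 (Algebra.norm K c) *
      (∑ y : E, χ (Algebra.norm K (aeval (c * y ^ d) F)) - χ (Algebra.norm K (aeval (0:E) F))) := by
    rw [← nsmul_eq_mul, ← Finset.sum_const, Finset.sum_congr rfl (fun y hy => h1 y (Finset.ne_of_mem_erase hy)),
      Finset.sum_comm]
    rw [Finset.sum_erase _ (by rw [Algebra.norm_zero, MulChar.map_nonunit χ1 (by simp)]; simp)]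
    refine Finset.sum_congr rfl fun c _ => ?_
    rw [← Finset.mul_sum, Finset.sum_erase_eq_sub (Finset.mem_univ _)]
    simp [zero_pow hd0]
  have h3 : ((Finset.univ.erase (0:E)).card : ℝ) * ‖S‖ ≤ (Finset.univ.erase (0:E)).card * ((d * (C1 + M) + 1 : ℝ) * u) := by
    have : ((Finset.univ.erase (0:E)).card : ℝ) * ‖S‖ = ‖((Finset.univ.erase (0:E)).card : ℂ) * S‖ := by
      rw [norm_mul, Complex.norm_natCast]
    rw [this, h2]
    refine (norm_sum_le _ _).trans ?_
    rw [← nsmul_eq_mul]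
    refine Finset.sum_le_card_nsmul _ _ _ ?_
    intro c hc
    have hc0 : c ≠ 0 := Finset.ne_of_mem_erase hc
    have h4 := gr_T F g F' e hF hi h0 hcop he c hc0 χ hχ s hs d M C1 hd hM hC1
    rw [norm_mul]
    have hn : ‖χ1 (Algebra.norm K c)‖ ≤ 1 := mc_norm_le χ1 _
    have hn2 : ‖χ (Algebra.norm K (aeval (0:E) F))‖ ≤ 1 := mc_norm_le χ _
    refine (mul_le_mul hn (norm_sub_le _ _) (norm_nonneg _) zero_le_one).trans ?_
    rw [one_mul]
    refine (add_le_add h4 hn2).trans ?_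
    rw [← hu]
    linarith
  have h4 : (0:ℝ) < (Finset.univ.erase (0:E)).card := by
    have : (1:E) ∈ Finset.univ.erase (0:E) := by simp
    exact_mod_cast Finset.card_pos.2 ⟨_, this⟩
  exact le_of_mul_le_mul_left h3 h4

lemma weil_gen {K : Type} [Field K] [Fintype K] (χ1 χ2 : MulChar K ℂ) (hχ : χ2 ≠ 1) (F g F' R : K[X]) (e : ℕ)
    (hF : F = g ^ e * F') (he : Nat.Coprime e (Fintype.card K - 1)) (hg : g.Monic) (hi : Irreducible g)
    (hR : R ≠ 0) (hcop : IsCoprime g R) (hX : X ∣ R)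
    (hroot : ∀ ρ : AlgebraicClosure K, aeval ρ F' = 0 → aeval ρ R = 0) (m : ℕ)
    (hm : g.natDegree + R.natDegree ≤ m) :
    ‖∑ x : K, χ1 x * χ2 (F.eval x)‖ ≤ (m - 1) * Real.sqrt (Fintype.card K) := by
  have h0 : g.eval 0 ≠ 0 := by
    intro h
    obtain ⟨a, b, hab⟩ := hcop
    obtain ⟨r, rfl⟩ := hX
    have := congrArg (eval 0) hab
    simp [h] at this
  have hcop' : IsCoprime g F' := by
    rw [hi.coprime_iff_not_dvd]
    rintro ⟨w, rfl⟩
    obtain ⟨ρ, hρ⟩ : ∃ ρ : AlgebraicClosure K, aeval ρ g = 0 :=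
      IsAlgClosed.exists_aeval_eq_zero _ g (Polynomial.degree_pos_of_irreducible hi).ne'
    have h2 := hroot ρ (by simp [hρ])
    obtain ⟨a, b, hab⟩ := hcop
    have := congrArg (aeval ρ) hab
    simp [hρ, h2] at this
  refine weil_of_growth χ1 χ2 hχ F g F' R e hF he hg hi hR hcop hX hroot m hm
    (C := ((Fintype.card K - 1 : ℕ) * ((1 + (Fintype.card K - 1) * (4 * (F.natDegree * (Fintype.card K - 1)) + 6) +
      (Fintype.card K - 1) * (F.natDegree * (Fintype.card K - 1)) + (Fintype.card K - 1) * ((Fintype.card K - 1) *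
      (2 * (F.natDegree * (Fintype.card K - 1)) + 8) + 1) : ℕ) + (F.natDegree * (Fintype.card K - 1) : ℕ)) + 1 : ℝ)) ?_
  intro s E _ _ _ _ hE
  exact gr_S F g F' e hF hi h0 hcop' he χ1 χ2 hχ s hE _ _ _ rfl rfl rfl

/-! Part P5 -/

/-- `h` is a combination of multiplicative characters of order dividing `m`. -/
def SvRep {L : Type} [Field L] [Fintype L] [Fintype (MulChar L ℂ)] (h : L → ℝ) (θ C : ℝ) (m : ℕ) : Prop :=
  ∃ c : MulChar L ℂ → ℂ, (∀ y, (h y : ℂ) = ∑ χ, c χ * χ y) ∧ c 1 = θ ∧ ∑ χ, ‖c χ‖ ≤ C ∧ ∀ χ, c χ ≠ 0 → χ ^ m = 1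

open Classical in
/-- indicator of `p`-th powers -/
noncomputable def svInd {L : Type} [Field L] [Fintype L] (p : ℕ) (y : L) : ℝ :=
  if y ^ ((Fintype.card L - 1) / p) = 1 then 1 else 0

lemma sv_char {L : Type} [Field L] [Fintype L] (p : ℕ) (hp : p.Prime) (hd : p ∣ Fintype.card L - 1) :
    ∃ χ : MulChar L ℂ, orderOf χ = p ∧ ∀ y : L, y ≠ 0 → (svInd p y : ℂ) = (1 / p) * ∑ i ∈ Finset.range p, (χ ^ i) y := by
  classical
  obtain ⟨χ, hχ⟩ := MulChar.exists_mulChar_orderOf L hd (Complex.isPrimitiveRoot_exp p hp.ne_zero)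
  refine ⟨χ, hχ, ?_⟩
  intro y hy
  have hp0 : (p:ℂ) ≠ 0 := by exact_mod_cast hp.ne_zero
  obtain ⟨n, hn⟩ := hd
  have hQ := Fintype.one_lt_card (α := L)
  have hdiv : (Fintype.card L - 1) / p = n := by rw [hn]; exact Nat.mul_div_cancel_left _ hp.pos
  have hn0 : 0 < n := by
    rcases Nat.eq_zero_or_pos n with h | h
    · rw [h] at hn; omega
    · exact h
  have hpow : ∀ z : L, z ≠ 0 → χ z ^ p = 1 := by
    intro z hz
    rw [← MulChar.pow_apply' χ hp.ne_zero, ← hχ, pow_orderOf_eq_one, MulChar.one_apply (by simpa using hz)]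
  have hsum : ∑ i ∈ Finset.range p, (χ ^ i) y = ∑ i ∈ Finset.range p, (χ y) ^ i := by
    refine Finset.sum_congr rfl fun i _ => ?_
    exact MulChar.pow_apply_coe χ i (Units.mk0 y hy)
  obtain ⟨γ, hγ⟩ := IsCyclic.exists_generator (α := Lˣ)
  obtain ⟨k, hk⟩ := mem_zpowers_iff_mem_range_orderOf.1 (hγ (Units.mk0 y hy)) |> Finset.mem_image.1
  have hk2 : y = (γ:L) ^ k := by
    have := congrArg Units.val hk.2
    simpa using this.symm
  have hord : orderOf γ = p * n := by
    rw [orderOf_eq_card_of_forall_mem_zpowers hγ, Nat.card_eq_fintype_card, Fintype.card_units, hn]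
  have hiff : y ^ n = 1 ↔ p ∣ k := by
    rw [hk2, ← pow_mul, ← Units.val_pow_eq_pow_val, Units.val_eq_one, ← orderOf_dvd_iff_pow_eq_one, hord]
    exact Nat.mul_dvd_mul_iff_right hn0
  rw [svInd, hdiv, hsum]
  by_cases h : y ^ n = 1
  · obtain ⟨j, hj⟩ := hiff.1 h
    have : χ y = 1 := by
      rw [hk2, hj, mul_comm, pow_mul, map_pow]
      exact hpow _ (pow_ne_zero _ (Units.ne_zero γ))
    simp [h, this, hp0]
  · rw [if_neg h]
    have hne : χ y ≠ 1 := by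
      intro h1
      have hc : Nat.Coprime p k := (Nat.Prime.coprime_iff_not_dvd hp).2 (fun h2 => h (hiff.2 h2))
      have hγ1 : χ γ = 1 := by
        have e1 : χ γ ^ p = 1 := hpow _ (Units.ne_zero γ)
        have e2 : χ γ ^ k = 1 := by rw [← map_pow, ← hk2, h1]
        have := pow_gcd_eq_one.2 ⟨e1, e2⟩
        rwa [hc, pow_one] at this
      have : χ = 1 := by
        ext z
        obtain ⟨j, hj⟩ := mem_zpowers_iff_mem_range_orderOf.1 (hγ z) |> Finset.mem_image.1
        rw [← hj.2, Units.val_pow_eq_pow_val, map_pow, hγ1, one_pow, ← Units.val_pow_eq_pow_val, MulChar.one_apply_coe]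
      rw [this, orderOf_one] at hχ
      exact hp.one_lt.ne hχ
    have hg := geom_sum_eq hne p
    rw [hpow y hy, sub_self, zero_div] at hg
    simp [hg]

lemma sv_zero {L : Type} [Field L] [Fintype L] [Fintype (MulChar L ℂ)] {h : L → ℝ} {θ C : ℝ} {m : ℕ}
    (H : SvRep h θ C m) : h 0 = 0 := by
  obtain ⟨c, h1, -⟩ := H
  have := h1 0
  simp only [MulChar.map_zero, mul_zero, Finset.sum_const_zero] at this
  exact_mod_cast this

lemma sv_step {L : Type} [Field L] [Fintype L] [Fintype (MulChar L ℂ)] (h : L → ℝ) (θ C : ℝ) (m : ℕ)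
    (H : SvRep h θ C m) (p : ℕ) (hp : p.Prime) (hd : p ∣ Fintype.card L - 1) (hpm : ¬ p ∣ m) :
    SvRep (fun y => h y * (svInd p y - 1 / p)) 0 ((1 - 1 / p) * C) (m * p) := by
  classical
  have hz := sv_zero H
  obtain ⟨c, h1, h2, h3, h4⟩ := H
  obtain ⟨ξ, hξ, hind⟩ := sv_char p hp hd
  have hp0 : (p:ℂ) ≠ 0 := by exact_mod_cast hp.ne_zero
  have hp0' : (p:ℝ) ≠ 0 := by exact_mod_cast hp.ne_zero
  refine ⟨fun χ => (1 / p) * ∑ i ∈ (Finset.range p).erase 0, c (χ * (ξ ^ i)⁻¹), ?_, ?_, ?_, ?_⟩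
  · intro y
    by_cases hy : y = 0
    · subst hy; simp only [hz, MulChar.map_zero, mul_zero, Finset.sum_const_zero, zero_mul, Complex.ofReal_zero]
    · push_cast
      rw [hind y hy]
      have e1 : ∑ χ : MulChar L ℂ, ((1 / p : ℂ) * ∑ i ∈ (Finset.range p).erase 0, c (χ * (ξ ^ i)⁻¹)) * χ y =
          (1 / p) * ∑ i ∈ (Finset.range p).erase 0, ∑ χ : MulChar L ℂ, c (χ * (ξ ^ i)⁻¹) * χ y := by
        rw [Finset.sum_comm, Finset.mul_sum]
        refine Finset.sum_congr rfl fun χ _ => ?_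
        rw [mul_assoc, Finset.sum_mul]
      have e2 : ∀ i, ∑ χ : MulChar L ℂ, c (χ * (ξ ^ i)⁻¹) * χ y = (h y : ℂ) * (ξ ^ i) y := by
        intro i
        rw [h1 y, Finset.sum_mul, ← Equiv.sum_comp (Equiv.mulRight (ξ ^ i))]
        refine Finset.sum_congr rfl fun χ _ => ?_
        simp [mul_assoc]
      rw [e1, Finset.sum_congr rfl (fun i _ => e2 i), ← Finset.mul_sum]
      rw [Finset.sum_erase_eq_sub (by simp [hp.pos]), pow_zero, MulChar.one_apply (by simpa using hy)]
      ring
  · simp only [Complex.ofReal_zero]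
    rw [Finset.sum_eq_zero, mul_zero]
    intro i hi
    by_contra hne
    have := h4 _ hne
    rw [one_mul, inv_pow, inv_eq_one, ← pow_mul, ← orderOf_dvd_iff_pow_eq_one, hξ] at this
    simp at hi
    rcases hp.dvd_mul.1 this with h | h
    · have := Nat.le_of_dvd (Nat.pos_of_ne_zero hi.1) h
      omega
    · exact hpm h
  · have e1 : ∀ χ : MulChar L ℂ, ‖(1 / p : ℂ) * ∑ i ∈ (Finset.range p).erase 0, c (χ * (ξ ^ i)⁻¹)‖ ≤
        (1 / p) * ∑ i ∈ (Finset.range p).erase 0, ‖c (χ * (ξ ^ i)⁻¹)‖ := by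
      intro χ
      rw [norm_mul, norm_div, norm_one, Complex.norm_natCast]
      gcongr
      exact norm_sum_le _ _
    refine (Finset.sum_le_sum fun χ _ => e1 χ).trans ?_
    rw [← Finset.mul_sum, Finset.sum_comm]
    have e2 : ∀ i, ∑ χ : MulChar L ℂ, ‖c (χ * (ξ ^ i)⁻¹)‖ = ∑ χ : MulChar L ℂ, ‖c χ‖ := by
      intro i
      rw [← Equiv.sum_comp (Equiv.mulRight (ξ ^ i))]
      refine Finset.sum_congr rfl fun χ _ => ?_
      simp [mul_assoc]
    rw [Finset.sum_congr rfl (fun i _ => e2 i), Finset.sum_const, Finset.card_erase_of_mem (by simp [hp.pos]),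
      Finset.card_range, nsmul_eq_mul, Nat.cast_sub hp.one_le, ← mul_assoc]
    have e3 : (1 / (p:ℝ)) * ((p:ℝ) - (1:ℕ)) = 1 - 1 / p := by field_simp; simp
    rw [e3]
    have : (1:ℝ) / p ≤ 1 := by
      rw [div_le_one (by exact_mod_cast hp.pos)]; exact_mod_cast hp.one_le
    gcongr
  · intro χ hχ
    by_contra hne
    apply hχ
    beta_reduce
    rw [Finset.sum_eq_zero, mul_zero]
    intro i hi
    by_contra h5
    have := h4 _ h5
    apply hne
    rw [mul_pow, inv_pow, mul_inv_eq_one] at this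
    have hxp : ξ ^ p = 1 := by rw [← hξ]; exact pow_orderOf_eq_one ξ
    rw [pow_mul, this, ← pow_mul, ← pow_mul, show i * (m * p) = p * (i * m) by ring, pow_mul, hxp, one_pow]

lemma sv_step2 {L : Type} [Field L] [Fintype L] [Fintype (MulChar L ℂ)] (h : L → ℝ) (θ C : ℝ) (m : ℕ)
    (H : SvRep h θ C m) (p : ℕ) (hp : p.Prime) (hd : p ∣ Fintype.card L - 1) (hpm : ¬ p ∣ m) :
    SvRep (fun y => h y * (1 - svInd p y)) (θ * (1 - 1 / p)) (C * (2 * (1 - 1 / p))) (m * p) := by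
  obtain ⟨b, g1, g2, g3, g4⟩ := sv_step h θ C m H p hp hd hpm
  obtain ⟨c, h1, h2, h3, h4⟩ := H
  have hp1 : (0:ℝ) ≤ 1 - 1 / p := by
    have : (1:ℝ) / p ≤ 1 := by
      rw [div_le_one (by exact_mod_cast hp.pos)]; exact_mod_cast hp.one_le
    linarith
  refine ⟨fun χ => ((1 - 1 / p : ℝ) : ℂ) * c χ - b χ, ?_, ?_, ?_, ?_⟩
  · intro y
    simp only [sub_mul, Finset.sum_sub_distrib, mul_assoc, ← Finset.mul_sum]
    rw [← h1, ← g1]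
    push_cast; ring
  · simp only [h2, g2]; push_cast; ring
  · calc ∑ χ, ‖((1 - 1 / p : ℝ) : ℂ) * c χ - b χ‖ ≤ ∑ χ, ((1 - 1 / p : ℝ) * ‖c χ‖ + ‖b χ‖) := by
          refine Finset.sum_le_sum fun χ _ => (norm_sub_le _ _).trans ?_
          rw [norm_mul, Complex.norm_real, Real.norm_of_nonneg hp1]
      _ = (1 - 1 / p : ℝ) * ∑ χ, ‖c χ‖ + ∑ χ, ‖b χ‖ := by rw [Finset.sum_add_distrib, Finset.mul_sum]
      _ ≤ (1 - 1 / p : ℝ) * C + (1 - 1 / p) * C := by gcongr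
      _ = _ := by ring
  · intro χ hχ
    by_cases hc : c χ = 0
    · apply g4; rintro hb; simp [hc, hb] at hχ
    · rw [pow_mul, h4 χ hc, one_pow]

open Classical in
/-- the indicator of nonzero elements which are not `p`-th powers for `p ∈ A` -/
noncomputable def svH {L : Type} [Field L] [Fintype L] (A : Finset ℕ) (y : L) : ℝ :=
  (if y = 0 then 0 else 1) * ∏ p ∈ A, (1 - svInd p y)

lemma svH_rep {L : Type} [Field L] [Fintype L] [Fintype (MulChar L ℂ)] (A : Finset ℕ)
    (hA : A ⊆ (Fintype.card L - 1).primeFactors) :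
    SvRep (svH (L := L) A) (∏ p ∈ A, (1 - 1 / (p:ℝ))) (∏ p ∈ A, (2 * (1 - 1 / (p:ℝ)))) (∏ p ∈ A, p) := by
  classical
  induction A using Finset.induction_on with
  | empty =>
    refine ⟨fun χ => if χ = 1 then 1 else 0, ?_, by simp, ?_, ?_⟩
    · intro y
      simp only [svH, ite_mul, one_mul, zero_mul, Finset.sum_ite_eq', Finset.mem_univ, if_true, Finset.prod_empty]
      by_cases hy : y = 0
      · subst hy; simp only [if_true, MulChar.map_zero, Complex.ofReal_zero]
      · simp [hy, MulChar.one_apply (by simpa using hy : IsUnit y)]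
    · rw [Finset.sum_eq_single 1]
      · simp
      · intro b _ hb; simp [hb]
      · simp
    · intro χ hχ
      simp at hχ
      simp [hχ]
  | insert p A hp ih =>
    have hA' : A ⊆ (Fintype.card L - 1).primeFactors := fun x hx => hA (Finset.mem_insert_of_mem hx)
    have hpp := hA (Finset.mem_insert_self p A)
    have hpr := Nat.prime_of_mem_primeFactors hpp
    have := sv_step2 _ _ _ _ (ih hA') p hpr (Nat.dvd_of_mem_primeFactors hpp) (by
      rw [Prime.dvd_finsetProd_iff hpr.prime]
      rintro ⟨r, hr, hd⟩
      have := (Nat.prime_dvd_prime_iff_eq hpr (Nat.prime_of_mem_primeFactors (hA' hr))).1 hd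
      exact hp (this ▸ hr))
    rw [Finset.prod_insert hp, Finset.prod_insert hp, Finset.prod_insert hp, mul_comm p, mul_comm (1 - 1 / (p:ℝ)),
      mul_comm (2 * (1 - 1 / (p:ℝ)))]
    convert! this using 1
    ext y
    rw [svH, svH, Finset.prod_insert hp]; ring

lemma sv_bil {L : Type} [Field L] [Fintype L] [Fintype (MulChar L ℂ)] (φ : L → L) (B : ℝ)
    (hB : ∀ χ1 χ2 : MulChar L ℂ, ¬ (χ1 = 1 ∧ χ2 = 1) → ‖∑ x, χ1 x * χ2 (φ x)‖ ≤ B)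
    (h1 h2 : L → ℝ) (t1 t2 C1 C2 : ℝ) (m1 m2 : ℕ) (H1 : SvRep h1 t1 C1 m1) (H2 : SvRep h2 t2 C2 m2) (N0 : ℝ)
    (hN0 : ∑ x, (1 : MulChar L ℂ) x * (1 : MulChar L ℂ) (φ x) = N0) (hB0 : 0 ≤ B) :
    |∑ x, h1 x * h2 (φ x) - t1 * t2 * N0| ≤ (C1 * C2 - |t1 * t2|) * B := by
  classical
  obtain ⟨c, e1, e2, e3, -⟩ := H1
  obtain ⟨b, g1, g2, g3, -⟩ := H2
  let S : MulChar L ℂ × MulChar L ℂ → ℂ := fun z => ∑ x, z.1 x * z.2 (φ x)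
  have key : ((∑ x, h1 x * h2 (φ x) : ℝ) : ℂ) = ∑ z : MulChar L ℂ × MulChar L ℂ, c z.1 * b z.2 * S z := by
    push_cast
    simp only [e1, g1, S]
    rw [Finset.sum_congr rfl (g := fun x => ∑ z : MulChar L ℂ × MulChar L ℂ, (c z.1 * z.1 x) * (b z.2 * z.2 (φ x)))]
    · rw [Finset.sum_comm]
      refine Finset.sum_congr rfl fun z _ => ?_
      rw [Finset.mul_sum]
      exact Finset.sum_congr rfl fun x _ => by ring
    · intro x _
      rw [Fintype.sum_mul_sum, Fintype.sum_prod_type]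
  have key2 : ((∑ x, h1 x * h2 (φ x) - t1 * t2 * N0 : ℝ) : ℂ) = ∑ z ∈ Finset.univ.erase (1, 1), c z.1 * b z.2 * S z := by
    rw [Finset.sum_erase_eq_sub (Finset.mem_univ _), ← key]
    simp only [S, hN0, e2, g2]
    push_cast; ring
  have habs : |∑ x, h1 x * h2 (φ x) - t1 * t2 * N0| = ‖((∑ x, h1 x * h2 (φ x) - t1 * t2 * N0 : ℝ) : ℂ)‖ := by
    rw [Complex.norm_real, Real.norm_eq_abs]
  rw [habs, key2]
  calc _ ≤ ∑ z ∈ Finset.univ.erase ((1, 1) : MulChar L ℂ × MulChar L ℂ), ‖c z.1‖ * ‖b z.2‖ * B := by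
        refine (norm_sum_le _ _).trans (Finset.sum_le_sum fun z hz => ?_)
        rw [norm_mul, norm_mul]
        gcongr
        refine hB z.1 z.2 ?_
        rintro ⟨h3, h4⟩
        exact (Finset.ne_of_mem_erase hz) (Prod.ext h3 h4)
    _ = ((∑ χ, ‖c χ‖) * (∑ χ, ‖b χ‖) - |t1 * t2|) * B := by
        rw [← Finset.sum_mul, Finset.sum_erase_eq_sub (Finset.mem_univ _), Fintype.sum_mul_sum, Fintype.sum_prod_type]
        simp only [e2, g2]
        rw [Complex.norm_real, Complex.norm_real, abs_mul]; rfl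
    _ ≤ _ := by
        have : 0 ≤ C1 := le_trans (Finset.sum_nonneg fun _ _ => norm_nonneg _) e3
        gcongr

lemma svInd_01 {L : Type} [Field L] [Fintype L] (p : ℕ) (y : L) : svInd p y = 0 ∨ svInd p y = 1 := by
  unfold svInd; split_ifs <;> simp

lemma svH_01 {L : Type} [Field L] [Fintype L] (A : Finset ℕ) (y : L) : svH A y = 0 ∨ svH A y = 1 := by
  classical
  unfold svH
  have : ∏ p ∈ A, (1 - svInd p y) = 0 ∨ ∏ p ∈ A, (1 - svInd p y) = 1 := by
    by_cases h : ∃ p ∈ A, svInd p y = 1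
    · obtain ⟨p, hp, h⟩ := h
      left; exact Finset.prod_eq_zero hp (by rw [h]; simp)
    · right
      refine Finset.prod_eq_one fun p hp => ?_
      rcases svInd_01 p y with h1 | h1
      · rw [h1]; simp
      · exact absurd ⟨p, hp, h1⟩ h
  split_ifs
  · simp
  · simpa using this

lemma svH_eq_one {L : Type} [Field L] [Fintype L] (A : Finset ℕ) (y : L) (h0 : y ≠ 0) (h : ∀ p ∈ A, svInd p y = 0) :
    svH A y = 1 := by
  classical
  unfold svH
  rw [if_neg h0, one_mul]
  exact Finset.prod_eq_one fun p hp => by rw [h p hp]; simp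

lemma svH_mem {L : Type} [Field L] [Fintype L] (A : Finset ℕ) (y : L) (h : svH A y ≠ 0) :
    y ≠ 0 ∧ ∀ p ∈ A, y ^ ((Fintype.card L - 1) / p) ≠ 1 := by
  classical
  unfold svH at h
  constructor
  · rintro rfl; simp at h
  · intro p hp he
    apply h
    rw [Finset.prod_eq_zero hp, mul_zero]
    rw [svInd, if_pos he]; simp

lemma svH_le {L : Type} [Field L] [Fintype L] (A B : Finset ℕ) (x y : L) :
    svH A x * svH A y * (1 - ∑ p ∈ B, svInd p x - ∑ p ∈ B, svInd p y) ≤ svH (A ∪ B) x * svH (A ∪ B) y := by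
  classical
  have hn : ∀ A : Finset ℕ, ∀ y : L, 0 ≤ svH A y := fun A y => by rcases svH_01 A y with h | h <;> rw [h]; norm_num
  have hi : ∀ p, ∀ y : L, 0 ≤ svInd p y := fun p y => by rcases svInd_01 p y with h | h <;> rw [h]; norm_num
  have hr : 0 ≤ svH (A ∪ B) x * svH (A ∪ B) y := mul_nonneg (hn _ _) (hn _ _)
  have hsx : 0 ≤ ∑ p ∈ B, svInd p x := Finset.sum_nonneg fun p _ => hi p x
  have hsy : 0 ≤ ∑ p ∈ B, svInd p y := Finset.sum_nonneg fun p _ => hi p y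
  rcases svH_01 A x with h | h
  · rw [h]; simpa using hr
  rcases svH_01 A y with h' | h'
  · rw [h']; simpa using hr
  rw [h, h', one_mul, one_mul]
  have hbig : ∀ z : L, svH A z = 1 → (∀ p ∈ B, svInd p z = 0) → svH (A ∪ B) z = 1 := by
    intro z hz hB
    have := svH_mem A z (by rw [hz]; norm_num)
    refine svH_eq_one _ _ this.1 ?_
    intro p hp
    rcases Finset.mem_union.1 hp with h | h
    · rw [svInd, if_neg (this.2 p h)]
    · exact hB p h
  by_cases hx : ∃ p ∈ B, svInd p x = 1
  · obtain ⟨p, hp, h1⟩ := hx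
    have := Finset.single_le_sum (f := fun p => svInd p x) (fun p _ => hi p x) hp
    simp only [h1] at this
    linarith
  by_cases hy : ∃ p ∈ B, svInd p y = 1
  · obtain ⟨p, hp, h1⟩ := hy
    have := Finset.single_le_sum (f := fun p => svInd p y) (fun p _ => hi p y) hp
    simp only [h1] at this
    linarith
  rw [hbig x h (fun p hp => (svInd_01 p x).resolve_right fun h => hx ⟨p, hp, h⟩),
    hbig y h' (fun p hp => (svInd_01 p y).resolve_right fun h => hy ⟨p, hp, h⟩)]
  linarith

open Classical in
lemma sv_main {L : Type} [Field L] [Fintype L] (φ : L → L) (T : ℝ)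
    (hT : ∀ χ1 χ2 : MulChar L ℂ, ¬ (χ1 = 1 ∧ χ2 = 1) → ‖∑ x, χ1 x * χ2 (φ x)‖ ≤ T) (hT0 : 0 ≤ T)
    (Z : ℕ) (hZ : (Finset.univ.filter (fun x : L => x = 0 ∨ φ x = 0)).card ≤ Z)
    (A B : Finset ℕ) (hAB : Disjoint A B) (hU : A ∪ B = (Fintype.card L - 1).primeFactors)
    (θ W δ : ℝ) (hθ : θ = ∏ p ∈ A, (1 - 1 / (p:ℝ))) (hW : W = 2 ^ A.card)
    (hδ : δ = 1 - 2 * ∑ p ∈ B, 1 / (p:ℝ)) (hδ0 : 0 ≤ δ) :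
    θ ^ 2 * (δ * ((Fintype.card L : ℝ) - Z + T) - T * W ^ 2 * (2 * B.card - 1 + 2 * δ)) ≤
    ((Finset.univ.filter (fun x : L => (x ≠ 0 ∧ ∀ p ∈ (Fintype.card L - 1).primeFactors, x ^ ((Fintype.card L - 1) / p) ≠ 1)
      ∧ (φ x ≠ 0 ∧ ∀ p ∈ (Fintype.card L - 1).primeFactors, (φ x) ^ ((Fintype.card L - 1) / p) ≠ 1))).card : ℝ) := by
  have : Fintype (MulChar L ℂ) := Fintype.ofFinite _
  have hA : A ⊆ (Fintype.card L - 1).primeFactors := hU ▸ Finset.subset_union_left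
  have hB : B ⊆ (Fintype.card L - 1).primeFactors := hU ▸ Finset.subset_union_right
  have hrep := svH_rep (L := L) A hA
  have hC : ∏ p ∈ A, (2 * (1 - 1 / (p:ℝ))) = W * θ := by
    rw [Finset.prod_mul_distrib, Finset.prod_const, hθ, hW]
  rw [hC, ← hθ] at hrep
  have hfac : ∀ p ∈ A, (0:ℝ) ≤ 1 - 1 / p := by
    intro p hp
    have hp := Nat.prime_of_mem_primeFactors (hA hp)
    have : (1:ℝ) / p ≤ 1 := by
      rw [div_le_one (by exact_mod_cast hp.pos)]; exact_mod_cast hp.one_le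
    linarith
  have hθ0 : 0 ≤ θ := by rw [hθ]; exact Finset.prod_nonneg hfac
  set Q : ℝ := (Fintype.card L : ℝ) with hQ
  -- main count
  obtain ⟨N0, hN0, hN0Z⟩ : ∃ N0 : ℝ, ∑ x, (1 : MulChar L ℂ) x * (1 : MulChar L ℂ) (φ x) = N0 ∧ Q - Z ≤ N0 := by
    refine ⟨((Finset.univ.filter (fun x : L => ¬ (x = 0 ∨ φ x = 0))).card : ℝ), ?_, ?_⟩
    · rw [Finset.card_filter]
      push_cast
      refine Finset.sum_congr rfl fun x _ => ?_
      by_cases h1 : x = 0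
      · subst h1; simp only [MulChar.map_zero]; simp
      by_cases h2 : φ x = 0
      · simp only [h2, MulChar.map_zero]; simp
      rw [MulChar.one_apply (by simpa using h1), MulChar.one_apply (by simpa using h2)]
      simp [h1, h2]
    · have h1 := Finset.card_filter_add_card_filter_not (s := (Finset.univ : Finset L)) (fun x : L => x = 0 ∨ φ x = 0)
      rw [Finset.card_univ] at h1
      have h2 : (Fintype.card L) ≤ Z + (Finset.univ.filter (fun x : L => ¬ (x = 0 ∨ φ x = 0))).card := by omega
      have h3 : ((Fintype.card L : ℕ) : ℝ) ≤ ((Z + (Finset.univ.filter (fun x : L => ¬ (x = 0 ∨ φ x = 0))).card : ℕ) : ℝ) := by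
        exact_mod_cast h2
      push_cast at h3
      linarith
  set N : ℝ := ∑ x, svH A x * svH A (φ x) with hN
  have hNlow : θ ^ 2 * (Q - Z) - (W ^ 2 * θ ^ 2 - θ ^ 2) * T ≤ N := by
    have := sv_bil φ T hT _ _ _ _ _ _ _ _ hrep hrep N0 hN0 hT0
    rw [abs_of_nonneg (mul_nonneg hθ0 hθ0)] at this
    have h2 := (abs_le.1 this).1
    have h3 : θ ^ 2 * (Q - Z) ≤ θ ^ 2 * N0 := by gcongr
    nlinarith
  have hndvd : ∀ p ∈ B, ¬ p ∣ ∏ r ∈ A, r := by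
    intro p hp
    have hpr := Nat.prime_of_mem_primeFactors (hB hp)
    rw [Prime.dvd_finsetProd_iff hpr.prime]
    rintro ⟨r, hr, hd⟩
    have := (Nat.prime_dvd_prime_iff_eq hpr (Nat.prime_of_mem_primeFactors (hA hr))).1 hd
    exact Finset.disjoint_left.1 hAB hr (this ▸ hp)
  have hM1 : ∀ p ∈ B, ∑ x, (svH A x * svInd p x) * svH A (φ x) ≤ N / p + (1 - 1 / p) * (W ^ 2 * θ ^ 2 * T) := by
    intro p hp
    have hs := sv_step _ _ _ _ hrep p (Nat.prime_of_mem_primeFactors (hB hp)) (Nat.dvd_of_mem_primeFactors (hB hp)) (hndvd p hp)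
    have := sv_bil φ T hT _ _ _ _ _ _ _ _ hs hrep N0 hN0 hT0
    simp only [zero_mul, sub_zero, abs_zero] at this
    have h2 := (abs_le.1 this).2
    have h3 : ∑ x, svH A x * (svInd p x - 1 / p) * svH A (φ x) = ∑ x, (svH A x * svInd p x) * svH A (φ x) - N / p := by
      rw [hN, Finset.sum_div, ← Finset.sum_sub_distrib]
      exact Finset.sum_congr rfl fun x _ => by ring
    rw [h3] at h2
    linarith
  have hM2 : ∀ p ∈ B, ∑ x, svH A x * (svH A (φ x) * svInd p (φ x)) ≤ N / p + (1 - 1 / p) * (W ^ 2 * θ ^ 2 * T) := by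
    intro p hp
    have hs := sv_step _ _ _ _ hrep p (Nat.prime_of_mem_primeFactors (hB hp)) (Nat.dvd_of_mem_primeFactors (hB hp)) (hndvd p hp)
    have := sv_bil φ T hT _ _ _ _ _ _ _ _ hrep hs N0 hN0 hT0
    simp only [mul_zero, zero_mul, sub_zero, abs_zero] at this
    have h2 := (abs_le.1 this).2
    have h3 : ∑ x, svH A x * (svH A (φ x) * (svInd p (φ x) - 1 / p)) =
        ∑ x, svH A x * (svH A (φ x) * svInd p (φ x)) - N / p := by
      rw [hN, Finset.sum_div, ← Finset.sum_sub_distrib]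
      exact Finset.sum_congr rfl fun x _ => by ring
    rw [h3] at h2
    linarith
  have hfinal : ∑ x, svH (A ∪ B) x * svH (A ∪ B) (φ x) ≤
      ((Finset.univ.filter (fun x : L => (x ≠ 0 ∧ ∀ p ∈ (Fintype.card L - 1).primeFactors, x ^ ((Fintype.card L - 1) / p) ≠ 1)
      ∧ (φ x ≠ 0 ∧ ∀ p ∈ (Fintype.card L - 1).primeFactors, (φ x) ^ ((Fintype.card L - 1) / p) ≠ 1))).card : ℝ) := by
    rw [Finset.card_filter, hU]
    push_cast
    refine Finset.sum_le_sum fun x _ => ?_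
    rcases svH_01 (Fintype.card L - 1).primeFactors x with h | h
    · rw [h, zero_mul]; split_ifs <;> norm_num
    rcases svH_01 (Fintype.card L - 1).primeFactors (φ x) with h' | h'
    · rw [h', mul_zero]; split_ifs <;> norm_num
    rw [if_pos ⟨svH_mem _ _ (by rw [h]; norm_num), svH_mem _ _ (by rw [h']; norm_num)⟩, h, h', one_mul]
  refine le_trans ?_ hfinal
  refine le_trans ?_ (Finset.sum_le_sum fun x _ => svH_le A B x (φ x))
  have hsplit : ∑ x, svH A x * svH A (φ x) * (1 - ∑ p ∈ B, svInd p x - ∑ p ∈ B, svInd p (φ x)) =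
      N - ∑ p ∈ B, ∑ x, (svH A x * svInd p x) * svH A (φ x) - ∑ p ∈ B, ∑ x, svH A x * (svH A (φ x) * svInd p (φ x)) := by
    rw [Finset.sum_comm (s := B), Finset.sum_comm (s := B), hN, ← Finset.sum_sub_distrib, ← Finset.sum_sub_distrib]
    refine Finset.sum_congr rfl fun x _ => ?_
    rw [← Finset.mul_sum, ← Finset.mul_sum, ← Finset.sum_mul, ← Finset.mul_sum]
    ring
  rw [hsplit]
  have hs1 := Finset.sum_le_sum hM1
  have hs2 := Finset.sum_le_sum hM2
  have hsv : ∑ p ∈ B, (N / p + (1 - 1 / p) * (W ^ 2 * θ ^ 2 * T)) =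
      (1 - δ) / 2 * N + (B.card - (1 - δ) / 2) * (W ^ 2 * θ ^ 2 * T) := by
    have e1 : (1 - δ) / 2 = ∑ p ∈ B, 1 / (p:ℝ) := by rw [hδ]; ring
    rw [Finset.sum_add_distrib, ← Finset.sum_mul, Finset.sum_sub_distrib, e1, Finset.sum_mul]
    congr 1
    · exact Finset.sum_congr rfl fun p _ => by ring
    · simp
  rw [hsv] at hs1 hs2
  have h5 : δ * (θ ^ 2 * (Q - Z) - (W ^ 2 * θ ^ 2 - θ ^ 2) * T) ≤ δ * N := by gcongr
  nlinarith

/-! Part P6 -/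

lemma nm_normal {K L : Type} [Field K] [Field L] [Fintype K] [Fintype L] [Algebra K L] (q : ℕ)
    (hK : Fintype.card K = q) (hL : Fintype.card L = q ^ 3) (α : L)
    (hD : α ^ 3 + (α ^ q) ^ 3 + (α ^ q ^ 2) ^ 3 - 3 * α * α ^ q * α ^ q ^ 2 ≠ 0) : IsNormalElem K 3 α := by
  have hq1 : 1 < q := hK ▸ Fintype.one_lt_card
  have hfr : Module.finrank K L = 3 := by
    have := Module.card_eq_pow_finrank (K := K) (V := L)
    rw [hK, hL] at this
    exact (Nat.pow_right_injective hq1 this).symm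
  have hli : LinearIndependent K (fun i : Fin 3 => α ^ Fintype.card K ^ (i : ℕ)) := by
    rw [Fintype.linearIndependent_iff]
    intro c hc
    rw [Fin.sum_univ_three] at hc
    simp only [Fin.val_zero, Fin.val_one, Fin.val_two, pow_zero, pow_one, Algebra.smul_def, hK] at hc
    set f := algebraMap K L with hf
    have hfrob : ∀ x y z : L, x + y + z = 0 → x ^ q + y ^ q + z ^ q = 0 := by
      intro x y z h
      have h2 := congrArg (FiniteField.frobeniusAlgHom K L) h
      simp only [map_add, FiniteField.coe_frobeniusAlgHom, hK, map_zero] at h2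
      exact h2
    have hcq : ∀ a : K, f a ^ q = f a := by
      intro a
      rw [← map_pow, ← hK, FiniteField.pow_card]
    have hγ : (α ^ q ^ 2) ^ q = α := by
      rw [← pow_mul, ← pow_succ, ← hL, FiniteField.pow_card]
    have hβ : (α ^ q) ^ q = α ^ q ^ 2 := by rw [← pow_mul, sq]
    have h2 := hfrob _ _ _ hc
    simp only [mul_pow, hcq, hγ, hβ] at h2
    have h3 := hfrob _ _ _ h2
    simp only [mul_pow, hcq, hγ, hβ] at h3
    set β := α ^ q
    set γ := α ^ q ^ 2
    have e0 : f (c 0) * (α ^ 3 + β ^ 3 + γ ^ 3 - 3 * α * β * γ) = 0 := by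
      linear_combination (α ^ 2 - β * γ) * hc + (β ^ 2 - α * γ) * h2 + (γ ^ 2 - α * β) * h3
    have e1 : f (c 1) * (α ^ 3 + β ^ 3 + γ ^ 3 - 3 * α * β * γ) = 0 := by
      linear_combination (β ^ 2 - α * γ) * hc + (γ ^ 2 - α * β) * h2 + (α ^ 2 - β * γ) * h3
    have e2 : f (c 2) * (α ^ 3 + β ^ 3 + γ ^ 3 - 3 * α * β * γ) = 0 := by
      linear_combination (γ ^ 2 - α * β) * hc + (α ^ 2 - β * γ) * h2 + (β ^ 2 - α * γ) * h3
    have r0 := (mul_eq_zero.1 e0).resolve_right hD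
    have r1 := (mul_eq_zero.1 e1).resolve_right hD
    have r2 := (mul_eq_zero.1 e2).resolve_right hD
    rw [hf, map_eq_zero] at r0 r1 r2
    intro i
    fin_cases i
    · exact r0
    · exact r1
    · exact r2
  refine ⟨hli, ?_⟩
  exact hli.span_eq_top_of_card_eq_finrank (by rw [hfr]; simp)

open Classical in
lemma nm_count1 {K L : Type} [Field K] [Field L] [Fintype K] [Fintype L] [Algebra K L] (q : ℕ)
    (hK : Fintype.card K = q) (hL : Fintype.card L = q ^ 3) :
    (Finset.univ.filter (fun α : L => IsPrimitiveElem α ∧ ¬ IsNormalElem K 3 α)).card ≤ 3 * q ^ 2 := by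
  have hq1 : 1 < q := hK ▸ Fintype.one_lt_card
  let P : L[X] := X ^ 3 + X ^ (3 * q) + X ^ (3 * q ^ 2) - 3 * X ^ (1 + q + q ^ 2)
  have hPc : P.coeff (3 * q ^ 2) = 1 := by
    have h1 : 3 * q ^ 2 ≠ 3 := by nlinarith
    have h2 : 3 * q ^ 2 ≠ 3 * q := by nlinarith
    have h3 : 3 * q ^ 2 ≠ 1 + q + q ^ 2 := by nlinarith
    have h4 : (3 : L[X]) = C 3 := rfl
    simp only [P, h4, coeff_add, coeff_sub, coeff_C_mul, coeff_X_pow, h1, h2, h3, if_false, if_true]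
    simp
  have hP0 : P ≠ 0 := by intro h; rw [h] at hPc; simp at hPc
  have hdeg : P.natDegree ≤ 3 * q ^ 2 := by
    have h4 : (3 : L[X]) = C 3 := rfl
    have h5 : 3 * q ≤ 3 * q ^ 2 := by nlinarith
    have h6 : 1 + q + q ^ 2 ≤ 3 * q ^ 2 := by nlinarith
    have h7 : 3 ≤ 3 * q ^ 2 := by nlinarith
    simp only [P, h4]
    refine (natDegree_sub_le _ _).trans (max_le ((natDegree_add_le _ _).trans (max_le ((natDegree_add_le _ _).trans
      (max_le ?_ ?_)) ?_)) ?_)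
    · simpa using h7
    · simpa using h5
    · simp
    · exact (natDegree_C_mul_X_pow_le _ _).trans h6
  refine le_trans ?_ ((card_roots' P).trans hdeg)
  refine le_trans (Finset.card_le_card ?_) (Multiset.toFinset_card_le _)
  intro α hα
  rw [Multiset.mem_toFinset, mem_roots hP0, IsRoot]
  simp only [Finset.mem_filter, Finset.mem_univ, true_and] at hα
  by_contra h
  apply hα.2
  refine nm_normal q hK hL α ?_
  intro h8
  apply h
  simp only [P, eval_add, eval_sub, eval_mul, eval_pow, eval_X, eval_ofNat]
  rw [← h8]; ring

open Classical in
lemma nm_count2 {K L : Type} [Field K] [Field L] [Fintype K] [Fintype L] [Algebra K L] (q : ℕ)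
    (hK : Fintype.card K = q) (hL : Fintype.card L = q ^ 3) (h3 : q % 3 ≠ 1) :
    (Finset.univ.filter (fun α : L => IsPrimitiveElem α ∧ ¬ IsNormalElem K 3 α)).card ≤ q ^ 2 := by
  have hq1 : 1 < q := hK ▸ Fintype.one_lt_card
  let P : L[X] := X + X ^ q + X ^ q ^ 2
  have h1 : q ^ 2 ≠ 1 := by nlinarith
  have h2 : q ^ 2 ≠ q := by nlinarith
  have hPc : P.coeff (q ^ 2) = 1 := by
    simp only [P, coeff_add, coeff_X_pow, coeff_X, h2, h1.symm, if_false, if_true]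
    simp
  have hP0 : P ≠ 0 := by intro h; rw [h] at hPc; simp at hPc
  have hdeg : P.natDegree ≤ q ^ 2 := by
    refine (natDegree_add_le _ _).trans (max_le ((natDegree_add_le _ _).trans (max_le ?_ ?_)) ?_)
    · simp; nlinarith
    · simp; nlinarith
    · simp
  refine le_trans ?_ ((card_roots' P).trans hdeg)
  refine le_trans (Finset.card_le_card ?_) (Multiset.toFinset_card_le _)
  intro α hα
  rw [Multiset.mem_toFinset, mem_roots hP0, IsRoot]
  simp only [Finset.mem_filter, Finset.mem_univ, true_and] at hα
  obtain ⟨hprim, hnn⟩ := hα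
  simp only [P, eval_add, eval_pow, eval_X]
  have hD : α ^ 3 + (α ^ q) ^ 3 + (α ^ q ^ 2) ^ 3 - 3 * α * α ^ q * α ^ q ^ 2 = 0 := by
    by_contra h; exact hnn (nm_normal q hK hL α h)
  by_contra htr
  have hq3 : q ^ 3 % 3 ≠ 1 := by
    have : q % 3 = 0 ∨ q % 3 = 2 := by omega
    rcases this with h | h <;> simp [Nat.pow_mod, h]
  have hq30 : 1 < q ^ 3 := Nat.one_lt_pow (by norm_num) hq1
  have hcop : Nat.gcd 3 (q ^ 3 - 1) = 1 := by
    rw [← Nat.coprime_iff_gcd_eq_one, Nat.Prime.coprime_iff_not_dvd Nat.prime_three]; omega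
  have hcube : ∀ x y : L, x ^ 3 = y ^ 3 → x = y := by
    intro x y h
    by_cases hy : y = 0
    · subst hy; simpa using h
    have hx : x ≠ 0 := by rintro rfl; apply hy; simpa using h.symm
    have e1 : (x / y) ^ 3 = 1 := by rw [div_pow, h, div_self (pow_ne_zero _ hy)]
    have e2 : (x / y) ^ (q ^ 3 - 1) = 1 := by
      rw [← hL]; exact FiniteField.pow_card_sub_one_eq_one _ (div_ne_zero hx hy)
    have e3 := pow_gcd_eq_one.2 ⟨e1, e2⟩
    rw [hcop, pow_one] at e3
    exact (div_eq_one_iff_eq hy).1 e3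
  set β := α ^ q with hβ
  set γ := α ^ q ^ 2 with hγ
  have hquad : (α - γ) ^ 2 - (α - γ) * (β - γ) + (β - γ) ^ 2 = 0 := by
    have : (α + β + γ) * ((α - γ) ^ 2 - (α - γ) * (β - γ) + (β - γ) ^ 2) = 0 := by
      linear_combination hD
    exact (mul_eq_zero.1 this).resolve_left htr
  have hXY : α - γ = -(β - γ) := by
    apply hcube
    linear_combination ((α - γ) + (β - γ)) * hquad
  have h3X : 3 * (α - γ) ^ 2 = 0 := by
    linear_combination hquad + (2 * (α - γ) - (β - γ)) * hXY
  have hcast : ((q ^ 3 : ℕ) : L) = 0 := by rw [← hL]; exact FiniteField.cast_card_eq_zero L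
  rcases mul_eq_zero.1 h3X with h | h
  · apply htr
    linear_combination hXY + γ * h
  · have hX : α - γ = 0 := pow_eq_zero_iff (two_ne_zero) |>.1 h
    have hβα : β = α := by
      rw [hX] at hXY
      have : β = γ := by linear_combination hXY
      rw [this]; linear_combination -hX
    have hα0 : α ≠ 0 := by
      rintro rfl
      unfold IsPrimitiveElem at hprim
      rw [orderOf_zero] at hprim
      omega
    have hpow : α ^ (q - 1) = 1 := by
      have : α ^ (q - 1) * α = 1 * α := by
        rw [← pow_succ, one_mul, show q - 1 + 1 = q by omega]; exact hβα
      exact mul_right_cancel₀ hα0 this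
    have hdvd := orderOf_dvd_of_pow_eq_one hpow
    rw [hprim, hL] at hdvd
    have := Nat.le_of_dvd (by omega) hdvd
    have : q < q ^ 3 := by
      calc q = q ^ 1 := (pow_one q).symm
        _ < q ^ 3 := Nat.pow_lt_pow_right hq1 (by norm_num)
    omega

/-! Part P8 -/

lemma as_ratEval {L : Type} [Field L] (f1 f2 : L[X]) (h2 : f2 ≠ 0) (α : L) (hα : f2.eval α ≠ 0) :
    ratEval (algebraMap L[X] (RatFunc L) f1 / algebraMap L[X] (RatFunc L) f2) α = f1.eval α / f2.eval α := by
  set x := algebraMap L[X] (RatFunc L) f1 / algebraMap L[X] (RatFunc L) f2 with hx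
  have h3 : x.num * f2 = f1 * x.denom := (RatFunc.num_mul_eq_mul_denom_iff h2).2 hx
  have h4 : x.denom.eval α ≠ 0 := by
    obtain ⟨r, hr⟩ := RatFunc.denom_div_dvd f1 f2
    intro h
    apply hα
    rw [hr, eval_mul, ← hx, h, zero_mul]
  unfold ratEval RatFunc.eval
  rw [eval₂_id, eval₂_id]
  have h5 := congrArg (eval α) h3
  rw [eval_mul, eval_mul] at h5
  rw [div_eq_div_iff h4 hα, h5]

lemma as_weil {L : Type} [Field L] [Fintype L] (f1 f2 : L[X]) (h2 : f2 ≠ 0) (hQ : 3 ≤ Fintype.card L)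
    (hd1 : f1.natDegree ≤ 3) (hd2 : f2.natDegree ≤ 2) (hcop : IsCoprime f1 f2) (k : ℕ) (g : L[X]) (hk : 0 < k)
    (hg : g.Monic) (hi : Irreducible g) (hgX : g ≠ X) (hgcd : Nat.gcd k (Fintype.card L - 1) = 1)
    (hdv : g ^ k ∣ f1 * f2) (hndv : ¬ g ^ (k + 1) ∣ f1 * f2) (χ1 χ2 : MulChar L ℂ) (hχ : χ2 ≠ 1) :
    ‖∑ x : L, χ1 x * χ2 ((f1 * f2 ^ (Fintype.card L - 2)).eval x)‖ ≤ 5 * Real.sqrt (Fintype.card L) := by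
  have h1 : f1 ≠ 0 := by rintro rfl; simp at hndv
  have hgX' : IsCoprime g X := by
    rw [hi.coprime_iff_not_dvd]
    intro h
    exact hgX (eq_of_monic_of_associated hg monic_X ((hi.dvd_irreducible_iff_associated irreducible_X).1 h))
  have h6 : (5:ℝ) = ((6:ℕ):ℝ) - 1 := by norm_num
  have hgp : Prime g := hi.prime
  have hgdvd : g ∣ f1 * f2 := (dvd_pow_self g hk.ne').trans hdv
  set n := Fintype.card L - 2 with hn
  have hn0 : n ≠ 0 := by omega
  rw [h6]
  rcases hgp.dvd_or_dvd hgdvd with hgf | hgf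
  · have hc2 : IsCoprime g f2 := hcop.of_isCoprime_of_dvd_left hgf
    obtain ⟨f1', hf1'⟩ : g ^ k ∣ f1 := (hc2.pow_left).dvd_of_dvd_mul_right hdv
    have hf1'0 : f1' ≠ 0 := by rintro rfl; simp at hf1'; exact h1 hf1'
    have hc1 : IsCoprime g f1' := by
      rw [hi.coprime_iff_not_dvd]
      rintro ⟨w, hw⟩
      apply hndv
      rw [hf1', hw]
      exact ⟨w * f2, by ring⟩
    refine weil_gen χ1 χ2 hχ _ g (f1' * f2 ^ n) (X * f1' * f2) k ?_ hgcd hg hi ?_ ?_ ?_ ?_ 6 ?_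
    · rw [hf1']; ring
    · exact mul_ne_zero (mul_ne_zero X_ne_zero hf1'0) h2
    · exact (hgX'.mul_right hc1).mul_right hc2
    · exact ⟨f1' * f2, by ring⟩
    · intro ρ h
      simp only [map_mul, map_pow, mul_eq_zero, pow_eq_zero_iff hn0] at h ⊢
      tauto
    · have e1 : f1.natDegree = k * g.natDegree + f1'.natDegree := by
        rw [hf1', natDegree_mul (pow_ne_zero _ hi.ne_zero) hf1'0, natDegree_pow]
      have e2 : g.natDegree ≤ k * g.natDegree := Nat.le_mul_of_pos_left _ hk
      rw [natDegree_mul (mul_ne_zero X_ne_zero hf1'0) h2, natDegree_mul X_ne_zero hf1'0, natDegree_X]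
      omega
  · have hc1 : IsCoprime g f1 := hcop.symm.of_isCoprime_of_dvd_left hgf
    obtain ⟨f2', hf2'⟩ : g ^ k ∣ f2 := (hc1.pow_left).dvd_of_dvd_mul_left hdv
    have hf2'0 : f2' ≠ 0 := by rintro rfl; simp at hf2'; exact h2 hf2'
    have hc2 : IsCoprime g f2' := by
      rw [hi.coprime_iff_not_dvd]
      rintro ⟨w, hw⟩
      apply hndv
      rw [hf2', hw]
      exact ⟨f1 * w, by ring⟩
    refine weil_gen χ1 χ2 hχ _ g (f1 * f2' ^ n) (X * f1 * f2') (k * n) ?_ ?_ hg hi ?_ ?_ ?_ ?_ 6 ?_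
    · rw [hf2', mul_pow, ← pow_mul]; ring
    · refine Nat.Coprime.mul_left hgcd ?_
      have : Fintype.card L - 1 = n + 1 := by omega
      rw [this]
      simp
    · exact mul_ne_zero (mul_ne_zero X_ne_zero h1) hf2'0
    · exact (hgX'.mul_right hc1).mul_right hc2
    · exact ⟨f1 * f2', by ring⟩
    · intro ρ h
      simp only [map_mul, map_pow, mul_eq_zero, pow_eq_zero_iff hn0] at h ⊢
      tauto
    · have e1 : f2.natDegree = k * g.natDegree + f2'.natDegree := by
        rw [hf2', natDegree_mul (pow_ne_zero _ hi.ne_zero) hf2'0, natDegree_pow]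
      have e2 : g.natDegree ≤ k * g.natDegree := Nat.le_mul_of_pos_left _ hk
      rw [natDegree_mul (mul_ne_zero X_ne_zero h1) hf2'0, natDegree_mul X_ne_zero h1, natDegree_X]
      omega

lemma as_prim {L : Type} [Field L] [Fintype L] (x : L) (hx : x ≠ 0)
    (h : ∀ p ∈ (Fintype.card L - 1).primeFactors, x ^ ((Fintype.card L - 1) / p) ≠ 1) : IsPrimitiveElem x := by
  have hQ := Fintype.one_lt_card (α := L)
  refine orderOf_eq_of_pow_and_pow_div_prime (by omega) (FiniteField.pow_card_sub_one_eq_one _ hx) ?_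
  intro p hp hd
  exact h p (Nat.mem_primeFactors.2 ⟨hp, hd, by omega⟩)

/-- The numerical sieve criterion. -/
def SvCrit (q : ℕ) : Prop := ∃ A B : Finset ℕ, Disjoint A B ∧ A ∪ B = (q ^ 3 - 1).primeFactors ∧
  0 ≤ 1 - 2 * ∑ p ∈ B, 1 / (p:ℝ) ∧
  ((if q % 3 = 1 then 3 * q ^ 2 else q ^ 2 : ℕ) : ℝ) < (∏ p ∈ A, (1 - 1 / (p:ℝ))) ^ 2 *
    ((1 - 2 * ∑ p ∈ B, 1 / (p:ℝ)) * ((q:ℝ) ^ 3 - 6 + 5 * Real.sqrt ((q:ℝ) ^ 3)) -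
      5 * Real.sqrt ((q:ℝ) ^ 3) * (2 ^ A.card) ^ 2 * (2 * B.card - 1 + 2 * (1 - 2 * ∑ p ∈ B, 1 / (p:ℝ))))

lemma as_main (q : ℕ) (hc : SvCrit q) : memB 3 2 q 3 := by
  classical
  intro K L _ _ _ _ _ hK hL f hf
  obtain ⟨f1, f2, h2, rfl, hd1, hd2, hcop, k, g, hk, hg, hi, hgX, hgcd, hdv, hndv⟩ := hf
  obtain ⟨A, B, hdis, hU, hδ, hlt⟩ := hc
  have hq1 : 1 < q := hK ▸ Fintype.one_lt_card
  have hQ8 : 8 ≤ Fintype.card L := by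
    rw [hL]; calc 8 = 2 ^ 3 := by norm_num
      _ ≤ q ^ 3 := Nat.pow_le_pow_left hq1 3
  have h1 : f1 ≠ 0 := by rintro rfl; simp at hndv
  set n := Fintype.card L - 2 with hn
  have hn0 : n ≠ 0 := by omega
  let φ : L → L := fun x => (f1 * f2 ^ n).eval x
  have hφ0 : ∀ x, φ x = 0 ↔ (f1 * f2).eval x = 0 := by
    intro x
    simp only [φ, eval_mul, eval_pow, mul_eq_zero, pow_eq_zero_iff hn0]
  have hcast : ((Fintype.card L : ℕ) : ℝ) = (q:ℝ) ^ 3 := by rw [hL]; push_cast; rfl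
  have hsq1 : (1:ℝ) ≤ Real.sqrt (Fintype.card L) := by
    rw [Real.one_le_sqrt]; exact_mod_cast (by omega : 1 ≤ Fintype.card L)
  have hdeg : (f1 * f2).natDegree ≤ 5 := by rw [natDegree_mul h1 h2]; omega
  have hf12 : f1 * f2 ≠ 0 := mul_ne_zero h1 h2
  have hT : ∀ χ1 χ2 : MulChar L ℂ, ¬ (χ1 = 1 ∧ χ2 = 1) → ‖∑ x, χ1 x * χ2 (φ x)‖ ≤ 5 * Real.sqrt (Fintype.card L) := by
    intro χ1 χ2 hχ
    by_cases hχ2 : χ2 = 1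
    · have hχ1 : χ1 ≠ 1 := fun h => hχ ⟨h, hχ2⟩
      have e1 : ∑ x, χ1 x * χ2 (φ x) = ∑ x, χ1 x - ∑ x ∈ Finset.univ.filter (fun x => φ x = 0), χ1 x := by
        rw [Finset.sum_filter, ← Finset.sum_sub_distrib]
        refine Finset.sum_congr rfl fun x _ => ?_
        by_cases h : φ x = 0
        · rw [h, MulChar.map_zero, if_pos rfl]; simp
        · rw [hχ2, MulChar.one_apply (by simpa using h), if_neg h]; simp
      rw [e1, MulChar.sum_eq_zero_of_ne_one hχ1, zero_sub, norm_neg]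
      have e2 : (Finset.univ.filter (fun x => φ x = 0)).card ≤ 5 := by
        refine le_trans ?_ ((card_roots' (f1 * f2)).trans hdeg)
        refine le_trans (Finset.card_le_card ?_) (Multiset.toFinset_card_le _)
        intro x hx
        rw [Multiset.mem_toFinset, mem_roots hf12, IsRoot, ← hφ0]
        exact (Finset.mem_filter.1 hx).2
      calc ‖∑ x ∈ Finset.univ.filter (fun x => φ x = 0), χ1 x‖ ≤ ∑ x ∈ Finset.univ.filter (fun x => φ x = 0), ‖χ1 x‖ :=
            norm_sum_le _ _
        _ ≤ ∑ x ∈ Finset.univ.filter (fun x => φ x = 0), (1:ℝ) := Finset.sum_le_sum fun x _ => mc_norm_le χ1 x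
        _ = ((Finset.univ.filter (fun x => φ x = 0)).card : ℝ) := by simp
        _ ≤ 5 := by exact_mod_cast e2
        _ ≤ _ := by linarith
    · exact as_weil f1 f2 h2 (by omega) hd1 hd2 hcop k g hk hg hi hgX hgcd hdv hndv χ1 χ2 hχ2
  have hZ : (Finset.univ.filter (fun x : L => x = 0 ∨ φ x = 0)).card ≤ 6 := by
    have hX0 : (X * (f1 * f2) : L[X]) ≠ 0 := mul_ne_zero X_ne_zero hf12
    have hdX : (X * (f1 * f2) : L[X]).natDegree ≤ 6 := by
      rw [natDegree_mul X_ne_zero hf12, natDegree_X]; omega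
    refine le_trans ?_ ((card_roots' _).trans hdX)
    refine le_trans (Finset.card_le_card ?_) (Multiset.toFinset_card_le _)
    intro x hx
    rw [Multiset.mem_toFinset, mem_roots hX0, IsRoot, eval_mul, eval_X, mul_eq_zero, ← hφ0]
    exact (Finset.mem_filter.1 hx).2
  have hmain := sv_main φ (5 * Real.sqrt (Fintype.card L)) hT (by positivity) 6 hZ A B hdis (by rw [hU, hL]) _ _ _ rfl rfl rfl hδ
  rw [hcast] at hmain
  push_cast at hmain
  have hgt := lt_of_lt_of_le hlt hmain
  rw [Nat.cast_lt] at hgt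
  have hbad : (Finset.univ.filter (fun α : L => IsPrimitiveElem α ∧ ¬ IsNormalElem K 3 α)).card ≤
      (if q % 3 = 1 then 3 * q ^ 2 else q ^ 2) := by
    split_ifs with h
    · convert nm_count1 q hK hL
    · convert nm_count2 q hK hL h
  have hex := Finset.exists_mem_notMem_of_card_lt_card (lt_of_le_of_lt hbad hgt)
  obtain ⟨α, hα, hnb⟩ := hex
  simp only [Finset.mem_filter, Finset.mem_univ, true_and, not_and, not_not] at hα hnb
  have hpα := as_prim α hα.1.1 hα.1.2
  refine ⟨α, hpα, hnb hpα, ?_⟩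
  have hpφ := as_prim (φ α) hα.2.1 hα.2.2
  have hne : eval α f1 ≠ 0 ∧ eval α f2 ≠ 0 := by
    have := hα.2.1
    rw [Ne, hφ0, eval_mul, mul_eq_zero, not_or] at this
    exact this
  have : ratEval (algebraMap L[X] (RatFunc L) f1 / algebraMap L[X] (RatFunc L) f2) α = φ α := by
    rw [as_ratEval f1 f2 h2 α hne.2]
    simp only [φ, eval_mul, eval_pow]
    rw [div_eq_iff hne.2, mul_assoc, ← pow_succ]
    have e : n + 1 = Fintype.card L - 1 := by omega
    rw [e, FiniteField.pow_card_sub_one_eq_one _ hne.2, mul_one]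
  rw [this]
  exact hpφ

/-! Part P7a -/

lemma cr_real (q : ℕ) (A B : Finset ℕ) (hdis : Disjoint A B) (hU : A ∪ B = (q ^ 3 - 1).primeFactors)
    (t w d r s : ℝ) (ht0 : 0 ≤ t) (ht : t ≤ ∏ p ∈ A, (1 - 1 / (p:ℝ))) (hw : ((2:ℝ) ^ A.card) ^ 2 ≤ w) (hd0 : 0 ≤ d)
    (hd : d ≤ 1 - 2 * ∑ p ∈ B, 1 / (p:ℝ)) (hs : (B.card : ℝ) ≤ s) (hr0 : 0 ≤ r) (hr : (q:ℝ) ^ 3 ≤ r ^ 2)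
    (hmon : (1 - 2 * ∑ p ∈ B, 1 / (p:ℝ)) ≤ d ∨ 6 + 10 * r * w ≤ (q:ℝ) ^ 3 + 5 * r)
    (hlt : ((if q % 3 = 1 then 3 * q ^ 2 else q ^ 2 : ℕ) : ℝ) <
      t ^ 2 * (d * ((q:ℝ) ^ 3 - 6 + 5 * r - 10 * r * w) - 5 * r * w * (2 * s - 1))) : SvCrit q := by
  refine ⟨A, B, hdis, hU, hd0.trans hd, lt_of_lt_of_le hlt ?_⟩
  set θ := ∏ p ∈ A, (1 - 1 / (p:ℝ)) with hθ
  set δ := 1 - 2 * ∑ p ∈ B, 1 / (p:ℝ) with hδ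
  set W2 := ((2:ℝ) ^ A.card) ^ 2 with hW2
  set ρ := Real.sqrt ((q:ℝ) ^ 3) with hρ
  set b : ℝ := (B.card : ℝ) with hb
  set Q := (q:ℝ) ^ 3 with hQ
  have hρ0 : 0 ≤ ρ := Real.sqrt_nonneg _
  have hρr : ρ ≤ r := Real.sqrt_le_iff.2 ⟨hr0, hr⟩
  have hW1 : 1 ≤ W2 := one_le_pow₀ (one_le_pow₀ (by norm_num))
  have hw1 : 1 ≤ w := hW1.trans hw
  have hδ0 : 0 ≤ δ := hd0.trans hd
  have hbδ : 0 ≤ 2 * b - 1 + δ := by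
    rcases Finset.eq_empty_or_nonempty B with h | h
    · have e1 : δ = 1 := by rw [hδ, h]; simp
      have e2 : b = 0 := by rw [hb, h]; simp
      rw [e1, e2]; norm_num
    · have : (1:ℝ) ≤ b := by rw [hb]; exact_mod_cast Finset.card_pos.2 h
      linarith
  have s1 : δ * (Q - 6 + 5 * ρ) - 5 * ρ * w * (2 * b - 1 + 2 * δ) ≤
      δ * (Q - 6 + 5 * ρ) - 5 * ρ * W2 * (2 * b - 1 + 2 * δ) := by
    have : 5 * ρ * W2 * (2 * b - 1 + 2 * δ) ≤ 5 * ρ * w * (2 * b - 1 + 2 * δ) := by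
      have : 0 ≤ 2 * b - 1 + 2 * δ := by linarith
      gcongr
    linarith
  have s2 : δ * (Q - 6 + 5 * r) - 5 * r * w * (2 * b - 1 + 2 * δ) ≤
      δ * (Q - 6 + 5 * ρ) - 5 * ρ * w * (2 * b - 1 + 2 * δ) := by
    have h1 : 0 ≤ w * (2 * b - 1 + 2 * δ) - δ := by
      have : 1 * (2 * b - 1 + 2 * δ) ≤ w * (2 * b - 1 + 2 * δ) := by
        have : 0 ≤ 2 * b - 1 + 2 * δ := by linarith
        gcongr
      linarith
    have h2 : ρ * (w * (2 * b - 1 + 2 * δ) - δ) ≤ r * (w * (2 * b - 1 + 2 * δ) - δ) := by gcongr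
    linarith
  have s3 : d * (Q - 6 + 5 * r - 10 * r * w) ≤ δ * (Q - 6 + 5 * r - 10 * r * w) := by
    rcases hmon with h | h
    · have : δ = d := le_antisymm h hd
      rw [this]
    · have : 0 ≤ Q - 6 + 5 * r - 10 * r * w := by linarith
      gcongr
  have s4 : 5 * r * w * (2 * b - 1) ≤ 5 * r * w * (2 * s - 1) := by
    have : 0 ≤ 5 * r * w := by positivity
    gcongr
  have s5 : d * (Q - 6 + 5 * r - 10 * r * w) - 5 * r * w * (2 * s - 1) ≤
      δ * (Q - 6 + 5 * ρ) - 5 * ρ * W2 * (2 * b - 1 + 2 * δ) := by linarith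
  have hpos : 0 < d * (Q - 6 + 5 * r - 10 * r * w) - 5 * r * w * (2 * s - 1) := by
    by_contra h
    push Not at h
    have h1 := mul_nonpos_of_nonneg_of_nonpos (sq_nonneg t) h
    have h2 : (0:ℝ) ≤ ((if q % 3 = 1 then 3 * q ^ 2 else q ^ 2 : ℕ) : ℝ) := Nat.cast_nonneg _
    linarith
  exact mul_le_mul (pow_le_pow_left₀ ht0 ht 2) s5 hpos.le (sq_nonneg θ)

lemma cr_nn (q : ℕ) : ((if q % 3 = 1 then 3 * q ^ 2 else q ^ 2 : ℕ) : ℝ) ≤ 3 * (q:ℝ) ^ 2 := by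
  split_ifs
  · push_cast; rfl
  · push_cast; nlinarith [sq_nonneg (q:ℝ)]

lemma cr_exch (T B : Finset ℕ) (m : ℕ) (hm : 1 < m) (hT : ∀ t ∈ T, 0 < t ∧ t < m) (hB : ∀ b ∈ B, b ∈ T ∨ m ≤ b)
    (hprod : ∏ b ∈ B, b < (∏ t ∈ T, t) * m ^ 2) :
    B.card ≤ T.card + 1 ∧ ∑ b ∈ B, 1 / (b:ℝ) ≤ ∑ t ∈ T, 1 / (t:ℝ) + 1 / m := by
  classical
  set B1 := B.filter (· ∈ T) with hB1
  set B2 := B.filter (¬ · ∈ T) with hB2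
  have hsub : B1 ⊆ T := fun x hx => (Finset.mem_filter.1 hx).2
  have hB2m : ∀ b ∈ B2, m ≤ b := fun b hb =>
    (hB b (Finset.mem_filter.1 hb).1).resolve_left (Finset.mem_filter.1 hb).2
  have hp1 : ∏ b ∈ B, b = (∏ b ∈ B1, b) * ∏ b ∈ B2, b := (Finset.prod_filter_mul_prod_filter_not B _ _).symm
  have hp2 : ∏ t ∈ T, t = (∏ b ∈ B1, b) * ∏ b ∈ T \ B1, b := by
    rw [mul_comm, Finset.prod_sdiff hsub]
  have hpos : 0 < ∏ b ∈ B1, b := Finset.prod_pos fun b hb => (hT b (hsub hb)).1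
  have h1 : m ^ B2.card ≤ ∏ b ∈ B2, b := by
    rw [← Finset.prod_const]; exact Finset.prod_le_prod' fun b hb => hB2m b hb
  have h2 : ∏ b ∈ T \ B1, b ≤ m ^ (T \ B1).card := by
    rw [← Finset.prod_const]; exact Finset.prod_le_prod' fun b hb => (hT b (Finset.sdiff_subset hb)).2.le
  have h3 : m ^ B2.card < m ^ ((T \ B1).card + 2) := by
    rw [hp1, hp2, mul_assoc] at hprod
    have := Nat.lt_of_mul_lt_mul_left hprod
    calc m ^ B2.card ≤ _ := h1
      _ < _ := this
      _ ≤ _ := by rw [pow_add]; gcongr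
  have h4 : B2.card < (T \ B1).card + 2 := (Nat.pow_lt_pow_iff_right hm).1 h3
  have hc1 : B.card = B1.card + B2.card := (Finset.card_filter_add_card_filter_not _).symm
  have hc2 : T.card = B1.card + (T \ B1).card := by
    rw [add_comm]; exact (Finset.card_sdiff_add_card_eq_card hsub).symm
  refine ⟨by omega, ?_⟩
  have hm0 : (0:ℝ) < m := by exact_mod_cast (by omega : 0 < m)
  have e1 : ∑ b ∈ B, 1 / (b:ℝ) = ∑ b ∈ B1, 1 / (b:ℝ) + ∑ b ∈ B2, 1 / (b:ℝ) :=
    (Finset.sum_filter_add_sum_filter_not B _ _).symm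
  have e2 : ∑ t ∈ T, 1 / (t:ℝ) = ∑ b ∈ B1, 1 / (b:ℝ) + ∑ b ∈ T \ B1, 1 / (b:ℝ) := by
    rw [add_comm, Finset.sum_sdiff hsub]
  have e3 : ∑ b ∈ B2, 1 / (b:ℝ) ≤ B2.card * (1 / (m:ℝ)) := by
    rw [← nsmul_eq_mul]
    refine Finset.sum_le_card_nsmul _ _ _ fun b hb => ?_
    exact one_div_le_one_div_of_le hm0 (by exact_mod_cast hB2m b hb)
  have e4 : (T \ B1).card * (1 / (m:ℝ)) ≤ ∑ b ∈ T \ B1, 1 / (b:ℝ) := by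
    rw [← nsmul_eq_mul]
    refine Finset.card_nsmul_le_sum _ _ _ fun b hb => ?_
    have := hT b (Finset.sdiff_subset hb)
    exact one_div_le_one_div_of_le (by exact_mod_cast this.1) (by exact_mod_cast this.2.le)
  have e5 : (B2.card : ℝ) * (1 / (m:ℝ)) ≤ ((T \ B1).card + 1 : ℝ) * (1 / (m:ℝ)) := by
    gcongr
    exact_mod_cast (by omega : B2.card ≤ (T \ B1).card + 1)
  linarith

lemma cr_theta (A : Finset ℕ) (hA : ∀ p ∈ A, 2 ≤ p) : 1 / ((A.card : ℝ) + 1) ≤ ∏ p ∈ A, (1 - 1 / (p:ℝ)) := by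
  classical
  induction A using Finset.induction_on_max with
  | empty => simp
  | insert p A hlt ih =>
    have hpA : p ∉ A := fun h => lt_irrefl _ (hlt p h)
    have hp2 := hA p (Finset.mem_insert_self _ _)
    rw [Finset.prod_insert hpA, Finset.card_insert_of_notMem hpA]
    have ih' := ih fun r hr => hA r (Finset.mem_insert_of_mem hr)
    have hcard : A.card + 2 ≤ p := by
      have : A ⊆ Finset.Ico 2 p := fun x hx => Finset.mem_Ico.2 ⟨hA x (Finset.mem_insert_of_mem hx), hlt x hx⟩
      have := Finset.card_le_card this
      rw [Nat.card_Ico] at this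
      omega
    have hc : ((A.card : ℝ) + 2) ≤ p := by exact_mod_cast hcard
    have hA0 : (0:ℝ) ≤ A.card := Nat.cast_nonneg _
    have h1 : 1 - 1 / ((A.card : ℝ) + 2) ≤ 1 - 1 / (p:ℝ) := by
      have := one_div_le_one_div_of_le (by linarith : (0:ℝ) < A.card + 2) hc
      linarith
    have h2 : 0 ≤ 1 - 1 / ((A.card : ℝ) + 2) := by
      have : 1 / ((A.card : ℝ) + 2) ≤ 1 := by rw [div_le_one (by linarith)]; linarith
      linarith
    calc 1 / (((A.card + 1 : ℕ) : ℝ) + 1) = (1 - 1 / ((A.card : ℝ) + 2)) * (1 / ((A.card : ℝ) + 1)) := by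
          push_cast; field_simp; ring
      _ ≤ _ := mul_le_mul h1 ih' (by positivity) (h2.trans h1)

lemma cr_sqpow (n : ℕ) : 4 * (n + 1) ^ 2 ≤ 9 * 2 ^ n := by
  induction n with
  | zero => norm_num
  | succ k ih =>
    rcases lt_or_ge k 2 with h | h
    · interval_cases k <;> norm_num
    · have e : 2 ^ (k + 1) = 2 * 2 ^ k := by ring
      rw [e]
      nlinarith

lemma cr_sub_prod (T S : Finset ℕ) (f : ℕ → ℝ) (hS : S ⊆ T) (h0 : ∀ x ∈ T, 1 ≤ f x) :
    ∏ x ∈ S, f x ≤ ∏ x ∈ T, f x := by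
  classical
  rw [← Finset.prod_sdiff hS]
  have h1 : 1 ≤ ∏ x ∈ T \ S, f x := by
    have := Finset.prod_le_prod (s := T \ S) (f := fun _ => (1:ℝ)) (g := f) (fun _ _ => zero_le_one)
      (fun x hx => h0 x (Finset.sdiff_subset hx))
    simpa using this
  have h2 : 0 ≤ ∏ x ∈ S, f x := Finset.prod_nonneg fun x hx => zero_le_one.trans (h0 x (hS hx))
  nlinarith

lemma cr_W (n : ℕ) (hn : n ≠ 0) : ((2:ℝ) ^ n.primeFactors.card) ^ 6 * (∏ p ∈ (Finset.range 64).filter Nat.Prime, (p:ℝ)) ≤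
    64 ^ 18 * n := by
  classical
  set T := (Finset.range 64).filter Nat.Prime with hT
  have hTc : T.card = 18 := by rw [hT]; decide +kernel
  have hTp : ∀ p ∈ T, 0 < p ∧ p < 64 := fun p hp => by
    rw [hT, Finset.mem_filter, Finset.mem_range] at hp
    exact ⟨hp.2.pos, hp.1⟩
  set P := n.primeFactors with hP
  have hprod : ∏ p ∈ P, (p:ℝ) ≤ n := by
    have := Nat.le_of_dvd (Nat.pos_of_ne_zero hn) (Nat.prod_primeFactors_dvd n)
    rw [← Nat.cast_prod]; exact_mod_cast this
  have hPpos : ∀ p ∈ P, (0:ℝ) < p := fun p hp => by exact_mod_cast (Nat.prime_of_mem_primeFactors hp).pos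
  have h1 : ((2:ℝ) ^ P.card) ^ 6 = (∏ p ∈ P, ((64:ℝ) / p)) * ∏ p ∈ P, (p:ℝ) := by
    rw [← Finset.prod_mul_distrib, Finset.prod_congr rfl (g := fun _ => (64:ℝ)) (fun p hp => by
      have := hPpos p hp; field_simp), Finset.prod_const, ← pow_mul, mul_comm, pow_mul]
    norm_num
  have h2 : ∏ p ∈ P, ((64:ℝ) / p) ≤ ∏ p ∈ T, ((64:ℝ) / p) := by
    have e1 : ∏ p ∈ P, ((64:ℝ) / p) ≤ ∏ p ∈ P.filter (· ∈ T), ((64:ℝ) / p) := by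
      rw [Finset.prod_filter]
      refine Finset.prod_le_prod (fun p hp => by have := hPpos p hp; positivity) fun p hp => ?_
      split_ifs with h
      · exact le_rfl
      · rw [div_le_one (hPpos p hp)]
        by_contra h3
        push Not at h3
        apply h
        rw [hT, Finset.mem_filter, Finset.mem_range]
        exact ⟨by exact_mod_cast h3, Nat.prime_of_mem_primeFactors hp⟩
    refine e1.trans (cr_sub_prod _ _ _ (fun x hx => (Finset.mem_filter.1 hx).2) ?_)
    intro p hp
    have := hTp p hp
    rw [one_le_div (by exact_mod_cast this.1)]
    exact_mod_cast this.2.le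
  have hTpos : 0 < ∏ p ∈ T, (p:ℝ) := Finset.prod_pos fun p hp => by exact_mod_cast (hTp p hp).1
  have h3 : (∏ p ∈ T, ((64:ℝ) / p)) * ∏ p ∈ T, (p:ℝ) = 64 ^ 18 := by
    rw [← Finset.prod_mul_distrib, Finset.prod_congr rfl (g := fun _ => (64:ℝ)) (fun p hp => by
      have : (0:ℝ) < p := by exact_mod_cast (hTp p hp).1
      field_simp), Finset.prod_const, hTc]
  have h4 : 0 ≤ ∏ p ∈ P, (p:ℝ) := Finset.prod_nonneg fun p hp => (hPpos p hp).le
  calc ((2:ℝ) ^ P.card) ^ 6 * ∏ p ∈ T, (p:ℝ) = (∏ p ∈ P, ((64:ℝ) / p)) * (∏ p ∈ P, (p:ℝ)) * ∏ p ∈ T, (p:ℝ) := by rw [h1]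
    _ ≤ (∏ p ∈ T, ((64:ℝ) / p)) * (n:ℝ) * ∏ p ∈ T, (p:ℝ) := by gcongr
    _ = 64 ^ 18 * n := by rw [← h3]; ring

lemma cr_large (q : ℕ) (hq : 60000000 ≤ q) : SvCrit q := by
  classical
  set n := q ^ 3 - 1 with hn
  have hq3 : 1 < q ^ 3 := Nat.one_lt_pow (by norm_num) (by omega)
  have hn0 : n ≠ 0 := by omega
  set ω := n.primeFactors.card with hω
  set W : ℝ := 2 ^ ω with hW
  set x := Real.sqrt q with hx
  have hx2 : x ^ 2 = q := Real.sq_sqrt (Nat.cast_nonneg q)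
  have hqr : (60000000:ℝ) ≤ q := by exact_mod_cast hq
  have hx0 : (7745:ℝ) ≤ x := by
    rw [hx]; apply Real.le_sqrt_of_sq_le; linarith
  have hW1 : 1 ≤ W := one_le_pow₀ (by norm_num)
  have hW2 : W ^ 2 ≤ 1405 * x ^ 2 := by
    have h1 := cr_W n hn0
    have h2 : ∏ p ∈ (Finset.range 64).filter Nat.Prime, (p:ℝ) = 117288381359406970983270 := by
      have : ∏ p ∈ (Finset.range 64).filter Nat.Prime, p = 117288381359406970983270 := by decide +kernel
      rw [← Nat.cast_prod, this]; norm_num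
    rw [h2] at h1
    have h3 : (n:ℝ) ≤ (q:ℝ) ^ 3 := by exact_mod_cast Nat.sub_le _ _
    have h4 : (W ^ 2) ^ 3 ≤ (1405 * x ^ 2) ^ 3 := by
      rw [hx2, mul_pow, ← pow_mul]
      change W ^ 6 ≤ _
      have h5 : W ^ 6 * 117288381359406970983270 ≤ 64 ^ 18 * (q:ℝ) ^ 3 := h1.trans (by gcongr)
      have h6 : (64:ℝ) ^ 18 ≤ 1405 ^ 3 * 117288381359406970983270 := by norm_num
      have h7 : (64:ℝ) ^ 18 * (q:ℝ) ^ 3 ≤ 1405 ^ 3 * 117288381359406970983270 * (q:ℝ) ^ 3 := by gcongr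
      nlinarith
    exact le_of_pow_le_pow_left₀ (by norm_num) (by positivity) h4
  have hWx : W ≤ 37.5 * x := by
    have : W ^ 2 ≤ (37.5 * x) ^ 2 := hW2.trans (by nlinarith)
    exact le_of_pow_le_pow_left₀ (by norm_num) (by positivity) this
  have hθ := cr_theta n.primeFactors (fun p hp => (Nat.prime_of_mem_primeFactors hp).two_le)
  rw [← hω] at hθ
  have hθ2 : 1 / (84.375 * x) ≤ (1 / ((ω:ℝ) + 1)) ^ 2 := by
    rw [div_pow, one_pow]
    apply one_div_le_one_div_of_le (by positivity)
    have := cr_sqpow ω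
    have h2 : (4 * ((ω:ℝ) + 1) ^ 2) ≤ 9 * W := by rw [hW]; exact_mod_cast this
    linarith
  refine cr_real q n.primeFactors ∅ (Finset.disjoint_empty_right _) (by simp [hn]) (1 / ((ω:ℝ) + 1)) (1405 * x ^ 2) 1 (x ^ 3) 0
    (by positivity) hθ hW2 (by norm_num) (by simp) (by simp) (by positivity) (le_of_eq (by rw [← hx2]; ring)) (Or.inl (by simp)) ?_
  refine lt_of_le_of_lt (cr_nn q) ?_
  rw [← hx2]
  have hE : 700 * x ^ 5 ≤ 1 * ((x ^ 2) ^ 3 - 6 + 5 * x ^ 3 - 10 * x ^ 3 * (1405 * x ^ 2)) - 5 * x ^ 3 * (1405 * x ^ 2) * (2 * 0 - 1) := by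
    have h1 : 0 ≤ x ^ 5 * (x - 7745) := mul_nonneg (by positivity) (by linarith)
    have h2 : (7745:ℝ) ^ 3 ≤ x ^ 3 := pow_le_pow_left₀ (by norm_num) hx0 3
    have h3 : 0 ≤ x ^ 5 := by positivity
    nlinarith
  calc 3 * (x ^ 2) ^ 2 < 1 / (84.375 * x) * (700 * x ^ 5) := by
        have : 1 / (84.375 * x) * (700 * x ^ 5) = 700 / 84.375 * x ^ 4 := by field_simp
        rw [this]
        have : 0 < x ^ 4 := by positivity
        nlinarith
    _ ≤ _ := mul_le_mul hθ2 hE (by positivity) (by positivity)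

/-! Part P7b -/

lemma cr_mid (q : ℕ) (h1 : 20000 ≤ q) (h2 : q < 60000000) : SvCrit q := by
  classical
  set n := q ^ 3 - 1 with hn
  have hq3 : 1 < q ^ 3 := Nat.one_lt_pow (by norm_num) (by omega)
  have hn0 : n ≠ 0 := by omega
  set A := n.primeFactors.filter (· < 13) with hA
  set B := n.primeFactors.filter (¬ · < 13) with hB
  set S : Finset ℕ := {2, 3, 5, 7, 11} with hS
  set T : Finset ℕ := {13, 17, 19, 23, 29, 31, 37, 41, 43, 47, 53, 59, 61} with hT
  have hAS : A ⊆ S := by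
    intro p hp
    rw [hA, Finset.mem_filter] at hp
    have h3 := Nat.prime_of_mem_primeFactors hp.1
    have h4 := hp.2
    revert h3
    interval_cases p <;> first | (intro _; decide) | (intro h; exact absurd h (by norm_num))
  have hAc : A.card ≤ 5 := (Finset.card_le_card hAS).trans (by decide)
  have hBT : ∀ b ∈ B, b ∈ T ∨ 67 ≤ b := by
    intro p hp
    rw [hB, Finset.mem_filter] at hp
    have h3 := Nat.prime_of_mem_primeFactors hp.1
    by_cases h5 : p < 67
    · left
      have h4 : 13 ≤ p := by omega
      revert h3
      interval_cases p <;> first | (intro _; decide) | (intro h; exact absurd h (by norm_num))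
    · right; omega
  have hBp : ∏ b ∈ B, b < (∏ t ∈ T, t) * 67 ^ 2 := by
    have e1 : ∏ b ∈ B, b ∣ n := (Finset.prod_dvd_prod_of_subset _ _ _ (Finset.filter_subset _ _)).trans
      (Nat.prod_primeFactors_dvd n)
    have e2 := Nat.le_of_dvd (by omega) e1
    have e3 : q ^ 3 ≤ 60000000 ^ 3 := Nat.pow_le_pow_left h2.le 3
    have e4 : 60000000 ^ 3 < (∏ t ∈ T, t) * 67 ^ 2 := by rw [hT]; decide +kernel
    omega
  obtain ⟨hc, hsum⟩ := cr_exch T B 67 (by norm_num) (by rw [hT]; decide) hBT hBp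
  have hTc : T.card = 13 := by rw [hT]; decide
  have hsT : ∑ t ∈ T, 1 / (t:ℝ) + 1 / (67 : ℕ) ≤ 0.4625 := by
    rw [hT]
    repeat rw [Finset.sum_insert (by decide)]
    rw [Finset.sum_singleton]
    norm_num
  have hθ : (16 / 77 : ℝ) ≤ ∏ p ∈ A, (1 - 1 / (p:ℝ)) := by
    have e0 : ∀ p ∈ S, 2 ≤ p := by rw [hS]; decide
    have e1 : ∏ p ∈ S, (1 - 1 / (p:ℝ)) = 16 / 77 := by
      rw [hS]
      repeat rw [Finset.prod_insert (by decide)]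
      rw [Finset.prod_singleton]
      norm_num
    rw [← e1]
    have e2 : ∀ p ∈ S, 0 ≤ 1 - 1 / (p:ℝ) := by
      intro p hp
      have : (2:ℝ) ≤ p := by exact_mod_cast e0 p hp
      have : 1 / (p:ℝ) ≤ 1 := by rw [div_le_one (by linarith)]; linarith
      linarith
    rw [← Finset.prod_sdiff hAS]
    refine mul_le_of_le_one_left (Finset.prod_nonneg fun p hp => e2 p (hAS hp)) ?_
    refine Finset.prod_le_one (fun p hp => e2 p (Finset.sdiff_subset hp)) fun p _ => ?_
    have : 0 ≤ 1 / (p:ℝ) := by positivity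
    linarith
  set x := Real.sqrt q with hx
  have hx2 : x ^ 2 = q := Real.sq_sqrt (Nat.cast_nonneg q)
  have hqr : (20000:ℝ) ≤ q := by exact_mod_cast h1
  have hx0 : (141:ℝ) ≤ x := by
    rw [hx]; apply Real.le_sqrt_of_sq_le; linarith
  have hx3 : (141:ℝ) ^ 3 ≤ x ^ 3 := pow_le_pow_left₀ (by norm_num) hx0 3
  have hQ : (q:ℝ) ^ 3 = x ^ 3 * x ^ 3 := by rw [← hx2]; ring
  refine cr_real q A B (Finset.disjoint_filter_filter_not _ _ _) (Finset.filter_union_filter_not_eq _ _)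
    (16 / 77) 1024 0.075 (x ^ 3) 14 (by norm_num) hθ ?_ (by norm_num) (by linarith)
    (by exact_mod_cast (by omega : B.card ≤ 14)) (by positivity) (by rw [hQ]; nlinarith) (Or.inr ?_) ?_
  · have : (2:ℝ) ^ A.card ≤ 2 ^ 5 := pow_le_pow_right₀ (by norm_num) hAc
    calc ((2:ℝ) ^ A.card) ^ 2 ≤ (2 ^ 5) ^ 2 := by gcongr
      _ = 1024 := by norm_num
  · rw [hQ]; nlinarith
  · refine lt_of_le_of_lt (cr_nn q) ?_
    rw [hQ, ← hx2]
    have hcube : (141:ℝ) ^ 2 * x ≤ x ^ 3 := by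
      have : (141:ℝ) ^ 2 ≤ x ^ 2 := pow_le_pow_left₀ (by norm_num) hx0 2
      nlinarith
    have e : 3 * (x ^ 2) ^ 2 = x ^ 3 * (3 * x) := by ring
    rw [e]
    set y := x ^ 3 with hy
    have hy0 : 0 < y := by positivity
    have hf : 3 * x + 1 < (16 / 77) ^ 2 * (0.075 * (y + 5 - 10 * 1024) - 5 * 1024 * (2 * 14 - 1)) := by
      norm_num at hx3 hcube ⊢
      linarith
    have h6 := mul_lt_mul_of_pos_left hf hy0
    norm_num at hx3 h6 ⊢
    linarith

/-! Part P7c -/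

def ckP : List ℕ := [2, 3, 5, 7, 11, 13, 17, 19, 23, 29, 31, 37, 41, 43, 47, 53, 59, 61, 67, 71, 73, 79, 83, 89, 97]

def ckR (R : ℕ) : List ℕ → ℕ
  | [] => R
  | p :: l => ckR (R / Nat.gcd R (p ^ 20)) l

def ckTest (q k r : ℕ) (LA LB : List ℕ) : Bool :=
  let tn := (LA.map (· - 1)).prod
  let td := LA.prod
  let bd := LB.prod
  let bn := (LB.map (bd / ·)).sum
  let s := LB.length + k
  let dd := bd * 100
  let e := 2 * bn * 100 + 2 * k * bd
  let dn := dd - e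
  let w := 4 ^ LA.length
  let nn := if q % 3 = 1 then 3 * q ^ 2 else q ^ 2
  Nat.ble e dd && (Nat.ble (q ^ 3) (r * r) && (Nat.ble (6 + 10 * r * w) (q ^ 3 + 5 * r) &&
    Nat.blt (nn * (td * td) * dd + tn * tn * (dn * (6 + 10 * r * w) + dd * (5 * r * w * (2 * s))))
      (tn * tn * (dn * (q ^ 3 + 5 * r) + dd * (5 * r * w)))))

def ckNewton (N : ℕ) : ℕ :=
  let f := fun x => (x + N / x) / 2
  f (f (f (f (f (2 ^ (Nat.log2 N / 2 + 1))))))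

def ckLog (R : ℕ) : ℕ :=
  bif Nat.blt R 100 then 0 else bif Nat.blt R 10000 then 1 else bif Nat.blt R 1000000 then 2 else
  bif Nat.blt R 100000000 then 3 else bif Nat.blt R 10000000000 then 4 else bif Nat.blt R 1000000000000 then 5 else 6

def ckCore (q k r : ℕ) (F : List ℕ) (c : ℕ) : Bool :=
  ckTest q k r (F.filter (fun p => Nat.blt p c)) (F.filter (fun p => !(Nat.blt p c)))

def ckMain (q : ℕ) : Bool :=
  let n := q ^ 3 - 1
  let R := ckR n ckP
  let k := ckLog R
  let r := ckNewton (q ^ 3) + 1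
  let F := ckP.filter (fun p => Nat.beq (n % p) 0)
  Nat.blt R (100 ^ (k + 1)) && (ckCore q k r F 6 || ckCore q k r F 4)

def ckSkip (q p : ℕ) : Bool := Nat.beq (q % p) 0 && !(Nat.beq (p ^ 20 % q) 0)

def ckExc : List ℕ := [2, 4, 8, 16, 3, 9, 27, 81, 5, 25, 7, 49, 11, 121, 13, 17, 19, 23, 29, 31, 37, 43, 61, 67, 71, 79, 151, 211, 331]

def ckOne (q : ℕ) : Bool :=
  ckSkip q 2 || (ckSkip q 3 || (ckSkip q 5 || (ckSkip q 7 || ((bif Nat.blt q 332 then ckExc.any (Nat.beq q) else false) || ckMain q))))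

def ckAll : ℕ → ℕ → Bool
  | 0, lo => ckOne lo
  | d + 1, lo => ckAll d lo && ckAll d (lo + 2 ^ d)

lemma ckAll_spec (d : ℕ) : ∀ lo, ckAll d lo = true → ∀ q, lo ≤ q → q < lo + 2 ^ d → ckOne q = true := by
  induction d with
  | zero => intro lo h q h1 h2; have : q = lo := by omega
            subst this; exact h
  | succ d ih =>
    intro lo h q h1 h2
    simp only [ckAll, Bool.and_eq_true] at h
    rw [pow_succ] at h2
    by_cases h3 : q < lo + 2 ^ d
    · exact ih _ h.1 q h1 h3
    · exact ih _ h.2 q (by omega) (by omega)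

lemma ck_run0 : ckAll 14 2 = true := by decide +kernel

lemma ck_run1 : ckAll 12 16386 = true := by decide +kernel

lemma ck_one (q : ℕ) (h1 : 2 ≤ q) (h2 : q < 20000) : ckOne q = true := by
  by_cases h : q < 16386
  · exact ckAll_spec 14 2 ck_run0 q h1 (by norm_num; omega)
  · exact ckAll_spec 12 16386 ck_run1 q (by omega) (by norm_num; omega)

lemma ckR_spec (l : List ℕ) : ∀ R u : ℕ, 0 < R → u ∣ R → (∀ p ∈ l, Nat.Coprime u p) → 0 < ckR R l ∧ u ∣ ckR R l := by
  induction l with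
  | nil => intro R u h1 h2 _; exact ⟨h1, h2⟩
  | cons p l ih =>
    intro R u h1 h2 h3
    have hg : Nat.gcd R (p ^ 20) ∣ R := Nat.gcd_dvd_left _ _
    have hcop : Nat.Coprime u (Nat.gcd R (p ^ 20)) :=
      Nat.Coprime.coprime_dvd_right (Nat.gcd_dvd_right _ _) ((h3 p (by simp)).pow_right 20)
    refine ih _ _ (Nat.div_pos (Nat.le_of_dvd h1 hg) (Nat.gcd_pos_of_pos_left _ h1)) ?_
      (fun r hr => h3 r (by simp [hr]))
    apply hcop.dvd_of_dvd_mul_left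
    rwa [Nat.mul_div_cancel' hg]

lemma ckP_prime : ∀ p ∈ ckP, p.Prime := by
  intro p hp
  simp only [ckP, List.mem_cons, List.not_mem_nil, or_false] at hp
  rcases hp with h | h | h | h | h | h | h | h | h | h | h | h | h | h | h | h | h | h | h | h | h | h | h | h | h <;>
    (subst h; norm_num)

lemma ckP_mem (p : ℕ) (h : p.Prime) (h1 : p < 100) : p ∈ ckP := by
  revert h
  interval_cases p <;> first | (intro _; decide) | (intro h; exact absurd h (by norm_num))

lemma ck_theta (l : List ℕ) (hl : ∀ p ∈ l, 0 < p) :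
    (((l.map (· - 1)).prod : ℕ) : ℝ) / ((l.prod : ℕ) : ℝ) = (l.map (fun p : ℕ => 1 - 1 / (p:ℝ))).prod := by
  induction l with
  | nil => simp
  | cons p l ih =>
    have hp := hl p (by simp)
    have hp' : (p:ℝ) ≠ 0 := by exact_mod_cast hp.ne'
    have hc : ((p - 1 : ℕ) : ℝ) = p - 1 := by rw [Nat.cast_sub hp]; simp
    simp only [List.map_cons, List.prod_cons, Nat.cast_mul]
    rw [← ih (fun r hr => hl r (by simp [hr])), mul_div_mul_comm, hc]
    congr 1
    field_simp

lemma ck_sum (l : List ℕ) (b : ℕ) (hb : 0 < b) (hl : ∀ p ∈ l, 0 < p ∧ p ∣ b) :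
    (((l.map (b / ·)).sum : ℕ) : ℝ) / b = (l.map (fun p : ℕ => 1 / (p:ℝ))).sum := by
  induction l with
  | nil => simp
  | cons p l ih =>
    have hp := hl p (by simp)
    have hp' : (p:ℝ) ≠ 0 := by exact_mod_cast hp.1.ne'
    have hb' : (b:ℝ) ≠ 0 := by exact_mod_cast hb.ne'
    simp only [List.map_cons, List.sum_cons, Nat.cast_add]
    rw [← ih (fun r hr => hl r (by simp [hr])), add_div, Nat.cast_div hp.2 hp']
    congr 1
    field_simp

lemma ck_test (q k r : ℕ) (hq : 2 ≤ q) (LA LB : List ℕ) (hA : LA.Nodup) (hB : LB.Nodup) (hAp : ∀ p ∈ LA, p.Prime)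
    (hBp : ∀ p ∈ LB, p.Prime) (U : Finset ℕ) (hAB : ∀ p ∈ LA, p ∉ LB) (hAU : ∀ p ∈ LA, p ∉ U) (hBU : ∀ p ∈ LB, p ∉ U)
    (hU : ∀ p ∈ U, 100 ≤ p) (hUc : U.card ≤ k) (hall : LA.toFinset ∪ (LB.toFinset ∪ U) = (q ^ 3 - 1).primeFactors)
    (h : ckTest q k r LA LB = true) : SvCrit q := by
  classical
  simp only [ckTest, Bool.and_eq_true, Nat.ble_eq, Nat.blt_eq] at h
  set tn := (LA.map (· - 1)).prod with htn
  set td := LA.prod with htd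
  set bd := LB.prod with hbd
  set bn := (LB.map (bd / ·)).sum with hbn
  set s := LB.length + k with hs
  set e := 2 * bn * 100 + 2 * k * bd with he
  set w := 4 ^ LA.length with hw
  set nn := if q % 3 = 1 then 3 * q ^ 2 else q ^ 2 with hnn
  obtain ⟨h1, h2, h3, h4⟩ := h
  have htd0 : 0 < td := List.prod_pos fun p hp => (hAp p hp).pos
  have hbd0 : 0 < bd := List.prod_pos fun p hp => (hBp p hp).pos
  have htd' : (0:ℝ) < td := by exact_mod_cast htd0
  have hbd' : (0:ℝ) < bd := by exact_mod_cast hbd0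
  set dn := bd * 100 - e with hdn
  have hdn' : (dn:ℝ) = bd * 100 - (2 * bn * 100 + 2 * k * bd) := by
    rw [hdn, Nat.cast_sub h1, he]; push_cast; ring
  have hθ := ck_theta LA (fun p hp => (hAp p hp).pos)
  have hσ := ck_sum LB bd hbd0 (fun p hp => ⟨(hBp p hp).pos, List.dvd_prod hp⟩)
  rw [← htn, ← htd] at hθ
  rw [← hbn] at hσ
  have hdisB : Disjoint LB.toFinset U := by
    rw [Finset.disjoint_left]; intro p hp; exact hBU p (List.mem_toFinset.1 hp)
  have hsumU : ∑ p ∈ U, 1 / (p:ℝ) ≤ k * (1 / 100) := by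
    have e1 : ∑ p ∈ U, 1 / (p:ℝ) ≤ U.card * (1 / 100 : ℝ) := by
      rw [← nsmul_eq_mul]
      refine Finset.sum_le_card_nsmul _ _ _ fun b hb => ?_
      exact one_div_le_one_div_of_le (by norm_num) (by exact_mod_cast hU b hb)
    refine e1.trans ?_
    gcongr
  have hsum : ∑ p ∈ LB.toFinset ∪ U, 1 / (p:ℝ) ≤ bn / bd + k * (1 / 100) := by
    rw [Finset.sum_union hdisB, List.sum_toFinset _ hB, ← hσ]
    linarith
  have hd : (dn:ℝ) / (bd * 100) = 1 - 2 * (bn / bd + k * (1 / 100)) := by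
    rw [hdn']; field_simp
  have hcardA : LA.toFinset.card = LA.length := List.toFinset_card_of_nodup hA
  refine cr_real q LA.toFinset (LB.toFinset ∪ U) ?_ hall (tn / td) w (dn / (bd * 100)) r s (by positivity) ?_ ?_
    (by positivity) ?_ ?_ (by positivity) ?_ (Or.inr ?_) ?_
  · rw [Finset.disjoint_left]
    intro p hp hp2
    rw [List.mem_toFinset] at hp
    rcases Finset.mem_union.1 hp2 with h5 | h5
    · exact hAB p hp (List.mem_toFinset.1 h5)
    · exact hAU p hp h5
  · rw [List.prod_toFinset _ hA, ← hθ]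
  · rw [hcardA, hw, ← pow_mul, mul_comm, pow_mul]; push_cast; norm_num
  · rw [hd]; linarith
  · have h5 : (LB.toFinset ∪ U).card ≤ s :=
      (Finset.card_union_le _ _).trans (by rw [List.toFinset_card_of_nodup hB]; omega)
    exact_mod_cast h5
  · rw [sq]; exact_mod_cast h2
  · exact_mod_cast h3
  · have h5 : (nn:ℝ) * (td * td) * (bd * 100) + tn * tn * (dn * (6 + 10 * r * w) + bd * 100 * (5 * r * w * (2 * s))) <
      tn * tn * (dn * (q ^ 3 + 5 * r) + bd * 100 * (5 * r * w)) := by exact_mod_cast h4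
    have h6 : ((tn:ℝ) / td) ^ 2 * (dn / (bd * 100) * ((q:ℝ) ^ 3 - 6 + 5 * r - 10 * r * w) - 5 * r * w * (2 * s - 1)) =
      (tn * tn * (dn * ((q:ℝ) ^ 3 - 6 + 5 * r - 10 * r * w) - bd * 100 * (5 * r * w * (2 * s - 1)))) / (td * td * (bd * 100)) := by
      field_simp
    rw [h6, lt_div_iff₀ (by positivity)]
    linarith

lemma ck_main (q : ℕ) (hq : 2 ≤ q) (h : ckMain q = true) : SvCrit q := by
  classical
  simp only [ckMain, Bool.and_eq_true, Nat.blt_eq] at h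
  set n := q ^ 3 - 1 with hn
  have hq3 : 1 < q ^ 3 := Nat.one_lt_pow (by norm_num) (by omega)
  have hn0 : 0 < n := by omega
  set k := ckLog (ckR n ckP) with hk
  set r := ckNewton (q ^ 3) + 1 with hr
  set F := ckP.filter (fun p => Nat.beq (n % p) 0) with hF
  obtain ⟨h1, h2⟩ := h
  set U := n.primeFactors.filter (100 ≤ ·) with hU
  have hU100 : ∀ p ∈ U, 100 ≤ p := fun p hp => (Finset.mem_filter.1 hp).2
  have hP100 : ∀ p ∈ ckP, p < 100 := by decide
  have hFm : ∀ p, p ∈ F ↔ p ∈ ckP ∧ p ∣ n := by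
    intro p
    rw [hF, List.mem_filter, Nat.beq_eq, Nat.dvd_iff_mod_eq_zero]
  have hUc : U.card ≤ k := by
    have hu : ∏ p ∈ U, p ∣ n := (Finset.prod_dvd_prod_of_subset _ _ _ (Finset.filter_subset _ _)).trans
      (Nat.prod_primeFactors_dvd n)
    have e1 := ckR_spec ckP n (∏ p ∈ U, p) hn0 hu (by
      intro p hp
      refine Nat.Coprime.prod_left fun u hu => ?_
      rw [Nat.coprime_primes (Nat.prime_of_mem_primeFactors (Finset.mem_filter.1 hu).1) (ckP_prime p hp)]
      have := hU100 u hu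
      have := hP100 p hp
      omega)
    have e2 := Nat.le_of_dvd e1.1 e1.2
    have e3 : 100 ^ U.card ≤ ∏ p ∈ U, p := by
      rw [← Finset.prod_const]; exact Finset.prod_le_prod' fun b hb => hU100 b hb
    have e4 : 100 ^ U.card < 100 ^ (k + 1) := lt_of_le_of_lt (e3.trans e2) h1
    have := (Nat.pow_lt_pow_iff_right (by norm_num)).1 e4
    omega
  have key : ∀ c, ckCore q k r F c = true → SvCrit q := by
    intro c hc
    have hFn : F.Nodup := List.Nodup.filter _ (by decide)
    refine ck_test q k r hq _ _ (hFn.filter _) (hFn.filter _) ?_ ?_ U ?_ ?_ ?_ hU100 hUc ?_ hc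
    · intro p hp
      exact ckP_prime p ((hFm p).1 (List.mem_filter.1 hp).1).1
    · intro p hp
      exact ckP_prime p ((hFm p).1 (List.mem_filter.1 hp).1).1
    · intro p hp hp2
      have h3 := (List.mem_filter.1 hp).2
      have h4 := (List.mem_filter.1 hp2).2
      simp [h3] at h4
    · intro p hp hp2
      have := hP100 p ((hFm p).1 (List.mem_filter.1 hp).1).1
      have := hU100 p hp2
      omega
    · intro p hp hp2
      have := hP100 p ((hFm p).1 (List.mem_filter.1 hp).1).1
      have := hU100 p hp2
      omega
    · ext p
      simp only [Finset.mem_union, List.mem_toFinset, List.mem_filter, hFm]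
      rw [hU, Finset.mem_filter, Nat.mem_primeFactors]
      constructor
      · rintro (h3 | h3 | h3)
        · exact ⟨ckP_prime p h3.1.1, h3.1.2, hn0.ne'⟩
        · exact ⟨ckP_prime p h3.1.1, h3.1.2, hn0.ne'⟩
        · exact h3.1
      · intro h3
        by_cases h4 : 100 ≤ p
        · exact Or.inr (Or.inr ⟨h3, h4⟩)
        · have h5 := ckP_mem p h3.1 (by omega)
          cases h6 : Nat.blt p c
          · right; left; exact ⟨⟨h5, h3.2.1⟩, by simp⟩
          · left; exact ⟨⟨h5, h3.2.1⟩, rfl⟩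
  rcases Bool.or_eq_true _ _ ▸ h2 with h3 | h3
  · exact key _ h3
  · exact key _ h3

lemma ck_skip (q p : ℕ) (hp : p.Prime) (hq : IsPrimePow q) (hlt : q < 20000) : ckSkip q p = false := by
  by_contra h
  rw [Bool.not_eq_false] at h
  simp only [ckSkip, Bool.and_eq_true, Nat.beq_eq, Bool.not_eq_true'] at h
  obtain ⟨h1, h2⟩ := h
  obtain ⟨r, m, hr, hm, rfl⟩ := (isPrimePow_nat_iff _).1 hq
  have h3 : p ∣ r := hp.dvd_of_dvd_pow (Nat.dvd_of_mod_eq_zero h1)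
  have h4 : p = r := (Nat.prime_dvd_prime_iff_eq hp hr).1 h3
  subst h4
  have h5 : m ≤ 20 := by
    by_contra h6
    have : 2 ^ 20 ≤ p ^ m := (Nat.pow_le_pow_left hp.two_le 20).trans (Nat.pow_le_pow_right hp.pos (by omega))
    omega
  have h6 : p ^ 20 % p ^ m = 0 := Nat.mod_eq_zero_of_dvd (pow_dvd_pow p h5)
  rw [h6] at h2
  exact absurd h2 (by decide)

lemma ck_small (q : ℕ) (hq : IsPrimePow q) (hlt : q < 20000) (hex : q ∉ ckExc) : SvCrit q := by
  have h2 : 2 ≤ q := hq.two_le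
  have h := ck_one q h2 hlt
  rw [ckOne, ck_skip q 2 (by norm_num) hq hlt, ck_skip q 3 (by norm_num) hq hlt, ck_skip q 5 (by norm_num) hq hlt,
    ck_skip q 7 (by norm_num) hq hlt] at h
  have h3 : (bif Nat.blt q 332 then ckExc.any (Nat.beq q) else false) = false := by
    cases Nat.blt q 332
    · rfl
    · simp only [cond_true]
      rw [List.any_eq_false]
      intro x hx h4
      rw [Nat.beq_eq] at h4
      exact hex (h4 ▸ hx)
  rw [h3] at h
  simp only [Bool.false_or] at h
  exact ck_main q h2 h

lemma ck_final (q : ℕ) (hq : IsPrimePow q) (hex : q ∉ ckExc) : SvCrit q := by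
  rcases lt_or_ge q 20000 with h | h
  · exact ck_small q hq h hex
  · rcases lt_or_ge q 60000000 with h' | h'
    · exact cr_mid q h h'
    · exact cr_large q h'

theorem stmt8 (q : ℕ) (hq : IsPrimePow q)
    (h : q ∉ ({2, 4, 8, 16, 3, 9, 27, 81, 5, 25, 7, 49, 11, 121, 13, 17, 19, 23, 29, 31,
      37, 43, 61, 67, 71, 79, 151, 211, 331} : Finset ℕ)) :
    memB 3 2 q 3 := by
  exact as_main q (ck_final q hq (fun hm => h (by simpa [ckExc] using hm)))
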